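/- For any A > 0 there exists C(A) such that for all reals Y₀ > 1, x ≥ 1, and coprime integers a, q with q ≥ 1, one has |∑_{n ≤ x, n ≡ a (mod q), P⁻(n) ≥ Y₀} μ(n) − (1/φ(q)) ∑_{n ≤ x, (n,q)=1, P⁻(n) ≥ Y₀} μ(n)| ≤ C(A)·x/(log 3x)^A. -/

import Mathlib

open Finset Real

/-- The indicator `𝔜₀` of integers all of whose prime factors are `≥ Y₀`. -/
noncomputable def YInd (Y₀ : ℝ) (n : ℕ) : ℝ :=
  if ∀ p ∈ n.primeFactors, Y₀ ≤ (p : ℝ) then 1 else 0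

namespace SiegelWalfisz

/-! ### Bounds for Dirichlet `L`-functions and the zeta function near the line `Re s = 1` -/

theorem norm_cpow_neg_sub_le {a b : ℝ} (ha : 0 < a) (hab : a ≤ b) {s : ℂ} (hs : 0 ≤ s.re) :
    ‖(b : ℂ) ^ (-s) - (a : ℂ) ^ (-s)‖ ≤ ‖s‖ * a ^ (-s.re - 1) * (b - a) := by
  have key := (convex_Icc a b).norm_image_sub_le_of_norm_hasDerivWithin_le
    (f := fun t : ℝ => (t : ℂ) ^ (-s)) (f' := fun t : ℝ => -s * (t : ℂ) ^ (-s - 1))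
    (C := ‖s‖ * a ^ (-s.re - 1)) (x := a) (y := b) ?_ ?_ (Set.left_mem_Icc.2 hab)
    (Set.right_mem_Icc.2 hab)
  · simpa [abs_of_nonneg (sub_nonneg.2 hab)] using key
  · intro t ht
    have ht0 : 0 < t := ha.trans_le ht.1
    have := (hasStrictDerivAt_id (t : ℂ)).cpow_const (c := -s)
      (Or.inl (by simpa using ht0))
    simpa using this.hasDerivAt.comp_ofReal.hasDerivWithinAt
  · intro t ht
    have ht0 : 0 < t := ha.trans_le ht.1
    rw [norm_mul, norm_neg, Complex.norm_cpow_eq_rpow_re_of_pos ht0]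
    have : (-s - 1).re = -s.re - 1 := by simp
    rw [this]
    exact mul_le_mul_of_nonneg_left
      (rpow_le_rpow_of_nonpos ha ht.1 (by linarith)) (norm_nonneg _)

theorem norm_cpow_neg_sub_le_rpow {a b : ℝ} (ha : 0 < a) (hab : a ≤ b) {s : ℂ} (hs : 0 ≤ s.re)
    {θ : ℝ} (hθ : 0 ≤ θ) (hθ' : θ ≤ 1) :
    ‖(b : ℂ) ^ (-s) - (a : ℂ) ^ (-s)‖ ≤ 2 * a ^ (-s.re) * (‖s‖ * (b - a) / a) ^ θ := by
  have hb : 0 < b := ha.trans_le hab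
  have hy : 0 ≤ ‖s‖ * (b - a) / a := by
    have := sub_nonneg.2 hab
    positivity
  have h1 : ‖(b : ℂ) ^ (-s) - (a : ℂ) ^ (-s)‖ ≤ 2 * a ^ (-s.re) := by
    refine (norm_sub_le _ _).trans ?_
    rw [Complex.norm_cpow_eq_rpow_re_of_pos ha, Complex.norm_cpow_eq_rpow_re_of_pos hb,
      Complex.neg_re]
    linarith [rpow_le_rpow_of_nonpos ha hab (by linarith : -s.re ≤ 0)]
  have h2 : ‖(b : ℂ) ^ (-s) - (a : ℂ) ^ (-s)‖ ≤ a ^ (-s.re) * (‖s‖ * (b - a) / a) := by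
    refine (norm_cpow_neg_sub_le ha hab hs).trans (le_of_eq ?_)
    rw [rpow_sub_one ha.ne']
    ring
  have ha' : 0 < a ^ (-s.re) := rpow_pos_of_pos ha _
  rcases le_total 1 (‖s‖ * (b - a) / a) with h | h
  · refine h1.trans ?_
    have : 1 ≤ (‖s‖ * (b - a) / a) ^ θ := one_le_rpow h hθ
    nlinarith
  · refine h2.trans ?_
    have : (‖s‖ * (b - a) / a) ≤ (‖s‖ * (b - a) / a) ^ θ := by
      rcases hy.eq_or_lt with h0 | h0
      · rw [← h0]; exact rpow_nonneg le_rfl _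
      · simpa using rpow_le_rpow_of_exponent_ge h0 h hθ'
    nlinarith

/-- The `m`-th block of length `q` of the Dirichlet series of `χ`. -/
noncomputable def block {q : ℕ} (χ : DirichletCharacter ℂ q) (m : ℕ) (s : ℂ) : ℂ :=
  ∑ r : Fin q, χ ((r : ℕ) + 1 : ℕ) * ((m * q + r + 1 : ℕ) : ℂ) ^ (-s)

theorem differentiable_block {q : ℕ} (χ : DirichletCharacter ℂ q) (m : ℕ) :
    Differentiable ℂ (block χ m) := by
  unfold block
  refine Differentiable.fun_sum fun r _ => ?_
  refine Differentiable.const_mul ?_ _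
  intro s
  refine DifferentiableAt.const_cpow differentiableAt_id.neg (Or.inl ?_)
  exact Nat.cast_ne_zero.2 (Nat.succ_ne_zero _)

theorem sum_fin_eq_zero {q : ℕ} [NeZero q] {χ : DirichletCharacter ℂ q} (hχ : χ ≠ 1) :
    ∑ r : Fin q, χ ((r : ℕ) + 1 : ℕ) = 0 := by
  have h := MulChar.sum_eq_zero_of_ne_one hχ
  rw [← h, ← Equiv.sum_comp (Equiv.addRight (1 : ZMod q))]
  obtain ⟨k, rfl⟩ : ∃ k, q = k + 1 := ⟨q - 1, by have := NeZero.pos q; omega⟩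
  refine Fintype.sum_congr _ _ fun r => ?_
  congr 1
  push_cast
  have : ((r : ℕ) : ZMod (k + 1)) = (r : ZMod (k+1)) := ZMod.natCast_zmod_val (n := k+1) r
  rw [this]
  rfl

theorem hasSum_block {q : ℕ} [NeZero q] (χ : DirichletCharacter ℂ q) {s : ℂ} (hs : 1 < s.re) :
    HasSum (fun m => block χ m s) (DirichletCharacter.LFunction χ s) := by
  rw [DirichletCharacter.LFunction_eq_LSeries χ hs]
  have h := (DirichletCharacter.LSeriesSummable_of_one_lt_re χ hs).hasSum
  change HasSum _ (LSeries _ s) at h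
  have h1 : HasSum (fun n => LSeries.term (fun n => χ n) s (n + 1))
      (LSeries (fun n => χ n) s) := by
    have h' := (hasSum_nat_add_iff' 1).2 h
    simpa using h'
  rw [← (Nat.divModEquiv q).symm.hasSum_iff] at h1
  refine (h1.prod_fiberwise (g := fun m => block χ m s) fun m => ?_)
  have := hasSum_fintype (fun r : Fin q =>
    ((fun n ↦ LSeries.term (fun n ↦ χ ↑n) s (n + 1)) ∘ (Nat.divModEquiv q).symm) (m, r))
  convert this using 1
  unfold block
  refine Finset.sum_congr rfl fun r _ => ?_
  simp only [Function.comp, Nat.divModEquiv_symm_apply]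
  rw [LSeries.term_of_ne_zero (Nat.succ_ne_zero _), Complex.cpow_neg, div_eq_mul_inv]
  congr 2
  push_cast
  simp

theorem norm_block_succ_le {q : ℕ} [NeZero q] {χ : DirichletCharacter ℂ q} (hχ : χ ≠ 1) {ε : ℝ}
    (hε : 0 < ε) (hε' : ε ≤ 1 / 3) {s : ℂ} (hs : 1 - ε ≤ s.re) (m : ℕ) :
    ‖block χ (m + 1) s‖ ≤ 2 * (q : ℝ) ^ ε * ‖s‖ ^ (2 * ε) * ((m + 1 : ℕ) : ℝ) ^ (-1 - ε) := by
  have hq : 0 < (q : ℝ) := by exact_mod_cast NeZero.pos q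
  have hq1 : 1 ≤ (q : ℝ) := by exact_mod_cast NeZero.pos q
  have hm : 0 < ((m + 1 : ℕ) : ℝ) := by positivity
  have hm1 : 1 ≤ ((m + 1 : ℕ) : ℝ) := by simp
  have h0 : block χ (m + 1) s = ∑ r : Fin q, χ ((r : ℕ) + 1 : ℕ) *
      ((((m + 1 : ℕ) * q + (r + 1) : ℝ) : ℂ) ^ (-s) - (((m + 1 : ℕ) * q : ℝ) : ℂ) ^ (-s)) := by
    simp_rw [mul_sub, Finset.sum_sub_distrib, ← Finset.sum_mul, sum_fin_eq_zero hχ, zero_mul,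
      sub_zero]
    unfold block
    refine Finset.sum_congr rfl fun r _ => ?_
    congr 2
    push_cast
    ring
  have hterm : ∀ r : Fin q, ‖χ ((r : ℕ) + 1 : ℕ) *
      ((((m + 1 : ℕ) * q + (r + 1) : ℝ) : ℂ) ^ (-s) - (((m + 1 : ℕ) * q : ℝ) : ℂ) ^ (-s))‖ ≤
      2 * (q : ℝ) ^ (ε - 1) * ‖s‖ ^ (2 * ε) * ((m + 1 : ℕ) : ℝ) ^ (-1 - ε) := by
    intro r
    rw [norm_mul]
    refine (mul_le_of_le_one_left (norm_nonneg _) (χ.norm_le_one _)).trans ?_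
    have hr : ((r : ℕ) : ℝ) + 1 ≤ q := by exact_mod_cast r.2
    refine (norm_cpow_neg_sub_le_rpow (by positivity) (by linarith) (by linarith)
      (by linarith : 0 ≤ 2 * ε) (by linarith)).trans ?_
    have e1 : (((m + 1 : ℕ) : ℝ) * q) ^ (-s.re) ≤
        ((m + 1 : ℕ) : ℝ) ^ (ε - 1) * (q : ℝ) ^ (ε - 1) := by
      rw [mul_rpow hm.le hq.le]
      gcongr <;> first | assumption | linarith
    have e2 : (‖s‖ * ((m + 1 : ℕ) * (q : ℝ) + ((r : ℕ) + 1) - (m + 1 : ℕ) * q) /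
        ((m + 1 : ℕ) * q)) ^ (2 * ε) ≤ ‖s‖ ^ (2 * ε) * ((m + 1 : ℕ) : ℝ) ^ (-(2 * ε)) := by
      rw [rpow_neg hm.le, ← inv_rpow hm.le, ← mul_rpow (norm_nonneg _) (inv_nonneg.2 hm.le)]
      refine rpow_le_rpow ?_ ?_ (by linarith)
      · have : (0:ℝ) ≤ ((r : ℕ) : ℝ) + 1 := by positivity
        rw [add_sub_cancel_left]; positivity
      · rw [add_sub_cancel_left, mul_div_assoc]
        gcongr
        rw [div_le_iff₀ (by positivity), ← mul_assoc, inv_mul_cancel₀ hm.ne', one_mul]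
        exact hr
    calc _ ≤ 2 * (((m + 1 : ℕ) : ℝ) ^ (ε - 1) * (q : ℝ) ^ (ε - 1)) *
          (‖s‖ ^ (2 * ε) * ((m + 1 : ℕ) : ℝ) ^ (-(2 * ε))) := by
          refine mul_le_mul (mul_le_mul_of_nonneg_left e1 (by norm_num)) e2 ?_ (by positivity)
          refine rpow_nonneg (div_nonneg (mul_nonneg (norm_nonneg _) ?_) (by positivity)) _
          linarith [Nat.cast_nonneg (α := ℝ) (r : ℕ)]
      _ = 2 * (q : ℝ) ^ (ε - 1) * ‖s‖ ^ (2 * ε) *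
          (((m + 1 : ℕ) : ℝ) ^ (ε - 1) * ((m + 1 : ℕ) : ℝ) ^ (-(2 * ε))) := by ring
      _ = _ := by rw [← rpow_add hm]; congr 2; ring
  rw [h0]
  refine (norm_sum_le _ _).trans ((Finset.sum_le_sum fun r _ => hterm r).trans (le_of_eq ?_))
  rw [Finset.sum_const, Finset.card_univ, Fintype.card_fin, nsmul_eq_mul, rpow_sub_one hq.ne']
  field_simp

theorem norm_block_zero_le {q : ℕ} [NeZero q] (χ : DirichletCharacter ℂ q) {ε : ℝ}
    (hε : 0 < ε) {s : ℂ} (hs : 1 - ε ≤ s.re) :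
    ‖block χ 0 s‖ ≤ (q : ℝ) ^ (2 * ε) * ∑' m : ℕ, ((m + 1 : ℕ) : ℝ) ^ (-1 - ε) := by
  have hsum : Summable fun m : ℕ => ((m + 1 : ℕ) : ℝ) ^ (-1 - ε) :=
    (summable_nat_add_iff 1).2 (Real.summable_nat_rpow.2 (by linarith))
  have hterm : ∀ r : Fin q, ‖χ ((r : ℕ) + 1 : ℕ) * ((0 * q + r + 1 : ℕ) : ℂ) ^ (-s)‖ ≤
      (q : ℝ) ^ (2 * ε) * (((r : ℕ) + 1 : ℕ) : ℝ) ^ (-1 - ε) := by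
    intro r
    have hr0 : 0 < (((r : ℕ) + 1 : ℕ) : ℝ) := by positivity
    have hr1 : 1 ≤ (((r : ℕ) + 1 : ℕ) : ℝ) := by simp
    have hr : (((r : ℕ) + 1 : ℕ) : ℝ) ≤ q := by exact_mod_cast r.2
    rw [norm_mul]
    refine (mul_le_of_le_one_left (norm_nonneg _) (χ.norm_le_one _)).trans ?_
    rw [zero_mul, zero_add, Complex.norm_natCast_cpow_of_pos (Nat.succ_pos _), Complex.neg_re]
    calc (((r : ℕ) + 1 : ℕ) : ℝ) ^ (-s.re) ≤ (((r : ℕ) + 1 : ℕ) : ℝ) ^ (2 * ε + (-1 - ε)) :=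
          rpow_le_rpow_of_exponent_le hr1 (by linarith)
      _ = (((r : ℕ) + 1 : ℕ) : ℝ) ^ (2 * ε) * (((r : ℕ) + 1 : ℕ) : ℝ) ^ (-1 - ε) :=
          rpow_add hr0 _ _
      _ ≤ _ := by gcongr
  refine (norm_sum_le _ _).trans ((Finset.sum_le_sum fun r _ => hterm r).trans ?_)
  rw [← Finset.mul_sum]
  gcongr
  rw [Fin.sum_univ_eq_sum_range (fun r => ((r + 1 : ℕ) : ℝ) ^ (-1 - ε))]
  exact hsum.sum_le_tsum _ fun i _ => by positivity

theorem hasSum_block_of_lt_re {q : ℕ} [NeZero q] {χ : DirichletCharacter ℂ q} (hχ : χ ≠ 1)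
    {ε : ℝ} (hε : 0 < ε) (hε' : ε ≤ 1 / 3) {s : ℂ} (hs : 1 - ε < s.re) :
    HasSum (fun m => block χ (m + 1) s) (DirichletCharacter.LFunction χ s - block χ 0 s) := by
  set R : ℝ := ‖s‖ + 3 with hR
  set U : Set ℂ := {z | 1 - ε < z.re} ∩ Metric.ball 0 R with hU
  have hsum : Summable fun m : ℕ => ((m + 1 : ℕ) : ℝ) ^ (-1 - ε) :=
    (summable_nat_add_iff 1).2 (Real.summable_nat_rpow.2 (by linarith))
  have hUo : IsOpen U := (isOpen_lt continuous_const Complex.continuous_re).inter Metric.isOpen_ball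
  have hUc : Convex ℝ U := (convex_halfSpace_re_gt _).inter (convex_ball _ _)
  have hu : Summable fun m : ℕ => 2 * (q : ℝ) ^ ε * R ^ (2 * ε) * ((m + 1 : ℕ) : ℝ) ^ (-1 - ε) :=
    hsum.mul_left _
  have hb : ∀ (m : ℕ) (w : ℂ), w ∈ U → ‖block χ (m + 1) w‖ ≤
      2 * (q : ℝ) ^ ε * R ^ (2 * ε) * ((m + 1 : ℕ) : ℝ) ^ (-1 - ε) := by
    intro m w hw
    refine (norm_block_succ_le hχ hε hε' (le_of_lt hw.1) m).trans ?_
    have : ‖w‖ ≤ R := by simpa using (Metric.mem_ball.1 hw.2).le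
    gcongr
  have hd := Complex.differentiableOn_tsum_of_summable_norm hu
    (fun m => (differentiable_block χ (m + 1)).differentiableOn) hUo hb
  have hd2 : DifferentiableOn ℂ (fun s => DirichletCharacter.LFunction χ s - block χ 0 s) U :=
    ((DirichletCharacter.differentiable_LFunction hχ).sub
      (differentiable_block χ 0)).differentiableOn
  have hmem : (2 : ℂ) ∈ U := by
    refine ⟨by simp; linarith, ?_⟩
    simp [hR]
    linarith [norm_nonneg s]
  have heq : (fun w => ∑' m, block χ (m + 1) w) =ᶠ[nhds 2]
      fun s => DirichletCharacter.LFunction χ s - block χ 0 s := by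
    have : {z : ℂ | 1 < z.re} ∈ nhds (2 : ℂ) :=
      (isOpen_lt continuous_const Complex.continuous_re).mem_nhds (by simp)
    filter_upwards [this] with z hz
    have := (hasSum_nat_add_iff' 1).2 (hasSum_block χ hz)
    simpa using this.tsum_eq
  have hE := (hd.analyticOnNhd hUo).eqOn_of_preconnected_of_eventuallyEq
    (hd2.analyticOnNhd hUo) hUc.isPreconnected hmem heq
  have hsU : s ∈ U := ⟨hs, by simp [hR]⟩
  have := hE hsU
  simp only at this
  rw [← this]
  exact (Summable.of_norm_bounded hu fun m => hb m s hsU).hasSum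

theorem exists_norm_LFunction_le {ε : ℝ} (hε : 0 < ε) (hε' : ε ≤ 1 / 3) :
    ∃ C : ℝ, 1 ≤ C ∧ ∀ (q : ℕ) [NeZero q] (χ : DirichletCharacter ℂ q), χ ≠ 1 →
      ∀ s : ℂ, 1 - ε < s.re → s.re ≤ 4 →
        ‖DirichletCharacter.LFunction χ s‖ ≤ C * (q * (|s.im| + 2)) ^ (2 * ε) := by
  have hsum : Summable fun m : ℕ => ((m + 1 : ℕ) : ℝ) ^ (-1 - ε) :=
    (summable_nat_add_iff 1).2 (Real.summable_nat_rpow.2 (by linarith))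
  set Z := ∑' m : ℕ, ((m + 1 : ℕ) : ℝ) ^ (-1 - ε) with hZ
  have hZ1 : 1 ≤ Z := by
    have := hsum.le_tsum 0 fun j _ => by positivity
    rw [hZ]
    simpa using this
  refine ⟨Z + 4 * Z, by linarith, fun q _ χ hχ s hs hs4 => ?_⟩
  have hq : 0 < (q : ℝ) := by exact_mod_cast NeZero.pos q
  have hq1 : 1 ≤ (q : ℝ) := by exact_mod_cast NeZero.pos q
  have h := hasSum_block_of_lt_re hχ hε hε' hs
  have h1 : ‖DirichletCharacter.LFunction χ s - block χ 0 s‖ ≤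
      2 * (q : ℝ) ^ ε * ‖s‖ ^ (2 * ε) * Z := by
    rw [← h.tsum_eq, hZ, ← tsum_mul_left]
    exact tsum_of_norm_bounded (hsum.mul_left _).hasSum
      fun m => norm_block_succ_le hχ hε hε' hs.le m
  have h2 := norm_block_zero_le χ hε hs.le
  have h3 : ‖DirichletCharacter.LFunction χ s‖ ≤
      2 * (q : ℝ) ^ ε * ‖s‖ ^ (2 * ε) * Z + (q : ℝ) ^ (2 * ε) * Z := by
    have := norm_add_le (DirichletCharacter.LFunction χ s - block χ 0 s) (block χ 0 s)
    rw [sub_add_cancel] at this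
    linarith
  have h4 : ‖s‖ ^ (2 * ε) ≤ 2 * (|s.im| + 2) ^ (2 * ε) := by
    have : ‖s‖ ≤ 2 * (|s.im| + 2) := by
      refine (Complex.norm_le_abs_re_add_abs_im s).trans ?_
      rw [abs_of_nonneg (by linarith : 0 ≤ s.re)]
      linarith [abs_nonneg s.im]
    calc ‖s‖ ^ (2 * ε) ≤ (2 * (|s.im| + 2)) ^ (2 * ε) :=
          rpow_le_rpow (norm_nonneg _) this (by linarith)
      _ = 2 ^ (2 * ε) * (|s.im| + 2) ^ (2 * ε) := mul_rpow (by norm_num) (by positivity)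
      _ ≤ _ := by
        gcongr
        simpa using rpow_le_rpow_of_exponent_le (by norm_num : (1:ℝ) ≤ 2)
          (by linarith : 2 * ε ≤ 1)
  have h5 : (q : ℝ) ^ ε ≤ (q : ℝ) ^ (2 * ε) := rpow_le_rpow_of_exponent_le hq1 (by linarith)
  have h6 : 1 ≤ (|s.im| + 2) ^ (2 * ε) :=
    one_le_rpow (by linarith [abs_nonneg s.im]) (by linarith)
  rw [mul_rpow hq.le (by positivity)]
  calc _ ≤ _ := h3
    _ ≤ 2 * (q : ℝ) ^ (2 * ε) * (2 * (|s.im| + 2) ^ (2 * ε)) * Z +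
        (q : ℝ) ^ (2 * ε) * Z * (|s.im| + 2) ^ (2 * ε) := by
      refine add_le_add (by gcongr) (le_mul_of_one_le_right (by positivity) h6)
    _ = _ := by ring

theorem norm_zeta_term_le {a : ℝ} (ha : 0 < a) {s : ℂ} (hs : 1 < s.re) {θ : ℝ} (hθ : 0 ≤ θ)
    (hθ' : θ ≤ 1) :
    ‖(a : ℂ) ^ (-s) - ((a : ℂ) ^ (1 - s) - ((a + 1 : ℝ) : ℂ) ^ (1 - s)) / (s - 1)‖ ≤
      2 * a ^ (-s.re) * (‖s‖ / a) ^ θ := by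
  have hs1 : (1 - s : ℂ) ≠ 0 := fun h => by
    have := congrArg Complex.re h
    simp at this
    linarith
  have hs1' : (s - 1 : ℂ) ≠ 0 := fun h => hs1 (by linear_combination -h)
  have key := (convex_Icc a (a + 1)).norm_image_sub_le_of_norm_hasDerivWithin_le
    (f := fun t : ℝ => (t : ℂ) ^ (1 - s) / (1 - s) - t * (a : ℂ) ^ (-s))
    (f' := fun t : ℝ => (t : ℂ) ^ (-s) - (a : ℂ) ^ (-s))
    (C := 2 * a ^ (-s.re) * (‖s‖ / a) ^ θ) (x := a) (y := a + 1) ?_ ?_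
    (Set.left_mem_Icc.2 (by linarith)) (Set.right_mem_Icc.2 (by linarith))
  · have e : (a : ℂ) ^ (-s) - ((a : ℂ) ^ (1 - s) - ((a + 1 : ℝ) : ℂ) ^ (1 - s)) / (s - 1) =
      -((((a + 1 : ℝ) : ℂ) ^ (1 - s) / (1 - s) - ((a + 1 : ℝ) : ℂ) * (a : ℂ) ^ (-s)) -
        ((a : ℂ) ^ (1 - s) / (1 - s) - a * (a : ℂ) ^ (-s))) := by
      push_cast
      field_simp
      ring
    rw [e, norm_neg]
    simpa using key
  · intro t ht
    have ht0 : 0 < t := ha.trans_le ht.1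
    have h1 := ((hasStrictDerivAt_id (t : ℂ)).cpow_const (c := 1 - s)
      (Or.inl (by simpa using ht0))).hasDerivAt.comp_ofReal
    have h2 := (h1.div_const (1 - s)).sub ((hasDerivAt_id (t : ℂ)).comp_ofReal.mul_const
      ((a : ℂ) ^ (-s)))
    refine HasDerivAt.hasDerivWithinAt ?_
    have e : (t : ℂ) ^ (-s) - (a : ℂ) ^ (-s) =
        (1 - s) * (t : ℂ) ^ (1 - s - 1) * 1 / (1 - s) - 1 * (a : ℂ) ^ (-s) := by
      rw [mul_one, mul_div_cancel_left₀ _ hs1, one_mul]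
      congr 2
      ring
    rw [e]
    exact h2
  · intro t ht
    have ht0 : 0 < t := ha.trans_le ht.1
    refine (norm_cpow_neg_sub_le_rpow ha ht.1 (by linarith) hθ hθ').trans ?_
    have h1 : 0 ≤ t - a := by linarith [ht.1]
    have h2 : ‖s‖ * (t - a) ≤ ‖s‖ := mul_le_of_le_one_right (norm_nonneg _) (by linarith [ht.2])
    gcongr

theorem exists_norm_zeta_sub_le {ε : ℝ} (hε : 0 < ε) (hε' : ε ≤ 1) :
    ∃ C : ℝ, 1 ≤ C ∧ ∀ s : ℂ, 1 < s.re → s.re ≤ 4 →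
      ‖riemannZeta s - 1 / (s - 1)‖ ≤ C * (|s.im| + 2) ^ ε := by
  have hsum : Summable fun m : ℕ => ((m + 1 : ℕ) : ℝ) ^ (-1 - ε) :=
    (summable_nat_add_iff 1).2 (Real.summable_nat_rpow.2 (by linarith))
  set Z := ∑' m : ℕ, ((m + 1 : ℕ) : ℝ) ^ (-1 - ε) with hZ
  have hZ1 : 1 ≤ Z := by
    have := hsum.le_tsum 0 fun j _ => by positivity
    rw [hZ]
    simpa using this
  refine ⟨4 * Z, by linarith, fun s hs hs4 => ?_⟩
  have hs1' : (s - 1 : ℂ) ≠ 0 := fun h => by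
    have := congrArg Complex.re h
    simp at this
    linarith
  have hnorm : ‖s‖ ^ ε ≤ 2 * (|s.im| + 2) ^ ε := by
    have : ‖s‖ ≤ 2 * (|s.im| + 2) := by
      refine (Complex.norm_le_abs_re_add_abs_im s).trans ?_
      rw [abs_of_nonneg (by linarith : 0 ≤ s.re)]
      linarith [abs_nonneg s.im]
    calc ‖s‖ ^ ε ≤ (2 * (|s.im| + 2)) ^ ε :=
          rpow_le_rpow (norm_nonneg _) this (by linarith)
      _ = 2 ^ ε * (|s.im| + 2) ^ ε := mul_rpow (by norm_num) (by positivity)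
      _ ≤ _ := by
        gcongr
        simpa using rpow_le_rpow_of_exponent_le (by norm_num : (1:ℝ) ≤ 2) hε'
  set D : ℕ → ℂ := fun n => ((n + 1 : ℕ) : ℂ) ^ (-s) -
    (((n + 1 : ℕ) : ℂ) ^ (1 - s) - ((n + 1 + 1 : ℕ) : ℂ) ^ (1 - s)) / (s - 1) with hD
  have hDb : ∀ n, ‖D n‖ ≤ 2 * ‖s‖ ^ ε * ((n + 1 : ℕ) : ℝ) ^ (-1 - ε) := by
    intro n
    have hn : 0 < ((n + 1 : ℕ) : ℝ) := by positivity
    have hn1 : 1 ≤ ((n + 1 : ℕ) : ℝ) := by simp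
    have := norm_zeta_term_le hn hs hε.le hε'
    have e : D n = (((n + 1 : ℕ) : ℝ) : ℂ) ^ (-s) - ((((n + 1 : ℕ) : ℝ) : ℂ) ^ (1 - s) -
        ((((n + 1 : ℕ) : ℝ) + 1 : ℝ) : ℂ) ^ (1 - s)) / (s - 1) := by
      simp [hD]
    rw [e]
    refine this.trans ?_
    rw [div_rpow (norm_nonneg _) hn.le, sub_eq_add_neg (-1 : ℝ), rpow_add hn, rpow_neg hn.le ε]
    calc _ = 2 * ‖s‖ ^ ε * (((n + 1 : ℕ) : ℝ) ^ (-s.re) * (((n + 1 : ℕ) : ℝ) ^ ε)⁻¹) := by ring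
      _ ≤ _ := by gcongr
  have hpart : ∀ N : ℕ, ‖∑ n ∈ range N, D n‖ ≤ 2 * ‖s‖ ^ ε * Z := by
    intro N
    refine (norm_sum_le _ _).trans ((Finset.sum_le_sum fun n _ => hDb n).trans ?_)
    rw [← Finset.mul_sum]
    gcongr
    exact hsum.sum_le_tsum _ fun i _ => by positivity
  have hlim : Filter.Tendsto (fun N : ℕ => ∑ n ∈ range N, D n) Filter.atTop
      (nhds (riemannZeta s - 1 / (s - 1))) := by
    have e : ∀ N : ℕ, ∑ n ∈ range N, D n = ∑ n ∈ range N, ((n + 1 : ℕ) : ℂ) ^ (-s) -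
        (1 - ((N + 1 : ℕ) : ℂ) ^ (1 - s)) / (s - 1) := by
      intro N
      simp only [hD]
      rw [Finset.sum_sub_distrib, ← Finset.sum_div,
        Finset.sum_range_sub' (fun n => ((n + 1 : ℕ) : ℂ) ^ (1 - s))]
      simp
    simp_rw [e]
    refine Filter.Tendsto.sub ?_ ?_
    · have h := (Complex.summable_one_div_nat_cpow.2 hs).hasSum
      rw [← zeta_eq_tsum_one_div_nat_cpow hs] at h
      have h' := (hasSum_nat_add_iff' 1).2 h
      have h'' := h'.tendsto_sum_nat
      have hs0 : s ≠ 0 := fun h => by simp [h] at hs; linarith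
      simpa [hs0, Complex.cpow_neg] using h''
    · have : Filter.Tendsto (fun N : ℕ => ((N + 1 : ℕ) : ℂ) ^ (1 - s)) Filter.atTop (nhds 0) := by
        rw [tendsto_zero_iff_norm_tendsto_zero]
        have h1 : ∀ N : ℕ, ‖((N + 1 : ℕ) : ℂ) ^ (1 - s)‖ = ((N + 1 : ℕ) : ℝ) ^ (-(s.re - 1)) := by
          intro N
          rw [Complex.norm_natCast_cpow_of_pos (Nat.succ_pos _)]
          simp
        simp_rw [h1]
        exact (tendsto_rpow_neg_atTop (by linarith : 0 < s.re - 1)).comp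
          (tendsto_natCast_atTop_atTop.comp (Filter.tendsto_add_atTop_nat 1))
      simpa using ((tendsto_const_nhds (x := (1 : ℂ))).sub this).div_const (s - 1)
  refine (le_of_tendsto hlim.norm (Filter.Eventually.of_forall hpart)).trans ?_
  calc 2 * ‖s‖ ^ ε * Z ≤ 2 * (2 * (|s.im| + 2) ^ ε) * Z := by gcongr
    _ = _ := by ring

theorem prod_one_add_inv_le (S : Finset ℕ) (hS : ∀ n ∈ S, 1 ≤ n) :
    ∏ n ∈ S, (1 + (n : ℝ)⁻¹) ≤ (#S : ℝ) + 1 := by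
  induction S using Finset.induction_on_max with
  | empty => simp
  | insert a S ha ih =>
    have ha' : a ∉ S := fun h => lt_irrefl _ (ha a h)
    have ih' := ih fun n hn => hS n (Finset.mem_insert_of_mem hn)
    rw [Finset.prod_insert ha', Finset.card_insert_of_notMem ha']
    have ha1 : 1 ≤ a := hS a (Finset.mem_insert_self _ _)
    have hc : #S + 1 ≤ a := by
      have : S ⊆ Finset.Ico 1 a := fun n hn =>
        Finset.mem_Ico.2 ⟨hS n (Finset.mem_insert_of_mem hn), ha n hn⟩
      have := Finset.card_le_card this
      rw [Nat.card_Ico] at this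
      omega
    have hc' : ((#S : ℝ) + 1) ≤ a := by exact_mod_cast hc
    have h1 : (a : ℝ)⁻¹ ≤ ((#S : ℝ) + 1)⁻¹ := inv_anti₀ (by positivity) hc'
    calc (1 + (a : ℝ)⁻¹) * ∏ n ∈ S, (1 + (n : ℝ)⁻¹) ≤ (1 + ((#S : ℝ) + 1)⁻¹) * ((#S : ℝ) + 1) := by
          gcongr
      _ = _ := by
        push_cast
        field_simp

theorem card_primeFactors_add_one_le {ε : ℝ} (hε : 0 < ε) {q : ℕ} (hq : q ≠ 0) :
    (#q.primeFactors : ℝ) + 1 ≤ (2 / ε + 1) * (q : ℝ) ^ ε := by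
  have hq0 : 0 < (q : ℝ) := by exact_mod_cast Nat.pos_of_ne_zero hq
  have hq1 : 1 ≤ (q : ℝ) := by exact_mod_cast Nat.pos_of_ne_zero hq
  have h1 : 2 ^ #q.primeFactors ≤ q := by
    refine le_trans ?_ (Nat.le_of_dvd (Nat.pos_of_ne_zero hq) (Nat.prod_primeFactors_dvd q))
    exact Finset.pow_card_le_prod _ _ _ fun p hp => (Nat.prime_of_mem_primeFactors hp).two_le
  have h2 : (#q.primeFactors : ℝ) * log 2 ≤ log q := by
    rw [← log_pow]
    exact log_le_log (by positivity) (by exact_mod_cast h1)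
  have h3 : log q ≤ (q : ℝ) ^ ε / ε := log_le_rpow_div hq0.le hε
  have h4 : (1 : ℝ) ≤ (q : ℝ) ^ ε := one_le_rpow hq1 hε.le
  have h5 := log_two_gt_d9
  have h6 : (#q.primeFactors : ℝ) ≤ 2 * log q := by
    have : (0 : ℝ) ≤ #q.primeFactors := by positivity
    nlinarith
  have h7 : 2 * log q ≤ 2 / ε * (q : ℝ) ^ ε := by
    calc 2 * log q ≤ 2 * ((q : ℝ) ^ ε / ε) := by gcongr
      _ = _ := by ring
  linarith

theorem exists_norm_LFunction_one_le {ε : ℝ} (hε : 0 < ε) (hε' : ε ≤ 1) :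
    ∃ C : ℝ, 1 ≤ C ∧ ∀ (q : ℕ) [NeZero q], ∀ s : ℂ, 1 < s.re → s.re ≤ 4 →
      ‖DirichletCharacter.LFunction (1 : DirichletCharacter ℂ q) s‖ ≤
        C * (‖s - 1‖⁻¹ + 1) * (q * (|s.im| + 2)) ^ ε := by
  obtain ⟨C, hC1, hC⟩ := exists_norm_zeta_sub_le hε hε'
  refine ⟨(2 / ε + 1) * C, ?_, fun q _ s hs hs4 => ?_⟩
  · have : 0 < 2 / ε := by positivity
    nlinarith
  have hs1 : s ≠ 1 := fun h => by simp [h] at hs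
  have hprod : ‖∏ p ∈ q.primeFactors, (1 - (p : ℂ) ^ (-s))‖ ≤ (2 / ε + 1) * (q : ℝ) ^ ε := by
    rw [norm_prod]
    refine le_trans (Finset.prod_le_prod (fun _ _ => norm_nonneg _) fun p hp => ?_)
      ((prod_one_add_inv_le q.primeFactors
        fun n hn => (Nat.prime_of_mem_primeFactors hn).one_le).trans
          (card_primeFactors_add_one_le hε (NeZero.ne q)))
    have hp := Nat.prime_of_mem_primeFactors hp
    refine (norm_sub_le _ _).trans ?_
    rw [norm_one, Complex.norm_natCast_cpow_of_pos hp.pos, Complex.neg_re]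
    gcongr
    rw [← rpow_neg_one]
    exact rpow_le_rpow_of_exponent_le (by exact_mod_cast hp.one_le) (by linarith)
  have hz : ‖riemannZeta s‖ ≤ C * (‖s - 1‖⁻¹ + 1) * (|s.im| + 2) ^ ε := by
    have h1 := norm_add_le (riemannZeta s - 1 / (s - 1)) (1 / (s - 1))
    rw [sub_add_cancel, norm_div (1 : ℂ), norm_one, one_div ‖s - 1‖] at h1
    have h2 := hC s hs hs4
    have h3 : 1 ≤ (|s.im| + 2) ^ ε := one_le_rpow (by linarith [abs_nonneg s.im]) hε.le
    have h4 : 0 ≤ ‖s - 1‖⁻¹ := by positivity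
    have h5 : ‖s - 1‖⁻¹ ≤ ‖s - 1‖⁻¹ * (C * (|s.im| + 2) ^ ε) :=
      le_mul_of_one_le_right h4 (by nlinarith)
    linarith
  have := DirichletCharacter.LFunctionTrivChar_eq_mul_riemannZeta (N := q) hs1
  unfold DirichletCharacter.LFunctionTrivChar at this
  rw [this, norm_mul, mul_rpow (by positivity) (by positivity)]
  calc _ ≤ ((2 / ε + 1) * (q : ℝ) ^ ε) * (C * (‖s - 1‖⁻¹ + 1) * (|s.im| + 2) ^ ε) := by gcongr
    _ = _ := by ring

theorem exists_norm_deriv_LFunction_le {ε : ℝ} (hε : 0 < ε) (hε' : ε ≤ 1 / 3) :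
    ∃ C : ℝ, 1 ≤ C ∧ ∀ (q : ℕ) [NeZero q] (χ : DirichletCharacter ℂ q), χ ≠ 1 →
      ∀ s : ℂ, 1 - ε / 2 < s.re → s.re ≤ 3 →
        ‖deriv (DirichletCharacter.LFunction χ) s‖ ≤ C * (q * (|s.im| + 2)) ^ (2 * ε) := by
  obtain ⟨C, hC1, hC⟩ := exists_norm_LFunction_le hε hε'
  refine ⟨4 * C / ε, ?_, fun q _ χ hχ s hs hs3 => ?_⟩
  · rw [le_div_iff₀ hε]
    linarith
  have hq : 0 < (q : ℝ) := by exact_mod_cast NeZero.pos q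
  have hB : ∀ z ∈ Metric.sphere s (ε / 2), ‖DirichletCharacter.LFunction χ z‖ ≤
      2 * C * (q * (|s.im| + 2)) ^ (2 * ε) := by
    intro z hz
    rw [mem_sphere_iff_norm] at hz
    have h1 := (Complex.abs_re_le_norm (z - s)).trans_eq hz
    have h2 := (Complex.abs_im_le_norm (z - s)).trans_eq hz
    rw [Complex.sub_re, abs_le] at h1
    rw [Complex.sub_im] at h2
    refine (hC q χ hχ z (by linarith) (by linarith)).trans ?_
    have h3 : |z.im| + 2 ≤ 2 * (|s.im| + 2) := by
      have := abs_sub_abs_le_abs_sub z.im s.im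
      linarith [abs_nonneg s.im]
    calc C * (q * (|z.im| + 2)) ^ (2 * ε) ≤ C * (2 * (q * (|s.im| + 2))) ^ (2 * ε) := by
          refine mul_le_mul_of_nonneg_left (rpow_le_rpow (by positivity) ?_ (by linarith))
            (by linarith)
          calc (q : ℝ) * (|z.im| + 2) ≤ q * (2 * (|s.im| + 2)) := by gcongr
            _ = _ := by ring
      _ = C * (2 ^ (2 * ε) * (q * (|s.im| + 2)) ^ (2 * ε)) := by
          rw [mul_rpow (by norm_num) (by positivity)]
      _ ≤ C * (2 * (q * (|s.im| + 2)) ^ (2 * ε)) := by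
          gcongr
          simpa using rpow_le_rpow_of_exponent_le (by norm_num : (1:ℝ) ≤ 2)
            (by linarith : 2 * ε ≤ 1)
      _ = _ := by ring
  refine (Complex.norm_deriv_le_of_forall_mem_sphere_norm_le (by positivity)
    (DirichletCharacter.differentiable_LFunction hχ).diffContOnCl hB).trans (le_of_eq ?_)
  field_simp
  ring

open scoped ComplexOrder in
theorem one_le_re_LSeries {a : ℕ → ℂ} (ha : 0 ≤ a) (ha1 : a 1 = 1)
    (habs : LSeries.abscissaOfAbsConv a ≤ 1) : 1 ≤ (LSeries a 2).re := by
  have hs : LSeriesSummable a 2 := LSeriesSummable_of_abscissaOfAbsConv_lt_re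
    (habs.trans_lt (by norm_num; exact_mod_cast (by norm_num : (1:ℝ) < 2)))
  have h : LSeries.term a 2 1 ≤ LSeries a 2 := by
    refine hs.le_tsum 1 fun n _ => ?_
    simpa using LSeries.term_nonneg (ha n) 2
  have := (Complex.le_def.1 h).1
  simpa [LSeries.term_def, ha1] using this

theorem iteratedDeriv_inv_sub_one (n : ℕ) :
    iteratedDeriv n (fun s : ℂ => (s - 1)⁻¹) 2 = (-1) ^ n * n.factorial := by
  have := iteratedDeriv_comp_sub_const n (fun z : ℂ => z⁻¹) 1
  rw [this]
  rw [iteratedDeriv_eq_iterate]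
  simp only []
  rw [iter_deriv_inv]
  norm_num

theorem norm_dslope_le {W : ℂ → ℂ} {M : ℝ} (hM : ∀ s ∈ Metric.closedBall (2 : ℂ) (5 / 4), ‖W s‖ ≤ M)
    {s : ℂ} (hs : s ∈ Metric.sphere (2 : ℂ) (5 / 4)) : ‖dslope W 1 s‖ ≤ 8 * M := by
  have h1 : (1 / 4 : ℝ) ≤ ‖s - 1‖ := by
    have : ‖s - 2‖ = 5 / 4 := by simpa [dist_eq_norm] using hs
    have h2 : ‖s - 2‖ ≤ ‖s - 1‖ + ‖(-1 : ℂ)‖ := by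
      rw [show s - 2 = (s - 1) + (-1) by ring]
      exact norm_add_le _ _
    rw [norm_neg, norm_one] at h2
    linarith
  have hne : s ≠ 1 := by
    rintro rfl
    norm_num at h1
  have hW1 : ‖W 1‖ ≤ M := hM 1 (by simp [dist_eq_norm]; norm_num)
  have hWs : ‖W s‖ ≤ M := hM s (Metric.sphere_subset_closedBall hs)
  rw [dslope_of_ne _ hne, slope_def_field, norm_div, div_le_iff₀ (by linarith)]
  have := norm_sub_le (W s) (W 1)
  have hM0 : 0 ≤ M := (norm_nonneg _).trans hW1
  nlinarith

open scoped ComplexOrder in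
theorem exists_le_re_residue : ∃ c : ℝ, 0 < c ∧ ∀ (W : ℂ → ℂ) (a : ℕ → ℂ) (M β : ℝ),
    Differentiable ℂ W → 0 ≤ a → a 1 = 1 → LSeries.abscissaOfAbsConv a ≤ 1 →
    (∀ s : ℂ, 1 < s.re → W s = (s - 1) * LSeries a s) → 1 ≤ M →
    (∀ s ∈ Metric.closedBall (2 : ℂ) (5 / 4), ‖W s‖ ≤ M) → 7 / 8 ≤ β → β < 1 →
    0 ≤ (W β).re → c * (1 - β) * M ^ (-(10 * (1 - β))) ≤ (W 1).re := by
  refine ⟨(2 * Real.exp (10 * Real.log 160 + 1))⁻¹, by positivity, ?_⟩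
  intro W a M β hW ha ha1 habs hWL hM hMb hβ hβ1 hWβ
  set H := dslope W 1 with hH
  have hHd : Differentiable ℂ H := by
    rw [← differentiableOn_univ]
    exact (Complex.differentiableOn_dslope Filter.univ_mem).2 hW.differentiableOn
  set lam := (W 1).re with hlam
  set u : ℝ := 2 - β with hu
  set c : ℕ → ℂ := fun n => iteratedDeriv n H 2 / n.factorial with hc
  have hcn (n : ℕ) : ‖c n‖ ≤ 8 * M * (4 / 5) ^ n := by
    have := Complex.norm_iteratedDeriv_le_of_forall_mem_sphere_norm_le (c := (2 : ℂ)) (f := H) n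
      (by norm_num : (0 : ℝ) < 5 / 4) hHd.diffContOnCl (C := 8 * M)
      (fun s hs => norm_dslope_le hMb hs)
    rw [hc]
    simp only [norm_div, Complex.norm_natCast]
    rw [div_le_iff₀ (by positivity)]
    refine this.trans (le_of_eq ?_)
    have : (4 / 5 : ℝ) ^ n = ((5 / 4 : ℝ) ^ n)⁻¹ := by rw [← inv_pow]; norm_num
    rw [this]; ring
  have hsum : HasSum (fun n => (c n) * ((β : ℂ) - 2) ^ n) (H β) := by
    have := Complex.hasSum_taylorSeries_of_entire hHd (2 : ℂ) (β : ℂ)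
    refine this.congr_fun ?_
    intro n
    simp [hc, smul_eq_mul]; ring
  set b : ℕ → ℝ := fun n => ((-1) ^ n * c n).re + lam with hb
  have hb0 (n : ℕ) : 0 ≤ b n ∧ (n = 0 → 1 ≤ b n) := by
    have hopen : IsOpen {s : ℂ | 1 < s.re} := isOpen_lt continuous_const Complex.continuous_re
    have h2 : (2 : ℂ) ∈ {s : ℂ | 1 < s.re} := by simp
    have heq : Set.EqOn H (LSeries a - fun s => W 1 * (s - 1)⁻¹) {s : ℂ | 1 < s.re} := by
      intro s hs
      have hne : s ≠ 1 := by
        rintro rfl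
        simp at hs
      have hne' : s - 1 ≠ 0 := sub_ne_zero.2 hne
      simp only [hH, Pi.sub_apply]
      rw [dslope_of_ne _ hne, slope_def_field, hWL s hs]
      field_simp
    have hab2 : LSeries.abscissaOfAbsConv a < (2 : ℝ) :=
      habs.trans_lt (by exact_mod_cast (by norm_num : (1:ℝ) < 2))
    have hLa : AnalyticOnNhd ℂ (LSeries a) {s | LSeries.abscissaOfAbsConv a < s.re} :=
      LSeries_analyticOnNhd a
    have hLa2 : ContDiffAt ℂ n (LSeries a) 2 := (hLa 2 (by simpa using hab2)).contDiffAt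
    have hinv : ContDiffAt ℂ n (fun s : ℂ => (s - 1)⁻¹) 2 := by
      apply ContDiffAt.inv
      · fun_prop
      · norm_num
    have hinv' : ContDiffAt ℂ n (fun s : ℂ => W 1 * (s - 1)⁻¹) 2 := contDiffAt_const.mul hinv
    have h3 : iteratedDeriv n H 2 = iteratedDeriv n (LSeries a) 2 - W 1 * ((-1) ^ n * n.factorial) := by
      rw [heq.iteratedDeriv_of_isOpen hopen n h2, iteratedDeriv_sub hLa2 hinv',
        iteratedDeriv_const_mul _ hinv, iteratedDeriv_inv_sub_one]
    have hpos := LSeries.iteratedDeriv_alternating ha hab2 n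
    have h4 : b n = ((-1) ^ n * iteratedDeriv n (LSeries a) 2).re / n.factorial := by
      have h5 : (-1) ^ n * c n =
          ((-1) ^ n * iteratedDeriv n (LSeries a) 2) / ((n.factorial : ℝ) : ℂ) - W 1 := by
        have hf : (n.factorial : ℂ) ≠ 0 := by exact_mod_cast n.factorial_ne_zero
        have hsq : ((-1 : ℂ) ^ n) ^ 2 = 1 := by rw [← pow_mul, mul_comm, pow_mul]; simp
        simp only [hc, h3]
        push_cast
        field_simp
        linear_combination (- W 1 * n.factorial) * hsq
      simp only [hb, h5, Complex.sub_re, Complex.div_ofReal_re]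
      rw [hlam]; ring
    have hre : 0 ≤ ((-1) ^ n * iteratedDeriv n (LSeries a) 2).re := by
      have := (Complex.le_def.1 hpos).1
      simpa using this
    refine ⟨by rw [h4]; positivity, ?_⟩
    rintro rfl
    rw [h4]
    simpa using one_le_re_LSeries ha ha1 habs
  have ht : HasSum (fun n => u ^ n * (b n - lam)) (H β).re := by
    have := Complex.hasSum_re hsum
    refine this.congr_fun ?_
    intro n
    have : ((β : ℂ) - 2) ^ n = ((u ^ n : ℝ) : ℂ) * (-1) ^ n := by
      rw [hu]; push_cast; rw [← mul_pow]; congr 1; ring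
    rw [this]
    simp only [hb]
    have : c n * (((u ^ n : ℝ) : ℂ) * (-1) ^ n) = ((u ^ n : ℝ) : ℂ) * ((-1) ^ n * c n) := by ring
    rw [this, Complex.re_ofReal_mul]; ring
  have hu1 : 1 < u := by linarith
  have hu2 : u ≤ 9 / 8 := by linarith
  have htn (n : ℕ) : -(8 * M * (9 / 10) ^ n) ≤ u ^ n * (b n - lam) := by
    have h1 : -‖c n‖ ≤ b n - lam := by
      have := Complex.abs_re_le_norm ((-1) ^ n * c n)
      simp only [norm_mul, norm_pow, norm_neg, norm_one, one_pow, one_mul] at this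
      have := (abs_le.1 this).1
      simp only [hb]; linarith
    have h2 : u ^ n * ‖c n‖ ≤ 8 * M * (9 / 10) ^ n := by
      calc u ^ n * ‖c n‖ ≤ (9 / 8) ^ n * (8 * M * (4 / 5) ^ n) := by
            gcongr
            exact hcn n
        _ = 8 * M * ((9 / 8) * (4 / 5)) ^ n := by rw [mul_pow]; ring
        _ = _ := by norm_num
    nlinarith [mul_le_mul_of_nonneg_left h1 (by positivity : 0 ≤ u ^ n)]
  set N : ℕ := ⌈10 * Real.log (160 * M)⌉₊ with hN
  have hN1 : 10 * Real.log (160 * M) ≤ N := Nat.le_ceil _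
  have hlogpos : 0 ≤ Real.log (160 * M) := Real.log_nonneg (by linarith)
  have hN2 : (N : ℝ) ≤ 10 * Real.log (160 * M) + 1 := (Nat.ceil_lt_add_one (by positivity)).le
  have h9 : 80 * M * (9 / 10 : ℝ) ^ N ≤ 1 / 2 := by
    have h1 : (9 / 10 : ℝ) ≤ Real.exp (-(1 / 10)) := by
      have := Real.add_one_le_exp (-(1 / 10) : ℝ)
      linarith
    have h2 : (9 / 10 : ℝ) ^ N ≤ (160 * M)⁻¹ := by
      calc (9 / 10 : ℝ) ^ N ≤ (Real.exp (-(1 / 10))) ^ N := by gcongr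
        _ = Real.exp (N * (-(1 / 10))) := by rw [Real.exp_nat_mul]
        _ ≤ Real.exp (-Real.log (160 * M)) := by
            apply Real.exp_le_exp.2; linarith
        _ = _ := by rw [Real.exp_neg, Real.exp_log (by linarith)]
    calc 80 * M * (9 / 10 : ℝ) ^ N ≤ 80 * M * (160 * M)⁻¹ := by gcongr
      _ = 1 / 2 := by field_simp; norm_num
  have hgeom : HasSum (fun n => -(8 * M * (9 / 10 : ℝ) ^ (n + N))) (-(80 * M * (9 / 10) ^ N)) := by
    have := (hasSum_geometric_of_lt_one (by norm_num : (0:ℝ) ≤ 9 / 10) (by norm_num)).mul_left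
      (-(8 * M * (9 / 10) ^ N))
    have e1 : (fun n => -(8 * M * (9 / 10 : ℝ) ^ (n + N))) =
        fun n => -(8 * M * (9 / 10) ^ N) * (9 / 10) ^ n := by
      funext n
      rw [pow_add]; ring
    have e2 : -(80 * M * (9 / 10 : ℝ) ^ N) = -(8 * M * (9 / 10) ^ N) * (1 - 9 / 10)⁻¹ := by
      norm_num; ring
    rw [e1, e2]
    exact this
  have htail := (hasSum_nat_add_iff' N).2 ht
  have h10 := hasSum_le (fun n => htn (n + N)) hgeom htail
  have h11 : 1 - lam * ((u ^ N - 1) / (u - 1)) ≤ ∑ n ∈ range N, u ^ n * (b n - lam) := by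
    have hNpos : 0 < N := by
      have : 0 < Real.log (160 * M) := Real.log_pos (by linarith)
      exact_mod_cast (by positivity : 0 < 10 * Real.log (160 * M)).trans_le hN1
    rw [← geom_sum_eq hu1.ne' N]
    simp only [mul_sub, sum_sub_distrib, ← sum_mul]
    have : (1 : ℝ) ≤ ∑ n ∈ range N, u ^ n * b n := by
      calc (1 : ℝ) ≤ u ^ 0 * b 0 := by simpa using (hb0 0).2 rfl
        _ ≤ _ := single_le_sum (f := fun n => u ^ n * b n)
            (fun n _ => mul_nonneg (by positivity) (hb0 n).1) (mem_range.2 hNpos)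
    linarith
  have hHβ : (H β).re ≤ lam / (1 - β) := by
    have hne : (β : ℂ) ≠ 1 := by exact_mod_cast hβ1.ne
    rw [hH, dslope_of_ne _ hne, slope_def_field]
    have : (W β - W 1) / ((β : ℂ) - 1) = (W β - W 1) / ((β - 1 : ℝ) : ℂ) := by push_cast; rfl
    rw [this, Complex.div_ofReal_re, Complex.sub_re, ← neg_div_neg_eq, neg_sub, neg_sub]
    gcongr
    linarith
  have h12 : (1 - β) / 2 ≤ lam * u ^ N := by
    have h13 : 1 / 2 ≤ lam * u ^ N / (1 - β) := by
      have h14 : u - 1 = 1 - β := by rw [hu]; ring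
      rw [h14] at h11
      have : lam / (1 - β) + lam * ((u ^ N - 1) / (1 - β)) = lam * u ^ N / (1 - β) := by ring
      linarith
    rw [le_div_iff₀ (by linarith)] at h13
    linarith
  have hMpos : 0 < M := by linarith
  have huN : u ^ N ≤ Real.exp (10 * Real.log 160 + 1) * M ^ (10 * (1 - β)) := by
    have h1 : u ≤ Real.exp (1 - β) := by
      have := Real.add_one_le_exp (1 - β)
      linarith
    calc u ^ N ≤ Real.exp (1 - β) ^ N := by gcongr
      _ = Real.exp (N * (1 - β)) := by rw [Real.exp_nat_mul]
      _ ≤ Real.exp ((10 * Real.log 160 + 1) + Real.log M * (10 * (1 - β))) := by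
          apply Real.exp_le_exp.2
          rw [Real.log_mul (by norm_num) hMpos.ne'] at hN2
          have : (N : ℝ) * (1 - β) ≤ (10 * (Real.log 160 + Real.log M) + 1) * (1 - β) := by
            gcongr
          have h16 : 0 ≤ Real.log 160 := Real.log_nonneg (by norm_num)
          nlinarith
      _ = _ := by rw [Real.exp_add, Real.rpow_def_of_pos hMpos]
  have hupos : 0 < u ^ N := by positivity
  have hlam0 : 0 ≤ lam := by
    by_contra h
    nlinarith
  have h17 : (1 - β) / 2 ≤ lam * (Real.exp (10 * Real.log 160 + 1) * M ^ (10 * (1 - β))) :=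
    h12.trans (by gcongr)
  rw [Real.rpow_neg hMpos.le]
  have hE : 0 < Real.exp (10 * Real.log 160 + 1) := Real.exp_pos _
  have hMp : 0 < M ^ (10 * (1 - β)) := by positivity
  rw [← div_eq_mul_inv, div_le_iff₀ hMp, inv_mul_le_iff₀ (by positivity)]
  linarith

/-- The arithmetic function attached to a Dirichlet character. -/
noncomputable def charFun {q : ℕ} (χ : DirichletCharacter ℂ q) : ArithmeticFunction ℂ :=
  toArithmeticFunction (fun n : ℕ => χ n)

theorem charFun_apply {q : ℕ} (χ : DirichletCharacter ℂ q) {n : ℕ} (hn : n ≠ 0) :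
    charFun χ n = χ n := by
  simp [charFun, toArithmeticFunction, hn]

theorem charFun_one {q : ℕ} (χ : DirichletCharacter ℂ q) : charFun χ 1 = 1 := by
  rw [charFun_apply χ one_ne_zero, Nat.cast_one, map_one]

/-- The von Mangoldt function twisted by a Dirichlet character. -/
noncomputable def charVonMangoldt {q : ℕ} (χ : DirichletCharacter ℂ q) : ArithmeticFunction ℂ where
  toFun n := χ n * (ArithmeticFunction.vonMangoldt n : ℂ)
  map_zero' := by simp

/-- The pointwise product of an arithmetic function with the logarithm. -/
noncomputable def mulLog (f : ArithmeticFunction ℂ) : ArithmeticFunction ℂ where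
  toFun n := (Real.log n : ℂ) * f n
  map_zero' := by simp

theorem mulLog_apply (f : ArithmeticFunction ℂ) (n : ℕ) :
    mulLog f n = (Real.log n : ℂ) * f n := rfl

theorem mulLog_mul (f g : ArithmeticFunction ℂ) : mulLog (f * g) = mulLog f * g + f * mulLog g := by
  ext n
  rw [mulLog_apply, ArithmeticFunction.add_apply]
  simp only [ArithmeticFunction.mul_apply, mulLog_apply, mul_sum, ← sum_add_distrib]
  refine sum_congr rfl fun d hd => ?_
  obtain ⟨h1, h2⟩ := Nat.mem_divisorsAntidiagonal.1 hd
  have hd1 : d.1 ≠ 0 := by rintro h; simp [h] at h1; exact h2 h1.symm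
  have hd2 : d.2 ≠ 0 := by rintro h; simp [h] at h1; exact h2 h1.symm
  rw [← h1, Nat.cast_mul, Real.log_mul (by exact_mod_cast hd1) (by exact_mod_cast hd2)]
  push_cast
  ring

theorem mulLog_mul_of_eq {f g a b : ArithmeticFunction ℂ} (hf : mulLog f = f * a)
    (hg : mulLog g = g * b) : mulLog (f * g) = (f * g) * (a + b) := by
  rw [mulLog_mul, hf, hg]; ring

theorem mulLog_charFun {q : ℕ} (χ : DirichletCharacter ℂ q) :
    mulLog (charFun χ) = charFun χ * charVonMangoldt χ := by
  ext n
  rcases eq_or_ne n 0 with rfl | hn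
  · simp
  have := congrFun (DirichletCharacter.convolution_twist_vonMangoldt χ) n
  rw [LSeries.convolution_def] at this
  simp only [Pi.mul_apply] at this
  rw [mulLog_apply, charFun_apply _ hn, mul_comm (charFun χ), ArithmeticFunction.mul_apply]
  rw [Complex.ofReal_log (by positivity), Complex.ofReal_natCast, mul_comm, ← this]
  refine sum_congr rfl fun d hd => ?_
  obtain ⟨h1, h2⟩ := Nat.mem_divisorsAntidiagonal.1 hd
  have hd2 : d.2 ≠ 0 := by rintro h; simp [h] at h1; exact h2 h1.symm
  rw [charFun_apply _ hd2]
  rfl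

open scoped ComplexOrder in
theorem nonneg_of_mulLog_eq {f g : ArithmeticFunction ℂ} (hfg : mulLog f = f * g) (h1 : f 1 = 1)
    (hg : ∀ n, 0 ≤ g n) (hg1 : g 1 = 0) (n : ℕ) : 0 ≤ f n := by
  induction n using Nat.strong_induction_on with
  | _ n ih =>
    rcases Nat.lt_or_ge n 2 with hn | hn
    · interval_cases n
      · simp
      · simp [h1]
    · have hlog : 0 < Real.log n := Real.log_pos (by exact_mod_cast hn)
      have h2 : (Real.log n : ℂ) * f n = (f * g) n := by rw [← hfg, mulLog_apply]
      have h3 : 0 ≤ (f * g) n := by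
        rw [ArithmeticFunction.mul_apply]
        refine sum_nonneg fun d hd => ?_
        obtain ⟨h3, h4⟩ := Nat.mem_divisorsAntidiagonal.1 hd
        rcases eq_or_ne d.2 1 with h5 | h5
        · simp [h5, hg1]
        · refine mul_nonneg (ih _ ?_) (hg _)
          have hd1 : 0 < d.1 := Nat.pos_of_ne_zero (by rintro h; simp [h] at h3; exact h4 h3.symm)
          have hd2 : d.2 ≠ 0 := by rintro h; simp [h] at h3; exact h4 h3.symm
          have : 2 ≤ d.2 := by omega
          nlinarith
      have hlogc : (0 : ℂ) < (Real.log n : ℂ) := by exact_mod_cast hlog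
      have h6 : f n = ((Real.log n : ℝ) : ℂ)⁻¹ * (f * g) n := by
        rw [← h2, inv_mul_cancel_left₀ hlogc.ne']
      rw [h6]
      refine mul_nonneg ?_ h3
      rw [← Complex.ofReal_inv]
      exact_mod_cast (inv_pos.2 hlog).le

open scoped ComplexOrder in
theorem one_add_nonneg_of_sq_eq_one {q : ℕ} {χ : DirichletCharacter ℂ q} (h : χ ^ 2 = 1)
    (a : ZMod q) : 0 ≤ 1 + χ a := by
  rcases MulChar.isQuadratic_iff_sq_eq_one.mpr h a with h | h | h <;> rw [h] <;> norm_num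

theorem changeLevel_mul_apply {q r : ℕ} (χ : DirichletCharacter ℂ q) (ψ : DirichletCharacter ℂ r)
    (n : ℕ) : (DirichletCharacter.changeLevel (Dvd.intro r rfl : q ∣ q * r) χ *
      DirichletCharacter.changeLevel (Dvd.intro_left q rfl : r ∣ q * r) ψ) (n : ZMod (q * r)) =
      χ n * ψ n := by
  rw [MulChar.mul_apply]
  by_cases h : IsCoprime (n : ℤ) ((q * r : ℕ) : ℤ)
  · have h1 := DirichletCharacter.changeLevel_eq_cast_of_dvd' χ (Dvd.intro r rfl : q ∣ q * r) h
    have h2 := DirichletCharacter.changeLevel_eq_cast_of_dvd' ψ (Dvd.intro_left q rfl : r ∣ q * r) h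
    simp only [Int.cast_natCast] at h1 h2
    rw [h1, h2]
  · have h1 := (DirichletCharacter.apply_eq_zero_iff
      (DirichletCharacter.changeLevel (Dvd.intro r rfl : q ∣ q * r) χ) (n : ℤ)).2 h
    simp only [Int.cast_natCast] at h1
    rw [h1, zero_mul]
    symm
    by_contra h3
    obtain ⟨h4, h5⟩ := mul_ne_zero_iff.1 h3
    have h6 := (DirichletCharacter.apply_ne_zero_iff χ (n : ℤ)).1 (by simpa using h4)
    have h7 := (DirichletCharacter.apply_ne_zero_iff ψ (n : ℤ)).1 (by simpa using h5)
    exact h (by push_cast; exact h6.mul_right h7)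

/-- The coefficients of `ζ L(χ) L(ψ) L(χψ)`. -/
noncomputable def fourFold {q r : ℕ} (χ : DirichletCharacter ℂ q) (ψ : DirichletCharacter ℂ r) :
    ArithmeticFunction ℂ :=
  charFun (1 : DirichletCharacter ℂ 1) * charFun χ * charFun ψ *
    charFun (DirichletCharacter.changeLevel (Dvd.intro r rfl : q ∣ q * r) χ *
      DirichletCharacter.changeLevel (Dvd.intro_left q rfl : r ∣ q * r) ψ)

open scoped ComplexOrder in
theorem fourFold_nonneg {q r : ℕ} {χ : DirichletCharacter ℂ q} {ψ : DirichletCharacter ℂ r}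
    (hχ : χ ^ 2 = 1) (hψ : ψ ^ 2 = 1) (n : ℕ) : 0 ≤ fourFold χ ψ n := by
  have h := mulLog_mul_of_eq (mulLog_mul_of_eq (mulLog_mul_of_eq
    (mulLog_charFun (1 : DirichletCharacter ℂ 1)) (mulLog_charFun χ)) (mulLog_charFun ψ))
    (mulLog_charFun (DirichletCharacter.changeLevel (Dvd.intro r rfl : q ∣ q * r) χ *
      DirichletCharacter.changeLevel (Dvd.intro_left q rfl : r ∣ q * r) ψ))
  refine nonneg_of_mulLog_eq h ?_ (fun m => ?_) ?_ n
  · simp [charFun_one]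
  · have h1 : (1 : DirichletCharacter ℂ 1) (m : ZMod 1) = 1 :=
      MulChar.one_apply (isUnit_of_subsingleton _)
    have h2 : (1 + χ m) * (1 + ψ m) * (ArithmeticFunction.vonMangoldt m : ℂ) =
        (charVonMangoldt (1 : DirichletCharacter ℂ 1) + charVonMangoldt χ + charVonMangoldt ψ +
          charVonMangoldt (DirichletCharacter.changeLevel (Dvd.intro r rfl : q ∣ q * r) χ *
      DirichletCharacter.changeLevel (Dvd.intro_left q rfl : r ∣ q * r) ψ)) m := by
      simp only [ArithmeticFunction.add_apply]
      simp only [charVonMangoldt, ArithmeticFunction.coe_mk]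
      rw [changeLevel_mul_apply, h1]
      ring
    rw [← h2]
    refine mul_nonneg (mul_nonneg (one_add_nonneg_of_sq_eq_one hχ _)
      (one_add_nonneg_of_sq_eq_one hψ _)) ?_
    exact_mod_cast ArithmeticFunction.vonMangoldt_nonneg
  · simp only [ArithmeticFunction.add_apply]
    simp [charVonMangoldt]

theorem fourFold_one {q r : ℕ} (χ : DirichletCharacter ℂ q) (ψ : DirichletCharacter ℂ r) :
    fourFold χ ψ 1 = 1 := by
  simp [fourFold, charFun_one]

theorem LSeriesHasSum_charFun {q : ℕ} [NeZero q] (χ : DirichletCharacter ℂ q) {s : ℂ}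
    (hs : 1 < s.re) : LSeriesHasSum (charFun χ) s (χ.LFunction s) := by
  have h1 : LSeriesSummable (fun n : ℕ => χ n) s :=
    LSeriesSummable_of_bounded_of_one_lt_re (m := 1) (fun n hn ↦ χ.norm_le_one _) hs
  rw [DirichletCharacter.LFunction_eq_LSeries χ hs]
  refine (LSeriesHasSum_congr _ _ fun {n} hn => ?_).1 h1.LSeriesHasSum
  exact (charFun_apply χ hn).symm

theorem LSeriesHasSum_fourFold {q r : ℕ} [NeZero q] [NeZero r] (χ : DirichletCharacter ℂ q)
    (ψ : DirichletCharacter ℂ r) {s : ℂ} (hs : 1 < s.re) :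
    LSeriesHasSum (fourFold χ ψ) s
      (DirichletCharacter.LFunction (1 : DirichletCharacter ℂ 1) s * χ.LFunction s * ψ.LFunction s *
      (DirichletCharacter.changeLevel (Dvd.intro r rfl : q ∣ q * r) χ *
      DirichletCharacter.changeLevel (Dvd.intro_left q rfl : r ∣ q * r) ψ).LFunction s) := by
  unfold fourFold
  exact ArithmeticFunction.LSeriesHasSum_mul (ArithmeticFunction.LSeriesHasSum_mul
    (ArithmeticFunction.LSeriesHasSum_mul (LSeriesHasSum_charFun _ hs) (LSeriesHasSum_charFun _ hs))
    (LSeriesHasSum_charFun _ hs)) (LSeriesHasSum_charFun _ hs)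

/-- A differentiable function on `ℂ` which is real on `(1, ∞)` is real on `ℝ`. -/
theorem im_eq_zero_of_differentiable {W : ℂ → ℂ} (hW : Differentiable ℂ W)
    (hre : ∀ x : ℝ, 1 < x → (W x).im = 0) (x : ℝ) : (W x).im = 0 := by
  set V : ℂ → ℂ := fun s => (starRingEnd ℂ) (W ((starRingEnd ℂ) s)) with hV
  have hVd : Differentiable ℂ V := fun s => by
    have := (hW ((starRingEnd ℂ) s)).conj_conj
    rw [Complex.conj_conj] at this
    exact this
  have hfreq : ∃ᶠ z in nhdsWithin (2 : ℂ) {2}ᶜ, V z = W z := by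
    have h1 : Filter.Tendsto (fun x : ℝ => (x : ℂ)) (nhdsWithin 2 {2}ᶜ)
        (nhdsWithin (2 : ℂ) {2}ᶜ) := by
      refine tendsto_nhdsWithin_iff.2 ⟨?_, ?_⟩
      · exact (Complex.continuous_ofReal.tendsto' 2 2 (by norm_num)).mono_left nhdsWithin_le_nhds
      · filter_upwards [self_mem_nhdsWithin] with x hx h
        have h3 : (x : ℂ) = ((2 : ℝ) : ℂ) := by simpa using h
        exact hx (Complex.ofReal_injective h3)
    refine h1.frequently (Filter.Eventually.frequently ?_)
    have : ∀ᶠ x : ℝ in nhdsWithin 2 {2}ᶜ, 1 < x :=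
      nhdsWithin_le_nhds (lt_mem_nhds (by norm_num))
    filter_upwards [this] with x hx
    simp only [hV, Complex.conj_ofReal]
    exact Complex.conj_eq_iff_im.2 (hre x hx)
  have heq : V = W := AnalyticOnNhd.eq_of_frequently_eq
    (fun z _ => hVd.analyticAt z) (fun z _ => hW.analyticAt z) hfreq
  have := congrFun heq x
  simp only [hV, Complex.conj_ofReal] at this
  exact Complex.conj_eq_iff_im.1 this

open scoped ComplexOrder in
theorem re_pos_of_eq_mul_LSeries {W : ℂ → ℂ} {a : ℕ → ℂ} (ha : 0 ≤ a) (ha1 : a 1 = 1)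
    (habs : LSeries.abscissaOfAbsConv a ≤ 1)
    (hWL : ∀ s : ℂ, 1 < s.re → W s = (s - 1) * LSeries a s) {x : ℝ} (hx : 1 < x) :
    0 < (W x).re ∧ (W x).im = 0 := by
  have h := LSeries.positive ha (by simp [ha1]) (x := x)
    (habs.trans_lt (by exact_mod_cast hx))
  have h2 : 0 < W x := by
    rw [hWL x (by simpa using hx)]
    refine mul_pos ?_ h
    have : (0 : ℂ) < ((x - 1 : ℝ) : ℂ) := by exact_mod_cast (by linarith : (0 : ℝ) < x - 1)
    simpa using this
  obtain ⟨h3, h4⟩ := Complex.lt_def.1 h2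
  exact ⟨by simpa using h3, by simpa using h4.symm⟩

open scoped ComplexOrder in
theorem exists_eq_zero_of_re_neg {W : ℂ → ℂ} {a : ℕ → ℂ} (hW : Differentiable ℂ W) (ha : 0 ≤ a)
    (ha1 : a 1 = 1) (habs : LSeries.abscissaOfAbsConv a ≤ 1)
    (hWL : ∀ s : ℂ, 1 < s.re → W s = (s - 1) * LSeries a s) {β : ℝ} (hβ : β < 1)
    (h : (W β).re < 0) : ∃ x : ℝ, β < x ∧ x ≤ 1 ∧ W x = 0 := by
  have hpos := fun x (hx : 1 < x) => re_pos_of_eq_mul_LSeries ha ha1 habs hWL hx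
  have hcont : ContinuousOn (fun x : ℝ => (W x).re) (Set.Icc β 2) :=
    (Complex.continuous_re.comp (hW.continuous.comp Complex.continuous_ofReal)).continuousOn
  obtain ⟨x, hx, hx0⟩ := intermediate_value_Ioo (by linarith) hcont
    (Set.mem_Ioo.2 ⟨h, (hpos 2 (by norm_num)).1⟩)
  refine ⟨x, hx.1, ?_, ?_⟩
  · by_contra h1
    exact (hpos x (by linarith)).1.ne' hx0
  · exact Complex.ext hx0 (im_eq_zero_of_differentiable hW (fun y hy => (hpos y hy).2) x)

/-- The entire function `(s - 1) ζ(s)`. -/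
noncomputable def zetaOne : ℂ → ℂ := DirichletCharacter.LFunctionTrivChar₁ 1

theorem differentiable_zetaOne : Differentiable ℂ zetaOne :=
  DirichletCharacter.differentiable_LFunctionTrivChar₁ 1

theorem zetaOne_one : zetaOne 1 = 1 := by
  simp [zetaOne, DirichletCharacter.LFunctionTrivChar₁]

theorem zetaOne_of_ne {s : ℂ} (hs : s ≠ 1) :
    zetaOne s = (s - 1) * DirichletCharacter.LFunction (1 : DirichletCharacter ℂ 1) s := by
  simp [zetaOne, DirichletCharacter.LFunctionTrivChar₁, hs, DirichletCharacter.LFunctionTrivChar]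

theorem exists_zetaOne_ne_zero : ∃ δ : ℝ, 0 < δ ∧ ∀ x : ℝ, 1 - δ ≤ x → x ≤ 1 → zetaOne x ≠ 0 := by
  have h1 : ∀ᶠ x : ℝ in nhds 1, zetaOne x ≠ 0 :=
    (differentiable_zetaOne.continuous.comp Complex.continuous_ofReal).continuousAt.eventually_ne
      (by simp [zetaOne_one])
  obtain ⟨δ, hδ, h⟩ := Metric.eventually_nhds_iff.1 h1
  refine ⟨δ / 2, by positivity, fun x hx hx1 => h ?_⟩
  rw [Real.dist_eq, abs_lt]
  constructor <;> linarith

theorem exists_norm_zetaOne_le : ∃ C : ℝ, 1 ≤ C ∧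
    ∀ s ∈ Metric.closedBall (2 : ℂ) (5 / 4), ‖zetaOne s‖ ≤ C := by
  obtain ⟨C, hC⟩ := (isCompact_closedBall (2 : ℂ) (5 / 4)).exists_bound_of_continuousOn
    differentiable_zetaOne.continuous.continuousOn
  exact ⟨max C 1, le_max_right _ _, fun s hs => (hC s hs).trans (le_max_left _ _)⟩

theorem exists_norm_LFunction_le_on_ball : ∃ C : ℝ, 1 ≤ C ∧
    ∀ (q : ℕ) [NeZero q] (χ : DirichletCharacter ℂ q), χ ≠ 1 →
    ∀ s ∈ Metric.closedBall (2 : ℂ) (5 / 4), ‖χ.LFunction s‖ ≤ C * q := by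
  obtain ⟨C, hC, h⟩ := exists_norm_LFunction_le (by norm_num : (0 : ℝ) < 1 / 3) le_rfl
  refine ⟨C * 4, by linarith, fun q _ χ hχ s hs => ?_⟩
  have hs' : ‖s - 2‖ ≤ 5 / 4 := by simpa [dist_eq_norm] using hs
  have h1 := abs_le.1 ((Complex.abs_re_le_norm (s - 2)).trans hs')
  have h2 := (Complex.abs_im_le_norm (s - 2)).trans hs'
  simp only [Complex.sub_re, Complex.sub_im, Complex.re_ofNat, Complex.im_ofNat, sub_zero] at h1 h2
  have hq : (1 : ℝ) ≤ q := by exact_mod_cast NeZero.one_le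
  refine (h q χ hχ s (by linarith) (by linarith)).trans ?_
  rw [mul_assoc]
  gcongr
  calc ((q : ℝ) * (|s.im| + 2)) ^ (2 * (1 / 3) : ℝ) ≤ (4 * q) ^ (2 * (1 / 3) : ℝ) := by
        refine Real.rpow_le_rpow (by positivity) ?_ (by norm_num)
        nlinarith
    _ ≤ (4 * q) ^ (1 : ℝ) := by
        apply Real.rpow_le_rpow_of_exponent_le <;> linarith
    _ = _ := by rw [Real.rpow_one]

open scoped ComplexOrder in
theorem exists_le_norm_residue : ∃ c : ℝ, 0 < c ∧ ∀ (W : ℂ → ℂ) (a : ℕ → ℂ) (K ε β : ℝ) (q : ℕ),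
    Differentiable ℂ W → 0 ≤ a → a 1 = 1 → LSeries.abscissaOfAbsConv a ≤ 1 →
    (∀ s : ℂ, 1 < s.re → W s = (s - 1) * LSeries a s) → 1 ≤ K → 1 ≤ q →
    (∀ s ∈ Metric.closedBall (2 : ℂ) (5 / 4), ‖W s‖ ≤ K * q ^ 2) → ε ≤ 1 / 8 → 1 - ε ≤ β → β < 1 →
    0 ≤ (W β).re → c * (1 - β) * K ^ (-(10 * ε)) * (q : ℝ) ^ (-(20 * ε)) ≤ ‖W 1‖ := by
  obtain ⟨c, hc, h⟩ := exists_le_re_residue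
  refine ⟨c, hc, fun W a K ε β q hW ha ha1 habs hWL hK hq hb hε hβ hβ1 hpos => ?_⟩
  have hq' : (1 : ℝ) ≤ q := by exact_mod_cast hq
  have hM : 1 ≤ K * (q : ℝ) ^ 2 := by
    have : (1 : ℝ) ≤ (q : ℝ) ^ 2 := one_le_pow₀ hq'
    nlinarith
  have h1 := h W a (K * q ^ 2) β hW ha ha1 habs hWL hM hb (by linarith) hβ1 hpos
  refine le_trans ?_ (h1.trans (Complex.re_le_norm _))
  rw [mul_assoc]
  have h2 : K ^ (-(10 * ε)) * (q : ℝ) ^ (-(20 * ε)) = (K * (q : ℝ) ^ 2) ^ (-(10 * ε)) := by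
    rw [Real.mul_rpow (by linarith) (by positivity), ← Real.rpow_natCast, ← Real.rpow_mul (by linarith)]
    congr 2
    push_cast; ring
  rw [h2]
  have : 0 ≤ c * (1 - β) := mul_nonneg hc.le (by linarith)
  gcongr
  linarith

open scoped ComplexOrder in
theorem zetaMul_props {q : ℕ} [NeZero q] {χ : DirichletCharacter ℂ q} (hχ2 : χ ^ 2 = 1) :
    0 ≤ (χ.zetaMul : ℕ → ℂ) ∧ χ.zetaMul 1 = 1 ∧ LSeries.abscissaOfAbsConv χ.zetaMul ≤ 1 ∧
    ∀ s : ℂ, 1 < s.re → zetaOne s * χ.LFunction s = (s - 1) * LSeries χ.zetaMul s := by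
  refine ⟨fun n => DirichletCharacter.zetaMul_nonneg hχ2 n, ?_, ?_, fun s hs => ?_⟩
  · exact χ.isMultiplicative_zetaMul.map_one
  · refine LSeries.abscissaOfAbsConv_le_of_forall_lt_LSeriesSummable fun y hy =>
      χ.LSeriesSummable_zetaMul (by simpa using hy)
  · have hne : s ≠ 1 := by rintro rfl; simp at hs
    have h1 : LSeriesHasSum (ArithmeticFunction.zeta : ArithmeticFunction ℂ) s
        (DirichletCharacter.LFunction (1 : DirichletCharacter ℂ 1) s) := by
      rw [DirichletCharacter.LFunction_modOne_eq]
      have := ArithmeticFunction.LSeriesHasSum_zeta hs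
      refine (LSeriesHasSum_congr _ _ fun {n} hn => ?_).1 this
      simp
    have h2 := ArithmeticFunction.LSeriesHasSum_mul h1 (LSeriesHasSum_charFun χ hs)
    rw [zetaOne_of_ne hne, mul_assoc]
    congr 1
    exact h2.LSeries_eq.symm

open scoped ComplexOrder in
theorem fourFold_props {q r : ℕ} [NeZero q] [NeZero r] {χ : DirichletCharacter ℂ q}
    {ψ : DirichletCharacter ℂ r} (hχ : χ ^ 2 = 1) (hψ : ψ ^ 2 = 1) :
    0 ≤ (fourFold χ ψ : ℕ → ℂ) ∧ LSeries.abscissaOfAbsConv (fourFold χ ψ) ≤ 1 ∧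
    ∀ s : ℂ, 1 < s.re → zetaOne s * χ.LFunction s * ψ.LFunction s *
      (DirichletCharacter.changeLevel (Dvd.intro r rfl : q ∣ q * r) χ *
      DirichletCharacter.changeLevel (Dvd.intro_left q rfl : r ∣ q * r) ψ).LFunction s =
      (s - 1) * LSeries (fourFold χ ψ) s := by
  refine ⟨fun n => fourFold_nonneg hχ hψ n, ?_, fun s hs => ?_⟩
  · refine LSeries.abscissaOfAbsConv_le_of_forall_lt_LSeriesSummable fun y hy =>
      (LSeriesHasSum_fourFold χ ψ (by simpa using hy)).LSeriesSummable
  · have hne : s ≠ 1 := by rintro rfl; simp at hs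
    rw [(LSeriesHasSum_fourFold χ ψ hs).LSeries_eq, zetaOne_of_ne hne]
    ring

theorem LFunction_eq_zero_of_changeLevel_mul_eq_one {q r : ℕ} [NeZero q] [NeZero r]
    {χ : DirichletCharacter ℂ q} {ψ : DirichletCharacter ℂ r} (hψ2 : ψ ^ 2 = 1)
    (h : DirichletCharacter.changeLevel (Dvd.intro r rfl : q ∣ q * r) χ *
      DirichletCharacter.changeLevel (Dvd.intro_left q rfl : r ∣ q * r) ψ = 1) {s : ℂ} (hs : s ≠ 1)
    (hs0 : 0 < s.re) (hψ : ψ.LFunction s = 0) : χ.LFunction s = 0 := by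
  have hinv : DirichletCharacter.changeLevel (Dvd.intro_left q rfl : r ∣ q * r) ψ *
      DirichletCharacter.changeLevel (Dvd.intro_left q rfl : r ∣ q * r) ψ = 1 := by
    rw [← map_mul, ← sq, hψ2, map_one]
  have heq : DirichletCharacter.changeLevel (Dvd.intro r rfl : q ∣ q * r) χ =
      DirichletCharacter.changeLevel (Dvd.intro_left q rfl : r ∣ q * r) ψ :=
    mul_right_cancel (h.trans hinv.symm)
  have h1 := DirichletCharacter.LFunction_changeLevel (Dvd.intro r rfl : q ∣ q * r) χ (.inr hs)
  have h2 := DirichletCharacter.LFunction_changeLevel (Dvd.intro_left q rfl : r ∣ q * r) ψ (.inr hs)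
  rw [heq, h2, hψ, zero_mul] at h1
  refine (mul_eq_zero.1 h1.symm).resolve_right (prod_ne_zero_iff.2 fun p hp h3 => ?_)
  have hp' := Nat.prime_of_mem_primeFactors hp
  have h4 : χ p * (p : ℂ) ^ (-s) = 1 := (sub_eq_zero.1 h3).symm
  have h5 : ‖χ p * (p : ℂ) ^ (-s)‖ < 1 := by
    rw [norm_mul, Complex.norm_natCast_cpow_of_pos hp'.pos, Complex.neg_re]
    have h6 : (p : ℝ) ^ (-s.re) < 1 :=
      Real.rpow_lt_one_of_one_lt_of_neg (by exact_mod_cast hp'.one_lt) (by linarith)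
    have h7 := χ.norm_le_one p
    have h8 : 0 ≤ (p : ℝ) ^ (-s.re) := by positivity
    nlinarith
  rw [h4, norm_one] at h5
  exact lt_irrefl _ h5

open scoped ComplexOrder in
theorem exists_le_norm_LFunction_of_nonneg : ∃ c K : ℝ, 0 < c ∧ 1 ≤ K ∧
    ∀ (q : ℕ) [NeZero q] (χ : DirichletCharacter ℂ q), χ ≠ 1 → χ ^ 2 = 1 →
    ∀ ε β : ℝ, ε ≤ 1 / 8 → 1 - ε ≤ β → β < 1 → 0 ≤ (zetaOne β * χ.LFunction β).re →
    c * (1 - β) * K ^ (-(10 * ε)) * (q : ℝ) ^ (-(20 * ε)) ≤ ‖χ.LFunction 1‖ := by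
  obtain ⟨c, hc, h⟩ := exists_le_norm_residue
  obtain ⟨C, hC, hCb⟩ := exists_norm_LFunction_le_on_ball
  obtain ⟨D, hD, hDb⟩ := exists_norm_zetaOne_le
  have hDC : 1 ≤ D * C := by nlinarith
  refine ⟨c, D * C, hc, hDC, fun q _ χ hχ hχ2 ε β hε hβ hβ1 hpos => ?_⟩
  obtain ⟨h1, h2, h3, h4⟩ := zetaMul_props hχ2
  have hq : 1 ≤ q := NeZero.one_le
  have hq' : (1 : ℝ) ≤ q := by exact_mod_cast hq
  have := h (fun s => zetaOne s * χ.LFunction s) χ.zetaMul (D * C) ε β q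
    (differentiable_zetaOne.mul (DirichletCharacter.differentiable_LFunction hχ)) h1 h2 h3 h4 hDC hq
    (fun s hs => ?_) hε hβ hβ1 hpos
  · simpa [zetaOne_one] using this
  · rw [norm_mul]
    calc ‖zetaOne s‖ * ‖χ.LFunction s‖ ≤ D * (C * q) := by
          gcongr
          · exact hDb s hs
          · exact hCb q χ hχ s hs
      _ ≤ D * C * q ^ 2 := by
          rw [← mul_assoc]
          gcongr
          nlinarith

open scoped ComplexOrder in
theorem exists_le_norm_LFunction_mul {r : ℕ} [NeZero r] {ψ : DirichletCharacter ℂ r} (hψ : ψ ≠ 1)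
    (hψ2 : ψ ^ 2 = 1) : ∃ c K : ℝ, 0 < c ∧ 1 ≤ K ∧
    ∀ (q : ℕ) [NeZero q] (χ : DirichletCharacter ℂ q), χ ≠ 1 → χ ^ 2 = 1 →
    (DirichletCharacter.changeLevel (Dvd.intro r rfl : q ∣ q * r) χ *
      DirichletCharacter.changeLevel (Dvd.intro_left q rfl : r ∣ q * r) ψ) ≠ 1 →
    ∀ ε β : ℝ, ε ≤ 1 / 8 → 1 - ε ≤ β → β < 1 → ψ.LFunction β = 0 →
    c * (1 - β) * K ^ (-(10 * ε)) * (q : ℝ) ^ (-(20 * ε)) ≤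
      ‖χ.LFunction 1 * ψ.LFunction 1 *
        (DirichletCharacter.changeLevel (Dvd.intro r rfl : q ∣ q * r) χ *
      DirichletCharacter.changeLevel (Dvd.intro_left q rfl : r ∣ q * r) ψ).LFunction 1‖ := by
  obtain ⟨c, hc, h⟩ := exists_le_norm_residue
  obtain ⟨C, hC, hCb⟩ := exists_norm_LFunction_le_on_ball
  obtain ⟨D, hD, hDb⟩ := exists_norm_zetaOne_le
  have hr' : (1 : ℝ) ≤ r := by exact_mod_cast NeZero.one_le
  have hDC : 1 ≤ D * C * (C * r) * (C * r) :=
    one_le_mul_of_one_le_of_one_le (one_le_mul_of_one_le_of_one_le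
      (one_le_mul_of_one_le_of_one_le hD hC) (one_le_mul_of_one_le_of_one_le hC hr'))
      (one_le_mul_of_one_le_of_one_le hC hr')
  refine ⟨c, D * C * (C * r) * (C * r), hc, hDC, fun q _ χ hχ hχ2 hne ε β hε hβ hβ1 hzero => ?_⟩
  obtain ⟨h1, h2, h3⟩ := fourFold_props hχ2 hψ2
  have hq : 1 ≤ q := NeZero.one_le
  have hq' : (1 : ℝ) ≤ q := by exact_mod_cast hq
  have := h (fun s => zetaOne s * χ.LFunction s * ψ.LFunction s *
      (DirichletCharacter.changeLevel (Dvd.intro r rfl : q ∣ q * r) χ *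
      DirichletCharacter.changeLevel (Dvd.intro_left q rfl : r ∣ q * r) ψ).LFunction s)
    (fourFold χ ψ) (D * C * (C * r) * (C * r)) ε β q
    (((differentiable_zetaOne.mul (DirichletCharacter.differentiable_LFunction hχ)).mul
      (DirichletCharacter.differentiable_LFunction hψ)).mul
      (DirichletCharacter.differentiable_LFunction hne)) h1 (fourFold_one χ ψ) h2 h3 hDC hq
    (fun s hs => ?_) hε hβ hβ1 (by simp [hzero])
  · simpa [zetaOne_one] using this
  · rw [norm_mul, norm_mul, norm_mul]
    have e := hCb (q * r) _ hne s hs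
    push_cast at e
    calc _ ≤ D * (C * q) * (C * r) * (C * (q * r)) := by
          gcongr
          · exact hDb s hs
          · exact hCb q χ hχ s hs
          · exact hCb r ψ hψ s hs
      _ = _ := by ring

open scoped ComplexOrder in
/-- The lower bound of Siegel for `L(1, χ)`. -/
theorem siegel {ε : ℝ} (hε : 0 < ε) : ∃ c : ℝ, 0 < c ∧
    ∀ (q : ℕ) [NeZero q] (χ : DirichletCharacter ℂ q), χ ≠ 1 → χ ^ 2 = 1 →
    c * (q : ℝ) ^ (-ε) ≤ ‖χ.LFunction 1‖ := by
  obtain ⟨δ, hδ, hZ⟩ := exists_zetaOne_ne_zero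
  obtain ⟨c, K, hc, hK, h⟩ := exists_le_norm_LFunction_of_nonneg
  set η : ℝ := min δ (min (1 / 8) (ε / 40)) with hη
  have hη0 : 0 < η := lt_min hδ (lt_min (by norm_num) (by positivity))
  have hηδ : η ≤ δ := min_le_left _ _
  have hη8 : η ≤ 1 / 8 := (min_le_right _ _).trans (min_le_left _ _)
  have hηε : 20 * η ≤ ε / 2 := by
    have : η ≤ ε / 40 := (min_le_right _ _).trans (min_le_right _ _)
    linarith
  have hKpos : 0 < K := by linarith
  have hmono : ∀ q : ℕ, 1 ≤ q → (q : ℝ) ^ (-(ε / 2)) ≤ (q : ℝ) ^ (-(20 * η)) := fun q hq =>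
    Real.rpow_le_rpow_of_exponent_le (by exact_mod_cast hq) (by linarith)
  have hmono' : ∀ q : ℕ, 1 ≤ q → (q : ℝ) ^ (-ε) ≤ (q : ℝ) ^ (-(20 * η)) := fun q hq =>
    Real.rpow_le_rpow_of_exponent_le (by exact_mod_cast hq) (by linarith)
  by_cases hex : ∃ (r : ℕ) (_ : NeZero r) (ψ : DirichletCharacter ℂ r) (β : ℝ), ψ ≠ 1 ∧ ψ ^ 2 = 1 ∧
      1 - η ≤ β ∧ β < 1 ∧ ψ.LFunction β = 0
  · obtain ⟨r, _, ψ, β, hψ, hψ2, hβ, hβ1, hzero⟩ := hex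
    obtain ⟨c', K', hc', hK', h'⟩ := exists_le_norm_LFunction_mul hψ hψ2
    obtain ⟨C, hC, hCb⟩ := exists_norm_LFunction_le (ε := min (ε / 4) (1 / 3))
      (lt_min (by positivity) (by norm_num)) (min_le_right _ _)
    have hr : (1 : ℝ) ≤ r := by exact_mod_cast NeZero.one_le
    have hL1 : 0 < ‖ψ.LFunction 1‖ :=
      norm_pos_iff.2 (DirichletCharacter.LFunction_apply_one_ne_zero hψ)
    have hK'pos : 0 < K' := by linarith
    have hβ' : 0 < 1 - β := by linarith
    set E : ℝ := ‖ψ.LFunction 1‖ * (C * (2 * r : ℝ) ^ (ε / 2)) with hE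
    have hEpos : 0 < E := by positivity
    refine ⟨min (c * (1 - β) * K ^ (-(10 * η))) (c' * (1 - β) * K' ^ (-(10 * η)) / E),
      lt_min (by positivity) (by positivity), fun q _ χ hχ hχ2 => ?_⟩
    have hq : 1 ≤ q := NeZero.one_le
    have hq' : (1 : ℝ) ≤ q := by exact_mod_cast hq
    have hqpos : (0 : ℝ) < q := by linarith
    by_cases hne : (DirichletCharacter.changeLevel (Dvd.intro r rfl : q ∣ q * r) χ *
      DirichletCharacter.changeLevel (Dvd.intro_left q rfl : r ∣ q * r) ψ) = 1
    · have hz := LFunction_eq_zero_of_changeLevel_mul_eq_one hψ2 hne (s := (β : ℂ))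
        (by exact_mod_cast hβ1.ne) (by simp only [Complex.ofReal_re]; linarith) hzero
      refine le_trans ?_ (h q χ hχ hχ2 η β hη8 hβ hβ1 (by simp [hz]))
      gcongr
      · exact min_le_left _ _
      · linarith
    · have h1 := h' q χ hχ hχ2 hne η β hη8 hβ hβ1 hzero
      have h2 := hCb (q * r) _ hne 1 (by simp; positivity) (by norm_num)
      rw [norm_mul, norm_mul] at h1
      set L := ‖(DirichletCharacter.changeLevel (Dvd.intro r rfl : q ∣ q * r) χ *
        DirichletCharacter.changeLevel (Dvd.intro_left q rfl : r ∣ q * r) ψ).LFunction 1‖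
      have h3 : L ≤ C * (2 * r : ℝ) ^ (ε / 2) * (q : ℝ) ^ (ε / 2) := by
        refine h2.trans ?_
        rw [mul_assoc]
        gcongr
        rw [← Real.mul_rpow (by positivity) (by positivity)]
        simp only [Complex.one_im, abs_zero, zero_add]
        push_cast
        rw [show (q : ℝ) * r * 2 = 2 * r * q by ring]
        have h5 : 1 ≤ (2 * r * q : ℝ) := by nlinarith
        refine Real.rpow_le_rpow_of_exponent_le h5 ?_
        have := min_le_left (ε / 4) (1 / 3 : ℝ)
        linarith
      have h4 : c' * (1 - β) * K' ^ (-(10 * η)) * (q : ℝ) ^ (-(ε / 2)) ≤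
          ‖χ.LFunction 1‖ * (E * (q : ℝ) ^ (ε / 2)) := by
        calc _ ≤ c' * (1 - β) * K' ^ (-(10 * η)) * (q : ℝ) ^ (-(20 * η)) := by
              gcongr
          _ ≤ ‖χ.LFunction 1‖ * ‖ψ.LFunction 1‖ * L := h1
          _ ≤ ‖χ.LFunction 1‖ * ‖ψ.LFunction 1‖ *
              (C * (2 * r : ℝ) ^ (ε / 2) * (q : ℝ) ^ (ε / 2)) := by gcongr
          _ = _ := by rw [hE]; ring
      calc _ ≤ c' * (1 - β) * K' ^ (-(10 * η)) / E * (q : ℝ) ^ (-ε) := by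
            gcongr
            exact min_le_right _ _
        _ = (c' * (1 - β) * K' ^ (-(10 * η)) * (q : ℝ) ^ (-(ε / 2))) / (E * (q : ℝ) ^ (ε / 2)) := by
            rw [show -ε = -(ε / 2) + -(ε / 2) by ring, Real.rpow_add hqpos,
              Real.rpow_neg hqpos.le (ε / 2)]
            field_simp
        _ ≤ _ := by
            rw [div_le_iff₀ (by positivity)]
            exact h4
  · refine ⟨c * η * K ^ (-(10 * η)), by positivity, fun q _ χ hχ hχ2 => ?_⟩
    have hq : 1 ≤ q := NeZero.one_le
    obtain ⟨h1, h2, h3, h4⟩ := zetaMul_props hχ2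
    have hpos : 0 ≤ (zetaOne ((1 - η : ℝ) : ℂ) * χ.LFunction ((1 - η : ℝ) : ℂ)).re := by
      by_contra! hneg
      obtain ⟨x, hx, hx1, hx0⟩ := exists_eq_zero_of_re_neg
        (W := fun s => zetaOne s * χ.LFunction s)
        (differentiable_zetaOne.mul (DirichletCharacter.differentiable_LFunction hχ)) h1 h2 h3 h4
        (by linarith) hneg
      have hLx : χ.LFunction x = 0 :=
        (mul_eq_zero.1 hx0).resolve_left (hZ x (by linarith) hx1)
      rcases hx1.lt_or_eq with h5 | h5
      · exact hex ⟨q, inferInstance, χ, x, hχ, hχ2, hx.le, h5, hLx⟩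
      · rw [h5] at hLx
        exact DirichletCharacter.LFunction_apply_one_ne_zero hχ (by simpa using hLx)
    have := h q χ hχ hχ2 η (1 - η) hη8 le_rfl (by linarith) hpos
    rw [sub_sub_cancel] at this
    refine le_trans ?_ this
    gcongr
    · exact_mod_cast hq
    · linarith

theorem exists_le_norm_LFunction_of_far {κ a : ℝ} (hκ : 0 < κ) (hκ' : κ ≤ 1 / 3) (ha : 0 < a) :
    ∃ c : ℝ, 0 < c ∧ ∀ (q : ℕ) [NeZero q] (χ : DirichletCharacter ℂ q) (x y : ℝ),
    0 < x → x ≤ 1 → (χ ^ 2 ≠ 1 ∨ a * (q * (|y| + 2)) ^ (-(3 * κ)) ≤ ‖(x : ℂ) + 2 * Complex.I * y‖) →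
    c * x ^ (3 / 4 : ℝ) * (q * (|y| + 2)) ^ (-(2 * κ)) ≤
      ‖χ.LFunction (1 + x + Complex.I * y)‖ := by
  obtain ⟨C₁, hC₁, h₁⟩ := exists_norm_LFunction_le hκ hκ'
  obtain ⟨C₂, hC₂, h₂⟩ := exists_norm_LFunction_one_le hκ (by linarith)
  set B : ℝ := C₁ * 2 ^ (2 * κ) + C₂ * (a⁻¹ + 1) * 2 ^ κ with hB
  set E : ℝ := (2 * C₂) ^ 3 * B with hE
  have hBpos : 0 < B := by positivity
  have hEpos : 0 < E := by positivity
  refine ⟨E⁻¹ ^ (1 / 4 : ℝ), by positivity, fun q _ χ x y hx hx1 hfar => ?_⟩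
  set Q : ℝ := q * (|y| + 2) with hQ
  have hq : (1 : ℝ) ≤ q := by exact_mod_cast NeZero.one_le
  have hy : 0 ≤ |y| := abs_nonneg y
  have hQ1 : 1 ≤ Q := by nlinarith
  have hQpos : 0 < Q := by linarith
  have h3 := DirichletCharacter.norm_LFunction_product_ge_one χ hx y
  have hT : ‖DirichletCharacter.LFunctionTrivChar q (1 + x)‖ ≤ 2 * C₂ * (x⁻¹ * Q ^ κ) := by
    refine (h₂ q (1 + x) (by simpa using hx) (by simp; linarith)).trans ?_
    have : 1 ≤ x⁻¹ := one_le_inv_iff₀.2 ⟨hx, hx1⟩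
    have e1 : ‖(1 + x : ℂ) - 1‖⁻¹ = x⁻¹ := by simp [abs_of_pos hx]
    rw [e1]
    calc _ ≤ C₂ * (2 * x⁻¹) * Q ^ κ := by
          gcongr
          · linarith
          · simp [hQ]; nlinarith
      _ = _ := by ring
  have hU : ‖(χ ^ 2).LFunction (1 + x + 2 * Complex.I * y)‖ ≤ B * Q ^ (5 * κ) := by
    have hre : (1 + (x : ℂ) + 2 * Complex.I * y).re = 1 + x := by simp
    have him : (1 + (x : ℂ) + 2 * Complex.I * y).im = 2 * y := by simp
    have hQ2 : (q : ℝ) * (|2 * y| + 2) ≤ 2 * Q := by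
      rw [abs_mul, abs_two]; nlinarith
    by_cases hχ : χ ^ 2 = 1
    · have hfar' := hfar.resolve_left (not_not.2 hχ)
      rw [hχ]
      refine (h₂ q _ (by rw [hre]; linarith) (by rw [hre]; linarith)).trans ?_
      rw [him]
      have e1 : ‖(1 + (x : ℂ) + 2 * Complex.I * y) - 1‖⁻¹ ≤ a⁻¹ * Q ^ (3 * κ) := by
        rw [show (1 + (x : ℂ) + 2 * Complex.I * y) - 1 = x + 2 * Complex.I * y by ring]
        calc _ ≤ (a * Q ^ (-(3 * κ)))⁻¹ := by
              gcongr
          _ = _ := by rw [mul_inv, Real.rpow_neg hQpos.le, inv_inv]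
      have e2 : 1 ≤ Q ^ (3 * κ) := Real.one_le_rpow hQ1 (by positivity)
      calc _ ≤ C₂ * (a⁻¹ * Q ^ (3 * κ) + Q ^ (3 * κ)) * (2 * Q) ^ κ := by gcongr
        _ = C₂ * (a⁻¹ + 1) * 2 ^ κ * Q ^ (4 * κ) := by
            rw [Real.mul_rpow (by norm_num) hQpos.le, show 4 * κ = 3 * κ + κ by ring,
              Real.rpow_add hQpos]
            ring
        _ ≤ B * Q ^ (5 * κ) := by
            gcongr
            · rw [hB]
              have : 0 ≤ C₁ * 2 ^ (2 * κ) := by positivity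
              linarith
            · norm_num
    · refine (h₁ q _ hχ _ (by rw [hre]; linarith) (by rw [hre]; linarith)).trans ?_
      rw [him]
      calc _ ≤ C₁ * (2 * Q) ^ (2 * κ) := by gcongr
        _ = C₁ * 2 ^ (2 * κ) * Q ^ (2 * κ) := by
            rw [Real.mul_rpow (by norm_num) hQpos.le, mul_assoc]
        _ ≤ B * Q ^ (5 * κ) := by
            gcongr
            · rw [hB]
              have : 0 ≤ C₂ * (a⁻¹ + 1) * 2 ^ κ := by positivity
              linarith
            · norm_num
  rw [norm_mul, norm_mul, norm_pow, norm_pow] at h3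
  set L := ‖χ.LFunction (1 + x + Complex.I * y)‖ with hL
  have h4 : 1 ≤ (2 * C₂ * (x⁻¹ * Q ^ κ)) ^ 3 * L ^ 4 * (B * Q ^ (5 * κ)) := by
    refine h3.le.trans ?_
    gcongr
  have h5 : (E⁻¹ ^ (1 / 4 : ℝ) * x ^ (3 / 4 : ℝ) * Q ^ (-(2 * κ))) ^ 4 ≤ L ^ 4 := by
    have e1 : (E⁻¹ ^ (1 / 4 : ℝ)) ^ 4 = E⁻¹ := by
      rw [← Real.rpow_natCast, ← Real.rpow_mul (by positivity)]; norm_num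
    have e2 : (x ^ (3 / 4 : ℝ)) ^ 4 = x ^ 3 := by
      rw [← Real.rpow_natCast, ← Real.rpow_mul (by positivity), ← Real.rpow_natCast]; norm_num
    have e3 : (Q ^ (-(2 * κ))) ^ 4 = (Q ^ (8 * κ))⁻¹ := by
      rw [← Real.rpow_natCast, ← Real.rpow_mul (by positivity), ← Real.rpow_neg hQpos.le]
      congr 1; push_cast; ring
    have e4 : (Q ^ κ) ^ 3 * Q ^ (5 * κ) = Q ^ (8 * κ) := by
      rw [← Real.rpow_natCast, ← Real.rpow_mul (by positivity), ← Real.rpow_add hQpos]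
      congr 1; push_cast; ring
    rw [mul_pow, mul_pow, e1, e2, e3, ← e4]
    have : E⁻¹ * x ^ 3 * ((Q ^ κ) ^ 3 * Q ^ (5 * κ))⁻¹ =
        ((2 * C₂ * (x⁻¹ * Q ^ κ)) ^ 3 * (B * Q ^ (5 * κ)))⁻¹ := by
      rw [hE]; field_simp
    rw [this, inv_le_iff_one_le_mul₀' (by positivity)]
    linarith
  exact le_of_pow_le_pow_left₀ (by norm_num) (norm_nonneg _) h5

theorem norm_LFunction_sub_le {q : ℕ} [NeZero q] {χ : DirichletCharacter ℂ q} (hχ : χ ≠ 1) {C κ T : ℝ}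
    (hκ : 0 < κ) (hC : 0 ≤ C)
    (h : ∀ s : ℂ, 1 - κ / 2 < s.re → s.re ≤ 3 → ‖deriv χ.LFunction s‖ ≤
      C * (q * (|s.im| + 2)) ^ (2 * κ)) {z w : ℂ} (hz : 1 ≤ z.re) (hz' : z.re ≤ 3) (hw : 1 ≤ w.re)
    (hw' : w.re ≤ 3) (hzT : |z.im| ≤ T) (hwT : |w.im| ≤ T) :
    ‖χ.LFunction w - χ.LFunction z‖ ≤ C * (q * (T + 2)) ^ (2 * κ) * ‖w - z‖ := by
  have hconv : Convex ℝ {s : ℂ | (1 ≤ s.re ∧ s.re ≤ 3) ∧ (-T ≤ s.im ∧ s.im ≤ T)} := by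
    have h1 := (convex_Icc (1 : ℝ) 3).linear_preimage Complex.reLm
    have h2 := (convex_Icc (-T) T).linear_preimage Complex.imLm
    exact h1.inter h2
  refine hconv.norm_image_sub_le_of_norm_deriv_le
    (fun s _ => (DirichletCharacter.differentiable_LFunction hχ) s) (fun s hs => ?_)
    ⟨⟨hz, hz'⟩, abs_le.1 hzT⟩ ⟨⟨hw, hw'⟩, abs_le.1 hwT⟩
  refine (h s (by linarith [hs.1.1]) hs.1.2).trans ?_
  have : |s.im| ≤ T := abs_le.2 hs.2
  gcongr

theorem exists_le_norm_LFunction {ε : ℝ} (hε : 0 < ε) : ∃ c : ℝ, 0 < c ∧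
    ∀ (q : ℕ) [NeZero q] (χ : DirichletCharacter ℂ q), χ ≠ 1 → ∀ s : ℂ, 1 < s.re → s.re ≤ 2 →
    c * (q * (|s.im| + 2)) ^ (-ε) ≤ ‖χ.LFunction s‖ := by
  set κ : ℝ := min (ε / 14) (1 / 3) with hκ
  have hκ0 : 0 < κ := lt_min (by positivity) (by norm_num)
  have hκ3 : κ ≤ 1 / 3 := min_le_right _ _
  have hκε : 14 * κ ≤ ε := by
    have : κ ≤ ε / 14 := min_le_left _ _
    linarith
  obtain ⟨cs, hcs, hS⟩ := siegel hκ0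
  obtain ⟨C, hC, hD⟩ := exists_norm_deriv_LFunction_le hκ0 hκ3
  set a : ℝ := cs / (2 * C) with ha
  have ha0 : 0 < a := by positivity
  obtain ⟨c₁, hc₁, hF⟩ := exists_le_norm_LFunction_of_far hκ0 hκ3 (a := a / 2) (by positivity)
  set b : ℝ := min 1 (c₁ / (2 * C)) with hb
  have hb0 : 0 < b := lt_min one_pos (by positivity)
  have hb1 : b ≤ 1 := min_le_left _ _
  have hbC : 2 * (b * C) ≤ c₁ := by
    have : b ≤ c₁ / (2 * C) := min_le_right _ _
    rw [le_div_iff₀ (by positivity)] at this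
    linarith
  set c : ℝ := min (cs / 2) (min (c₁ * (a / 2) ^ (3 / 4 : ℝ)) (c₁ / 2 * b ^ 3)) with hc
  have hc0 : 0 < c := lt_min (by positivity) (lt_min (by positivity) (by positivity))
  refine ⟨c, hc0, fun q _ χ hχ s hs hs2 => ?_⟩
  set x : ℝ := s.re - 1 with hx
  set y : ℝ := s.im with hy
  have hsxy : s = 1 + x + Complex.I * y := by
    apply Complex.ext <;> simp [hx, hy]
  set Q : ℝ := q * (|y| + 2) with hQ
  have hq : (1 : ℝ) ≤ q := by exact_mod_cast NeZero.one_le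
  have hy0 : 0 ≤ |y| := abs_nonneg y
  have hQ1 : 1 ≤ Q := by nlinarith
  have hQpos : 0 < Q := by linarith
  have hqQ : (q : ℝ) ≤ Q := by nlinarith
  have hx0 : 0 < x := by linarith
  have hx1 : x ≤ 1 := by linarith
  have hmove : (χ ^ 2 ≠ 1 ∨ a / 2 * Q ^ (-(3 * κ)) ≤ |y|) → c * Q ^ (-ε) ≤ ‖χ.LFunction s‖ := by
    intro hyp
    have hF' : ∀ x : ℝ, 0 < x → x ≤ 1 → c₁ * x ^ (3 / 4 : ℝ) * Q ^ (-(2 * κ)) ≤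
        ‖χ.LFunction (1 + x + Complex.I * y)‖ := by
      intro x hx0 hx1
      refine hF q χ x y hx0 hx1 (hyp.imp id fun h => h.trans ?_)
      have := Complex.abs_im_le_norm ((x : ℂ) + 2 * Complex.I * y)
      have e : ((x : ℂ) + 2 * Complex.I * y).im = 2 * y := by simp
      rw [e, abs_mul, abs_two] at this
      linarith
    set x₀ : ℝ := (b * Q ^ (-(4 * κ))) ^ 4 with hx₀
    have hbQ0 : 0 < b * Q ^ (-(4 * κ)) := by positivity
    have hbQ : b * Q ^ (-(4 * κ)) ≤ 1 := by
      have : Q ^ (-(4 * κ)) ≤ 1 := Real.rpow_le_one_of_one_le_of_nonpos hQ1 (by linarith)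
      have h0 : 0 < Q ^ (-(4 * κ)) := by positivity
      nlinarith
    have hx₀0 : 0 < x₀ := by positivity
    have hx₀1 : x₀ ≤ 1 := pow_le_one₀ hbQ0.le hbQ
    have hx₀34 : x₀ ^ (3 / 4 : ℝ) = (b * Q ^ (-(4 * κ))) ^ 3 := by
      rw [hx₀, ← Real.rpow_natCast, ← Real.rpow_mul hbQ0.le, ← Real.rpow_natCast]; norm_num
    have hfin : c * Q ^ (-ε) ≤ c₁ / 2 * x₀ ^ (3 / 4 : ℝ) * Q ^ (-(2 * κ)) := by
      have e1 : (Q ^ (-(4 * κ))) ^ 3 * Q ^ (-(2 * κ)) = Q ^ (-(14 * κ)) := by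
        rw [← Real.rpow_natCast, ← Real.rpow_mul hQpos.le, ← Real.rpow_add hQpos]
        congr 1; push_cast; ring
      calc c * Q ^ (-ε) ≤ (c₁ / 2 * b ^ 3) * Q ^ (-(14 * κ)) := by
            gcongr
            · exact (min_le_right _ _).trans (min_le_right _ _)
        _ = _ := by rw [hx₀34, ← e1]; ring
    rcases le_total x₀ x with hxx | hxx
    · rw [hsxy]
      refine hfin.trans (le_trans ?_ (hF' x hx0 hx1))
      gcongr
      linarith
    · have h1 := hF' x₀ hx₀0 hx₀1
      have h2 := norm_LFunction_sub_le hχ hκ0 (by linarith) (hD q χ hχ)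
        (z := s) (w := 1 + x₀ + Complex.I * y) (T := |y|) (by linarith) (by linarith)
        (by simp; linarith) (by simp; linarith) le_rfl (by simp)
      have e1 : ‖(1 + x₀ + Complex.I * y : ℂ) - s‖ ≤ x₀ := by
        have : (1 + x₀ + Complex.I * y : ℂ) - s = ((x₀ - x : ℝ) : ℂ) := by
          nth_rewrite 1 [hsxy]; push_cast; ring
        rw [this, Complex.norm_real, Real.norm_eq_abs, abs_of_nonneg (by linarith)]
        linarith
      have e2 : C * Q ^ (2 * κ) * x₀ ≤ c₁ / 2 * x₀ ^ (3 / 4 : ℝ) * Q ^ (-(2 * κ)) := by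
        have e3 : x₀ = x₀ ^ (3 / 4 : ℝ) * (b * Q ^ (-(4 * κ))) := by
          rw [hx₀34, hx₀]; ring
        have e4 : Q ^ (2 * κ) * Q ^ (-(4 * κ)) = Q ^ (-(2 * κ)) := by
          rw [← Real.rpow_add hQpos]; congr 1; ring
        have e5 : 0 ≤ x₀ ^ (3 / 4 : ℝ) * Q ^ (-(2 * κ)) := by positivity
        calc C * Q ^ (2 * κ) * x₀ = (b * C) * (x₀ ^ (3 / 4 : ℝ) * (Q ^ (2 * κ) * Q ^ (-(4 * κ)))) := by
              nth_rewrite 1 [e3]; ring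
          _ ≤ c₁ / 2 * (x₀ ^ (3 / 4 : ℝ) * (Q ^ (2 * κ) * Q ^ (-(4 * κ)))) := by
              rw [e4]
              gcongr
              linarith
          _ = _ := by rw [e4]; ring
      have e3 := norm_sub_norm_le (χ.LFunction (1 + x₀ + Complex.I * y)) (χ.LFunction s)
      have e4 : C * Q ^ (2 * κ) * ‖(1 + x₀ + Complex.I * y : ℂ) - s‖ ≤ C * Q ^ (2 * κ) * x₀ := by
        gcongr
      have e5 : c₁ * x₀ ^ (3 / 4 : ℝ) * Q ^ (-(2 * κ)) =
        2 * (c₁ / 2 * x₀ ^ (3 / 4 : ℝ) * Q ^ (-(2 * κ))) := by ring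
      linarith
  by_cases hχ2 : χ ^ 2 = 1
  · rcases le_or_gt (a / 2 * Q ^ (-(3 * κ))) |y| with h1 | h1
    · exact hmove (.inr h1)
    · rcases le_or_gt (a / 2 * Q ^ (-(3 * κ))) x with h2 | h2
      · have h3 := hF q χ x y hx0 hx1 (.inr (h2.trans ?_))
        · rw [hsxy]
          refine le_trans ?_ h3
          have e1 : (Q ^ (-(3 * κ))) ^ (3 / 4 : ℝ) * Q ^ (-(2 * κ)) = Q ^ (-(17 / 4 * κ)) := by
            rw [← Real.rpow_mul hQpos.le, ← Real.rpow_add hQpos]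
            congr 1; ring
          calc c * Q ^ (-ε) ≤ (c₁ * (a / 2) ^ (3 / 4 : ℝ)) * Q ^ (-(17 / 4 * κ)) := by
                gcongr
                · exact (min_le_right _ _).trans (min_le_left _ _)
                · linarith
            _ = c₁ * (a / 2 * Q ^ (-(3 * κ))) ^ (3 / 4 : ℝ) * Q ^ (-(2 * κ)) := by
                rw [Real.mul_rpow (x := a / 2) (y := Q ^ (-(3 * κ))) (by positivity) (by positivity), ← e1]; ring
            _ ≤ _ := by gcongr
        · have := Complex.re_le_norm ((x : ℂ) + 2 * Complex.I * y)
          simpa using this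
      · have h3 := hS q χ hχ hχ2
        have h4 := norm_LFunction_sub_le hχ hκ0 (by linarith) (hD q χ hχ)
          (z := s) (w := 1) (T := |y|) (by linarith) (by linarith)
          (by simp) (by norm_num) le_rfl (by simp)
        have e1 : ‖1 - s‖ ≤ a * Q ^ (-(3 * κ)) := by
          have e2 : ‖1 - s‖ ≤ x + |y| := by
            have := Complex.norm_le_abs_re_add_abs_im (1 - s)
            simp only [Complex.sub_re, Complex.one_re, Complex.sub_im, Complex.one_im, zero_sub,
              abs_neg] at this
            rw [abs_sub_comm, abs_of_pos hx0] at this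
            exact this
          linarith
        have e2 : C * Q ^ (2 * κ) * ‖1 - s‖ ≤ cs / 2 * Q ^ (-κ) := by
          have e4 : Q ^ (2 * κ) * Q ^ (-(3 * κ)) = Q ^ (-κ) := by
            rw [← Real.rpow_add hQpos]; congr 1; ring
          calc _ ≤ C * Q ^ (2 * κ) * (a * Q ^ (-(3 * κ))) := by gcongr
            _ = (C * a) * (Q ^ (2 * κ) * Q ^ (-(3 * κ))) := by ring
            _ = _ := by
                rw [e4, ha]; field_simp
        have e3 : cs * Q ^ (-κ) ≤ cs * (q : ℝ) ^ (-κ) := by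
          gcongr ?_ * ?_
          exact Real.rpow_le_rpow_of_nonpos (by linarith) hqQ (by linarith)
        have e4 : c * Q ^ (-ε) ≤ cs / 2 * Q ^ (-κ) := by
          gcongr
          · exact min_le_left _ _
          · linarith
        have e5 := norm_sub_norm_le (χ.LFunction 1) (χ.LFunction s)
        linarith
  · exact hmove (.inl hχ2)

theorem exists_norm_logDeriv_le {ε : ℝ} (hε : 0 < ε) (hε' : ε ≤ 1 / 3) :
    ∃ C r : ℝ, 0 < C ∧ 0 < r ∧ ∀ (q : ℕ) [NeZero q] (χ : DirichletCharacter ℂ q), χ ≠ 1 →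
    ∀ s : ℂ, 1 < s.re → s.re ≤ 2 →
    ∀ z ∈ Metric.closedBall s (r * (q * (|s.im| + 2)) ^ (-(3 * ε))),
      χ.LFunction z ≠ 0 ∧ ‖-deriv χ.LFunction z / χ.LFunction z‖ ≤
        C * (q * (|s.im| + 2)) ^ (3 * ε) := by
  obtain ⟨c, hc, hL⟩ := exists_le_norm_LFunction hε
  obtain ⟨C, hC, hD⟩ := exists_norm_deriv_LFunction_le hε hε'
  set D : ℝ := C * 2 ^ (2 * ε) with hDdef
  have hD0 : 0 < D := by positivity
  set r : ℝ := min (c / (2 * D)) (ε / 4) with hr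
  have hr0 : 0 < r := lt_min (by positivity) (by positivity)
  have hrε : r ≤ ε / 4 := min_le_right _ _
  have hrD : D * r ≤ c / 2 := by
    have : r ≤ c / (2 * D) := min_le_left _ _
    rw [le_div_iff₀ (by positivity)] at this
    linarith
  refine ⟨D / (c / 2), r, by positivity, hr0, fun q _ χ hχ s hs hs2 z hz => ?_⟩
  set Q : ℝ := q * (|s.im| + 2) with hQ
  have hq : (1 : ℝ) ≤ q := by exact_mod_cast NeZero.one_le
  have hy0 : 0 ≤ |s.im| := abs_nonneg _
  have hQ1 : 1 ≤ Q := by nlinarith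
  have hQpos : 0 < Q := by linarith
  set R : ℝ := r * Q ^ (-(3 * ε)) with hR
  have hR0 : 0 < R := by positivity
  have hRr : R ≤ r := by
    have : Q ^ (-(3 * ε)) ≤ 1 := Real.rpow_le_one_of_one_le_of_nonpos hQ1 (by linarith)
    nlinarith
  have hder : ∀ w ∈ Metric.closedBall s R, ‖deriv χ.LFunction w‖ ≤ D * Q ^ (2 * ε) := by
    intro w hw
    have hw' : ‖w - s‖ ≤ R := by simpa [dist_eq_norm] using hw
    have h1 := abs_le.1 ((Complex.abs_re_le_norm (w - s)).trans hw')
    have h2 := (Complex.abs_im_le_norm (w - s)).trans hw'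
    simp only [Complex.sub_re, Complex.sub_im] at h1 h2
    refine (hD q χ hχ w (by linarith) (by linarith)).trans ?_
    rw [hDdef, mul_assoc, ← Real.mul_rpow (by norm_num) hQpos.le]
    have h3 : |w.im| ≤ |s.im| + 1 := by
      have := abs_sub_abs_le_abs_sub w.im s.im
      linarith
    refine mul_le_mul_of_nonneg_left (Real.rpow_le_rpow (by positivity) ?_ (by positivity))
      (by linarith)
    rw [hQ]; nlinarith
  have hQQ : Q ^ (2 * ε) * Q ^ (-(3 * ε)) = Q ^ (-ε) := by
    rw [← Real.rpow_add hQpos]; congr 1; ring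
  have hlow : c / 2 * Q ^ (-ε) ≤ ‖χ.LFunction z‖ := by
    have h1 := (convex_closedBall s R).norm_image_sub_le_of_norm_deriv_le
      (fun w _ => (DirichletCharacter.differentiable_LFunction hχ) w) hder hz
      (Metric.mem_closedBall_self hR0.le)
    have h2 : ‖s - z‖ ≤ R := by rw [norm_sub_rev]; simpa [dist_eq_norm] using hz
    have h3 := hL q χ hχ s hs hs2
    have h4 := norm_sub_norm_le (χ.LFunction s) (χ.LFunction z)
    have h5 : D * Q ^ (2 * ε) * ‖s - z‖ ≤ c / 2 * Q ^ (-ε) := by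
      calc _ ≤ D * Q ^ (2 * ε) * R := by gcongr
        _ = D * r * Q ^ (-ε) := by rw [hR, ← hQQ]; ring
        _ ≤ _ := by gcongr
    linarith
  have hpos : 0 < ‖χ.LFunction z‖ := lt_of_lt_of_le (by positivity) hlow
  refine ⟨norm_pos_iff.1 hpos, ?_⟩
  rw [norm_div, norm_neg, div_le_iff₀ hpos]
  have h6 : Q ^ (3 * ε) * Q ^ (-ε) = Q ^ (2 * ε) := by
    rw [← Real.rpow_add hQpos]; congr 1; ring
  calc _ ≤ D * Q ^ (2 * ε) := hder z hz
    _ = D / (c / 2) * Q ^ (3 * ε) * (c / 2 * Q ^ (-ε)) := by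
        rw [← h6]; field_simp
    _ ≤ _ := by gcongr

/-- The coefficients `χ(n) Λ(n) (log n)^k`. -/
noncomputable def lambdaLog {q : ℕ} (χ : DirichletCharacter ℂ q) (k n : ℕ) : ℂ :=
  χ n * (ArithmeticFunction.vonMangoldt n : ℂ) * (Real.log n : ℂ) ^ k

theorem logMul_iterate_eq {q : ℕ} (χ : DirichletCharacter ℂ q) (k : ℕ) :
    LSeries.logMul^[k] ((fun n : ℕ => χ n) * fun n : ℕ => (ArithmeticFunction.vonMangoldt n : ℂ)) =
      lambdaLog χ k := by
  induction k with
  | zero => funext n; simp [lambdaLog]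
  | succ k ih =>
    rw [Function.iterate_succ_apply', ih]
    funext n
    simp only [LSeries.logMul, lambdaLog, ← Complex.natCast_log]
    ring

theorem abscissa_twist_vonMangoldt_le {q : ℕ} (χ : DirichletCharacter ℂ q) :
    LSeries.abscissaOfAbsConv
      ((fun n : ℕ => χ n) * fun n : ℕ => (ArithmeticFunction.vonMangoldt n : ℂ)) ≤ 1 :=
  LSeries.abscissaOfAbsConv_le_of_forall_lt_LSeriesSummable fun y hy =>
    χ.LSeriesSummable_twist_vonMangoldt (by simpa using hy)

theorem LSeriesSummable_lambdaLog {q : ℕ} (χ : DirichletCharacter ℂ q) (k : ℕ) {s : ℂ}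
    (hs : 1 < s.re) : LSeriesSummable (lambdaLog χ k) s := by
  refine LSeriesSummable_of_abscissaOfAbsConv_lt_re ?_
  rw [← logMul_iterate_eq, LSeries.absicssaOfAbsConv_logPowMul]
  exact (abscissa_twist_vonMangoldt_le χ).trans_lt (by exact_mod_cast hs)

theorem exists_norm_LSeries_lambdaLog_le (k : ℕ) : ∃ C : ℝ, 0 < C ∧
    ∀ (q : ℕ) [NeZero q] (χ : DirichletCharacter ℂ q), χ ≠ 1 →
    ∀ s : ℂ, 1 < s.re → s.re ≤ 2 →
    ‖LSeries (lambdaLog χ k) s‖ ≤ C * (q * (|s.im| + 2)) ^ (1 / 2 : ℝ) := by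
  set ε : ℝ := 1 / (6 * (k + 1)) with hε
  have hε0 : 0 < ε := by positivity
  have hε3 : ε ≤ 1 / 3 := by
    rw [hε]
    apply one_div_le_one_div_of_le (by norm_num)
    have : (0 : ℝ) ≤ k := Nat.cast_nonneg k
    linarith
  obtain ⟨C, r, hC, hr, h⟩ := exists_norm_logDeriv_le hε0 hε3
  refine ⟨k.factorial * C / r ^ k, by positivity, fun q _ χ hχ s hs hs2 => ?_⟩
  set Q : ℝ := q * (|s.im| + 2) with hQ
  have hq : (1 : ℝ) ≤ q := by exact_mod_cast NeZero.one_le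
  have hy0 : 0 ≤ |s.im| := abs_nonneg _
  have hQpos : 0 < Q := by positivity
  set R : ℝ := r * Q ^ (-(3 * ε)) with hR
  have hR0 : 0 < R := by positivity
  set F : ℂ → ℂ := fun z => -deriv χ.LFunction z / χ.LFunction z with hF
  set a : ℕ → ℂ := ((fun n : ℕ => χ n) * fun n : ℕ => (ArithmeticFunction.vonMangoldt n : ℂ)) with ha
  have hopen : IsOpen {s : ℂ | 1 < s.re} := isOpen_lt continuous_const Complex.continuous_re
  have heqL : Set.EqOn (LSeries fun n : ℕ => χ n) χ.LFunction {s : ℂ | 1 < s.re} :=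
    fun w hw => (χ.LFunction_eq_LSeries hw).symm
  have heq : Set.EqOn (LSeries a) F {s : ℂ | 1 < s.re} := by
    intro w hw
    simp only [ha, hF]
    rw [χ.LSeries_twist_vonMangoldt_eq hw, heqL hw, (heqL.deriv hopen) hw]
  have habs : LSeries.abscissaOfAbsConv a < s.re :=
    (abscissa_twist_vonMangoldt_le χ).trans_lt (by exact_mod_cast hs)
  have h1 := LSeries_iteratedDeriv k habs
  rw [heq.iteratedDeriv_of_isOpen hopen k hs, logMul_iterate_eq] at h1
  have h2 : ‖LSeries (lambdaLog χ k) s‖ = ‖iteratedDeriv k F s‖ := by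
    rw [h1, norm_mul, norm_pow, norm_neg, norm_one, one_pow, one_mul]
  have hdiff : DiffContOnCl ℂ F (Metric.ball s R) := by
    refine DifferentiableOn.diffContOnCl fun z hz => ?_
    have hz' : z ∈ Metric.closedBall s R := Metric.closure_ball_subset_closedBall hz
    have hd := DirichletCharacter.differentiable_LFunction hχ
    exact ((((hd.contDiff (n := 2)).differentiable_deriv_two z).neg).div (hd z)
      (h q χ hχ s hs hs2 z hz').1).differentiableWithinAt
  have h3 := Complex.norm_iteratedDeriv_le_of_forall_mem_sphere_norm_le k hR0 hdiff
    (fun z hz => (h q χ hχ s hs hs2 z (Metric.sphere_subset_closedBall hz)).2)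
  rw [h2]
  refine h3.trans (le_of_eq ?_)
  have e1 : (Q ^ (-(3 * ε))) ^ k = (Q ^ (3 * ε * k))⁻¹ := by
    rw [← Real.rpow_natCast, ← Real.rpow_mul hQpos.le, ← Real.rpow_neg hQpos.le]
    congr 1; ring
  have e2 : Q ^ (3 * ε) * Q ^ (3 * ε * k) = Q ^ (1 / 2 : ℝ) := by
    rw [← Real.rpow_add hQpos]
    congr 1
    rw [hε]
    field_simp
    ring
  rw [← e2, hR, mul_pow, e1]
  field_simp
  rw [hQ]

/-! ### A smoothed Perron formula -/

/-- The tent function `t ↦ max (1 - t) 0` on `(0, ∞)`, written so that its Mellin transform is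
immediate. -/
noncomputable def tent (t : ℝ) : ℂ :=
  (Set.Ioc (0 : ℝ) 1).indicator (fun _ => (1 : ℂ)) t -
    (Set.Ioc (0 : ℝ) 1).indicator (fun t : ℝ => (t : ℂ) ^ (1 : ℂ)) t

theorem tent_of_pos {t : ℝ} (ht : 0 < t) : tent t = ((max (1 - t) 0 : ℝ) : ℂ) := by
  unfold tent
  by_cases h : t ≤ 1
  · have hm : t ∈ Set.Ioc (0 : ℝ) 1 := ⟨ht, h⟩
    rw [Set.indicator_of_mem hm, Set.indicator_of_mem hm, max_eq_left (by linarith)]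
    simp
  · have hm : t ∉ Set.Ioc (0 : ℝ) 1 := fun h' => h h'.2
    rw [Set.indicator_of_notMem hm, Set.indicator_of_notMem hm, max_eq_right (by linarith)]
    simp

theorem continuousAt_tent {t : ℝ} (ht : 0 < t) : ContinuousAt tent t := by
  have h : ContinuousAt (fun t : ℝ => ((max (1 - t) 0 : ℝ) : ℂ)) t := by fun_prop
  exact h.congr (Filter.eventuallyEq_of_mem (Ioi_mem_nhds ht) fun u hu => (tent_of_pos hu).symm)

theorem hasMellin_tent {s : ℂ} (hs : 0 < s.re) : HasMellin tent s (1 / s - 1 / (s + 1)) := by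
  have h1 := hasMellin_one_Ioc hs
  have h2 := hasMellin_cpow_Ioc 1 (s := s) (by simp; linarith)
  have := hasMellin_sub h1.1 h2.1
  rw [h1.2, h2.2] at this
  exact this

theorem norm_mellin_tent_le {σ : ℝ} (hσ : 1 ≤ σ) (y : ℝ) :
    ‖mellin tent (σ + y * Complex.I)‖ ≤ (1 + ‖y‖ ^ 2)⁻¹ := by
  have hre : ((σ : ℂ) + y * Complex.I).re = σ := by simp
  have him : ((σ : ℂ) + y * Complex.I).im = y := by simp
  set s : ℂ := (σ : ℂ) + y * Complex.I with hs
  have h0 : s ≠ 0 := fun h => by rw [h] at hre; simp at hre; linarith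
  have h1 : s + 1 ≠ 0 := fun h => by
    have := congrArg Complex.re h
    simp only [Complex.add_re, hre, Complex.one_re, Complex.zero_re] at this
    linarith
  rw [(hasMellin_tent (by rw [hre]; linarith)).2]
  have e : 1 / s - 1 / (s + 1) = (s * (s + 1))⁻¹ := by field_simp; ring
  rw [e, norm_inv, norm_mul]
  have a1 : √(1 + ‖y‖ ^ 2) ≤ ‖s‖ := by
    rw [Complex.norm_eq_sqrt_sq_add_sq, hre, him, Real.norm_eq_abs, sq_abs]
    apply Real.sqrt_le_sqrt
    nlinarith
  have a2 : √(1 + ‖y‖ ^ 2) ≤ ‖s + 1‖ := by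
    rw [Complex.norm_eq_sqrt_sq_add_sq, Complex.add_re, Complex.add_im, hre, him,
      Complex.one_re, Complex.one_im, Real.norm_eq_abs, sq_abs]
    apply Real.sqrt_le_sqrt
    nlinarith
  apply inv_anti₀ (by positivity)
  calc 1 + ‖y‖ ^ 2 = √(1 + ‖y‖ ^ 2) * √(1 + ‖y‖ ^ 2) := (Real.mul_self_sqrt (by positivity)).symm
    _ ≤ _ := by gcongr

theorem verticalIntegrable_mellin_tent {σ : ℝ} (hσ : 1 ≤ σ) :
    Complex.VerticalIntegrable (mellin tent) σ := by
  have hc : Continuous fun y : ℝ => mellin tent (σ + y * Complex.I) := by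
    have : (fun y : ℝ => mellin tent (σ + y * Complex.I)) = fun y : ℝ =>
        1 / ((σ : ℂ) + y * Complex.I) - 1 / ((σ : ℂ) + y * Complex.I + 1) := by
      funext y
      exact (hasMellin_tent (by simp; linarith)).2
    rw [this]
    refine (Continuous.div (by fun_prop) (by fun_prop) fun y h => ?_).sub
      (Continuous.div (by fun_prop) (by fun_prop) fun y h => ?_)
    · have := congrArg Complex.re h
      simp at this; linarith
    · have := congrArg Complex.re h
      simp at this; linarith
  refine MeasureTheory.Integrable.mono' ?_ hc.aestronglyMeasurable
    (Filter.Eventually.of_forall (norm_mellin_tent_le hσ))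
  have := integrable_rpow_neg_one_add_norm_sq (E := ℝ) (μ := MeasureTheory.volume) (r := 2)
    (by simp)
  refine this.congr (Filter.Eventually.of_forall fun y => ?_)
  simp only
  rw [show (-2 : ℝ) / 2 = -1 by norm_num, Real.rpow_neg_one]

theorem exists_norm_sum_tent_le : ∃ K : ℝ, 0 < K ∧ ∀ (a : ℕ → ℂ) (σ X B : ℝ), 1 ≤ σ →
    0 < X → LSeriesSummable a σ →
    (∀ y : ℝ, ‖LSeries a (σ + y * Complex.I)‖ ≤ B * (|y| + 2) ^ (1 / 2 : ℝ)) →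
    ‖∑ n ∈ Icc 1 ⌊X⌋₊, a n * (1 - n / X : ℝ)‖ ≤ K * B * X ^ σ := by
  set g : ℝ → ℝ := fun y => 2 * (1 + ‖y‖ ^ 2) ^ (-(3 / 2 : ℝ) / 2) with hg
  have hgi : MeasureTheory.Integrable g := by
    have := integrable_rpow_neg_one_add_norm_sq (E := ℝ) (μ := MeasureTheory.volume)
      (r := 3 / 2) (by norm_num)
    exact this.const_mul 2
  have hgpos : ∀ y, 0 ≤ g y := fun y => by positivity
  have hbnd : ∀ y : ℝ, (|y| + 2) ^ (1 / 2 : ℝ) * (1 + ‖y‖ ^ 2)⁻¹ ≤ g y := by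
    intro y
    have hpos : (0 : ℝ) < 1 + ‖y‖ ^ 2 := by positivity
    have h1 : (|y| + 2) ^ (1 / 2 : ℝ) ≤ 2 * (1 + ‖y‖ ^ 2) ^ (1 / 4 : ℝ) := by
      have h2 : |y| + 2 ≤ 4 * (1 + ‖y‖ ^ 2) ^ (1 / 2 : ℝ) := by
        rw [← Real.sqrt_eq_rpow]
        have e1 : (1 : ℝ) ≤ √(1 + ‖y‖ ^ 2) := Real.one_le_sqrt.mpr (by nlinarith [norm_nonneg y])
        have e2 : |y| ≤ √(1 + ‖y‖ ^ 2) := by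
          apply Real.le_sqrt_of_sq_le
          rw [Real.norm_eq_abs]; linarith
        linarith
      calc (|y| + 2) ^ (1 / 2 : ℝ) ≤ (4 * (1 + ‖y‖ ^ 2) ^ (1 / 2 : ℝ)) ^ (1 / 2 : ℝ) := by
            apply Real.rpow_le_rpow (by positivity) h2 (by norm_num)
        _ = 2 * (1 + ‖y‖ ^ 2) ^ (1 / 4 : ℝ) := by
            rw [Real.mul_rpow (by norm_num) (by positivity), ← Real.rpow_mul hpos.le]
            norm_num
    calc (|y| + 2) ^ (1 / 2 : ℝ) * (1 + ‖y‖ ^ 2)⁻¹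
        ≤ 2 * (1 + ‖y‖ ^ 2) ^ (1 / 4 : ℝ) * (1 + ‖y‖ ^ 2)⁻¹ := by gcongr
      _ = g y := by
          simp only [hg]
          rw [mul_assoc, ← Real.rpow_neg_one, ← Real.rpow_add hpos]
          norm_num
  refine ⟨(∫ y, g y) + 1, by
    have : 0 ≤ ∫ y, g y := MeasureTheory.integral_nonneg hgpos
    linarith, fun a σ X B hσ hX hsum hB => ?_⟩
  have hσ0 : 0 < σ := by linarith
  set s : ℝ → ℂ := fun y => (σ : ℂ) + y * Complex.I with hs
  have hsre : ∀ y, (s y).re = σ := fun y => by simp [hs]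
  set F : ℝ → ℂ := fun y => (X : ℂ) ^ (s y) * mellin tent (s y) with hF
  have hXnorm : ∀ y, ‖(X : ℂ) ^ (s y)‖ = X ^ σ := fun y => by
    rw [Complex.norm_cpow_eq_rpow_re_of_pos hX, hsre]
  have hvi : MeasureTheory.Integrable fun y => mellin tent (s y) :=
    verticalIntegrable_mellin_tent hσ
  have hFi : MeasureTheory.Integrable F := by
    refine hvi.bdd_mul (c := X ^ σ) ?_ (Filter.Eventually.of_forall fun y => (hXnorm y).le)
    apply Continuous.aestronglyMeasurable
    have : (X : ℂ) ≠ 0 := by exact_mod_cast hX.ne'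
    simp only [hs]
    exact Continuous.const_cpow (by fun_prop) (Or.inl this)
  have hterm : ∀ n y, ‖LSeries.term a (s y) n‖ = ‖LSeries.term a (σ : ℂ) n‖ := fun n y => by
    rw [LSeries.norm_term_eq, LSeries.norm_term_eq, hsre, Complex.ofReal_re]
  have hGi : ∀ n, MeasureTheory.Integrable fun y => LSeries.term a (s y) n * F y := by
    intro n
    refine hFi.bdd_mul (c := ‖LSeries.term a (σ : ℂ) n‖) ?_
      (Filter.Eventually.of_forall fun y => (hterm n y).le)
    apply Continuous.aestronglyMeasurable
    rcases eq_or_ne n 0 with rfl | hn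
    · simp only [LSeries.term_zero]; exact continuous_const
    · have : (n : ℂ) ≠ 0 := by exact_mod_cast hn
      simp only [LSeries.term_of_ne_zero hn, hs]
      refine Continuous.div continuous_const
        (Continuous.const_cpow (by fun_prop) (Or.inl this)) fun y => ?_
      simp [Complex.cpow_eq_zero_iff, this]
  have hGs : Summable fun n => ∫ y, ‖LSeries.term a (s y) n * F y‖ := by
    have : (fun n => ∫ y, ‖LSeries.term a (s y) n * F y‖) =
        fun n => ‖LSeries.term a (σ : ℂ) n‖ * ∫ y, ‖F y‖ := by
      funext n
      rw [← MeasureTheory.integral_const_mul]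
      congr 1; funext y
      rw [norm_mul, hterm]
    rw [this]
    exact hsum.norm.mul_right _
  have hkey := MeasureTheory.hasSum_integral_of_summable_integral_norm hGi hGs
  have hval : ∀ n, ∫ y, LSeries.term a (s y) n * F y =
      (2 * π : ℝ) * (if n ∈ Icc 1 ⌊X⌋₊ then a n * (1 - n / X : ℝ) else 0) := by
    intro n
    rcases eq_or_ne n 0 with rfl | hn
    · simp
    have hn0 : (0 : ℝ) < n := by exact_mod_cast Nat.pos_of_ne_zero hn
    have hnX : 0 < n / X := by positivity
    have hinv := mellinInv_mellin_eq σ tent hnX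
      (hasMellin_tent (s := σ) (by simpa using hσ0)).1
      (verticalIntegrable_mellin_tent hσ) (continuousAt_tent hnX)
    have e1 : ∀ y : ℝ, LSeries.term a (s y) n * F y =
        a n * ((((n / X : ℝ) : ℂ) ^ (-(s y))) • mellin tent (s y)) := by
      intro y
      rw [LSeries.term_of_ne_zero hn, Complex.cpow_neg, Complex.ofReal_div,
        Complex.div_cpow_ofReal_nonneg hn0.le hX.le, smul_eq_mul, Complex.ofReal_natCast, hF]
      have : (n : ℂ) ^ (s y) ≠ 0 := by simp [Complex.cpow_eq_zero_iff, hn]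
      field_simp
    simp_rw [e1]
    rw [MeasureTheory.integral_const_mul]
    have e2 : ∫ y : ℝ, ((((n / X : ℝ) : ℂ) ^ (-(s y))) • mellin tent (s y)) =
        (2 * π : ℝ) * tent (n / X) := by
      rw [← hinv, mellinInv, Complex.real_smul]
      push_cast
      have : (π : ℂ) ≠ 0 := by exact_mod_cast Real.pi_ne_zero
      simp only [hs]
      rw [← mul_assoc, mul_one_div_cancel (by simp [this]), one_mul]
    rw [e2, tent_of_pos hnX]
    have hn1 : 1 ≤ n := Nat.pos_of_ne_zero hn
    by_cases hle : n ∈ Icc 1 ⌊X⌋₊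
    · have : (n : ℝ) ≤ X := (Nat.le_floor_iff hX.le).mp (Finset.mem_Icc.mp hle).2
      rw [if_pos hle, max_eq_left (by rw [sub_nonneg, div_le_one hX]; exact this)]
      ring
    · have : ¬ (n : ℝ) ≤ X := fun h =>
        hle (Finset.mem_Icc.mpr ⟨hn1, (Nat.le_floor_iff hX.le).mpr h⟩)
      rw [if_neg hle, max_eq_right (by rw [sub_nonpos, one_le_div hX]; linarith)]
      simp
  simp_rw [hval] at hkey
  have hfin : HasSum (fun n => ((2 * π : ℝ) : ℂ) *
      (if n ∈ Icc 1 ⌊X⌋₊ then a n * (1 - n / X : ℝ) else 0))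
      (((2 * π : ℝ) : ℂ) * ∑ n ∈ Icc 1 ⌊X⌋₊, a n * (1 - n / X : ℝ)) := by
    apply HasSum.mul_left
    have := hasSum_sum_of_ne_finset_zero (L := SummationFilter.unconditional ℕ) (s := Icc 1 ⌊X⌋₊)
      (f := fun n => if n ∈ Icc 1 ⌊X⌋₊ then a n * ((1 - n / X : ℝ) : ℂ) else 0)
      fun n hn => if_neg hn
    rwa [Finset.sum_congr rfl fun n hn => if_pos hn] at this
  have heq := hfin.unique hkey
  have hnorm : ‖∫ y, ∑' n, LSeries.term a (s y) n * F y‖ ≤ ∫ y, B * X ^ σ * g y := by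
    refine MeasureTheory.norm_integral_le_of_norm_le (hgi.const_mul _)
      (Filter.Eventually.of_forall fun y => ?_)
    rw [tsum_mul_right, norm_mul, hF]
    simp only [norm_mul, hXnorm]
    have h1 := hB y
    have h2 := norm_mellin_tent_le hσ y
    have h3 := hbnd y
    have hB0 : 0 ≤ B := by
      have : 0 < (|y| + 2) ^ (1 / 2 : ℝ) := by positivity
      exact nonneg_of_mul_nonneg_left ((norm_nonneg _).trans h1) this
    calc ‖∑' n, LSeries.term a (s y) n‖ * (X ^ σ * ‖mellin tent (s y)‖)
        ≤ (B * (|y| + 2) ^ (1 / 2 : ℝ)) * (X ^ σ * (1 + ‖y‖ ^ 2)⁻¹) := by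
          gcongr
          exact h1
      _ = B * X ^ σ * ((|y| + 2) ^ (1 / 2 : ℝ) * (1 + ‖y‖ ^ 2)⁻¹) := by ring
      _ ≤ B * X ^ σ * g y := by gcongr
  rw [← heq, norm_mul, Complex.norm_real, Real.norm_of_nonneg (by positivity),
    MeasureTheory.integral_const_mul] at hnorm
  have hB0 : 0 ≤ B := by
    have h1 := hB 0
    have : 0 < (|(0 : ℝ)| + 2) ^ (1 / 2 : ℝ) := by positivity
    exact nonneg_of_mul_nonneg_left ((norm_nonneg _).trans h1) this
  have hI : 0 ≤ ∫ y, g y := MeasureTheory.integral_nonneg hgpos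
  have h2π : 1 ≤ 2 * π := by linarith [Real.pi_gt_three]
  have hS := norm_nonneg (∑ n ∈ Icc 1 ⌊X⌋₊, a n * (1 - n / X : ℝ))
  have hXs : 0 < X ^ σ := by positivity
  have : 0 ≤ B * X ^ σ := by positivity
  nlinarith

/-! ### Character sums over primes -/

theorem exists_norm_sum_lambdaLog_mul_sub_le (k : ℕ) : ∃ C : ℝ, 0 < C ∧
    ∀ (q : ℕ) [NeZero q] (χ : DirichletCharacter ℂ q), χ ≠ 1 → ∀ X : ℝ, exp 1 ≤ X →
    ‖∑ n ∈ Icc 1 ⌊X⌋₊, lambdaLog χ k n * (X - n : ℝ)‖ ≤ C * X ^ 2 * √q := by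
  obtain ⟨K, hK, hP⟩ := exists_norm_sum_tent_le
  obtain ⟨C, hC, hL⟩ := exists_norm_LSeries_lambdaLog_le k
  refine ⟨K * C * exp 1, by positivity, fun q _ χ hχ X hX => ?_⟩
  have hX0 : 0 < X := (exp_pos 1).trans_le hX
  have hℓ : 1 ≤ log X := by rwa [Real.le_log_iff_exp_le hX0]
  set σ : ℝ := 1 + 1 / log X with hσ
  have h1 : 1 < σ := by
    have : 0 < 1 / log X := by positivity
    linarith
  have h2 : σ ≤ 2 := by
    have : 1 / log X ≤ 1 := (div_le_one (by linarith)).mpr hℓ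
    linarith
  have hXσ : X ^ σ = exp 1 * X := by
    rw [Real.rpow_def_of_pos hX0, hσ, mul_add, mul_one_div_cancel (by linarith), mul_one,
      Real.exp_add, Real.exp_log hX0, mul_comm]
  have h := hP (lambdaLog χ k) σ X (C * √q) h1.le hX0
    (LSeriesSummable_lambdaLog χ k (by simpa using h1)) (fun y => by
      have := hL q χ hχ (σ + y * Complex.I) (by simpa using h1) (by simpa using h2)
      refine this.trans (le_of_eq ?_)
      simp only [Complex.add_im, Complex.ofReal_im, Complex.mul_im, Complex.ofReal_re,
        Complex.I_im, Complex.I_re, mul_one, mul_zero, add_zero, zero_add]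
      rw [Real.mul_rpow (by positivity) (by positivity), ← Real.sqrt_eq_rpow]
      ring)
  have e : ∑ n ∈ Icc 1 ⌊X⌋₊, lambdaLog χ k n * (X - n : ℝ) =
      (X : ℂ) * ∑ n ∈ Icc 1 ⌊X⌋₊, lambdaLog χ k n * (1 - n / X : ℝ) := by
    rw [Finset.mul_sum]
    refine Finset.sum_congr rfl fun n _ => ?_
    have : (X : ℂ) ≠ 0 := by exact_mod_cast hX0.ne'
    push_cast
    field_simp
  rw [e, norm_mul, Complex.norm_real, Real.norm_of_nonneg hX0.le]
  calc X * _ ≤ X * (K * (C * √q) * X ^ σ) := by gcongr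
    _ = _ := by rw [hXσ]; ring

/-- Removing a smooth weight by differencing. -/
theorem norm_sum_mul_le_of_smoothed {a : ℕ → ℂ} {X h m : ℝ} (hX : 0 ≤ X) (hh : 0 < h)
    (hm : ∀ n : ℕ, (n : ℝ) ≤ X + h → ‖a n‖ ≤ m) :
    h * ‖∑ n ∈ Icc 1 ⌊X⌋₊, a n‖ ≤ ‖∑ n ∈ Icc 1 ⌊X + h⌋₊, a n * (X + h - n : ℝ)‖ +
      ‖∑ n ∈ Icc 1 ⌊X⌋₊, a n * (X - n : ℝ)‖ + h * (h + 1) * m := by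
  have hle : ⌊X⌋₊ ≤ ⌊X + h⌋₊ := Nat.floor_mono (by linarith)
  have hm0 : 0 ≤ m := (norm_nonneg _).trans (hm 0 (by simp; linarith))
  have hsplit : ∑ n ∈ Icc 1 ⌊X + h⌋₊, a n * (X + h - n : ℝ) =
      ∑ n ∈ Icc 1 ⌊X⌋₊, a n * (X + h - n : ℝ) +
        ∑ n ∈ Ioc ⌊X⌋₊ ⌊X + h⌋₊, a n * (X + h - n : ℝ) := by
    rw [← Finset.sum_union]
    · congr 1
      ext n; simp only [mem_Icc, mem_union, mem_Ioc]; omega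
    · rw [Finset.disjoint_left]
      intro n; simp only [mem_Icc, mem_Ioc]; omega
  have heq : (h : ℂ) * ∑ n ∈ Icc 1 ⌊X⌋₊, a n = ∑ n ∈ Icc 1 ⌊X + h⌋₊, a n * (X + h - n : ℝ) -
      ∑ n ∈ Icc 1 ⌊X⌋₊, a n * (X - n : ℝ) -
        ∑ n ∈ Ioc ⌊X⌋₊ ⌊X + h⌋₊, a n * (X + h - n : ℝ) := by
    rw [hsplit, Finset.mul_sum, add_sub_right_comm, add_sub_cancel_right, ← Finset.sum_sub_distrib]
    refine Finset.sum_congr rfl fun n _ => ?_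
    push_cast; ring
  have htail : ‖∑ n ∈ Ioc ⌊X⌋₊ ⌊X + h⌋₊, a n * (X + h - n : ℝ)‖ ≤ h * (h + 1) * m := by
    calc _ ≤ ∑ n ∈ Ioc ⌊X⌋₊ ⌊X + h⌋₊, ‖a n * (X + h - n : ℝ)‖ := norm_sum_le _ _
      _ ≤ ∑ n ∈ Ioc ⌊X⌋₊ ⌊X + h⌋₊, m * h := by
          refine Finset.sum_le_sum fun n hn => ?_
          rw [mem_Ioc] at hn
          have h1 : (n : ℝ) ≤ X + h := (Nat.le_floor_iff (by linarith)).mp hn.2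
          have h2 : X < n := (Nat.floor_lt hX).mp hn.1
          rw [norm_mul, Complex.norm_real, Real.norm_of_nonneg (by linarith)]
          exact mul_le_mul (hm n h1) (by linarith) (by linarith) hm0
      _ = (⌊X + h⌋₊ - ⌊X⌋₊ : ℕ) * (m * h) := by simp
      _ ≤ (h + 1) * (m * h) := by
          gcongr
          rw [Nat.cast_sub hle]
          have h1 := Nat.floor_le (show 0 ≤ X + h by linarith)
          have h2 := Nat.lt_floor_add_one X
          linarith
      _ = _ := by ring
  calc h * ‖∑ n ∈ Icc 1 ⌊X⌋₊, a n‖ = ‖(h : ℂ) * ∑ n ∈ Icc 1 ⌊X⌋₊, a n‖ := by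
        rw [norm_mul, Complex.norm_real, Real.norm_of_nonneg hh.le]
    _ ≤ _ := by
        rw [heq]
        refine (norm_sub_le _ _).trans (add_le_add (norm_sub_le _ _) htail)

theorem pow_log_le_factorial_mul {X : ℝ} (hX : 1 ≤ X) (n : ℕ) : log X ^ n ≤ n.factorial * X := by
  have := Real.pow_div_factorial_le_exp (log X) (Real.log_nonneg hX) n
  rw [Real.exp_log (by linarith), div_le_iff₀ (by positivity)] at this
  linarith

theorem norm_lambdaLog_le {q : ℕ} (χ : DirichletCharacter ℂ q) (k n : ℕ) :
    ‖lambdaLog χ k n‖ ≤ ArithmeticFunction.vonMangoldt n * log n ^ k := by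
  have hl : 0 ≤ log n := Real.log_natCast_nonneg n
  unfold lambdaLog
  rw [norm_mul, norm_mul, norm_pow, Complex.norm_real, Complex.norm_real,
    Real.norm_of_nonneg hl, Real.norm_of_nonneg ArithmeticFunction.vonMangoldt_nonneg]
  have := χ.norm_le_one n
  have h0 : 0 ≤ ArithmeticFunction.vonMangoldt n := ArithmeticFunction.vonMangoldt_nonneg
  calc _ ≤ 1 * ArithmeticFunction.vonMangoldt n * log n ^ k := by gcongr
    _ = _ := by ring

theorem exists_norm_sum_lambdaLog_le (m : ℕ) : ∃ C : ℝ, 0 < C ∧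
    ∀ (q : ℕ) [NeZero q] (χ : DirichletCharacter ℂ q), χ ≠ 1 → ∀ X : ℝ, exp 1 ≤ X →
    ‖∑ n ∈ Icc 1 ⌊X⌋₊, lambdaLog χ (2 * m + 1) n‖ ≤ C * X * log X ^ (m + 1) * √q := by
  obtain ⟨C, hC, h⟩ := exists_norm_sum_lambdaLog_mul_sub_le (2 * m + 1)
  refine ⟨5 * C + 4 ^ (m + 1) * (1 + (m + 1).factorial), by positivity,
    fun q _ χ hχ X hX => ?_⟩
  have hX0 : 0 < X := (exp_pos 1).trans_le hX
  have hX1 : 1 ≤ X := by linarith [Real.add_one_le_exp 1]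
  have hℓ : 1 ≤ log X := by rwa [Real.le_log_iff_exp_le hX0]
  have hq : 1 ≤ √(q : ℝ) := Real.one_le_sqrt.mpr (by exact_mod_cast NeZero.one_le)
  set ℓ := log X with hℓdef
  set P := ℓ ^ (m + 1) with hP
  have hP1 : 1 ≤ P := one_le_pow₀ hℓ
  set H := X / P with hH
  have hH0 : 0 < H := by positivity
  have hHX : H ≤ X := div_le_self hX0.le hP1
  have hm : ∀ n : ℕ, (n : ℝ) ≤ X + H → ‖lambdaLog χ (2 * m + 1) n‖ ≤ 4 ^ (m + 1) * P ^ 2 := by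
    intro n hn
    refine (norm_lambdaLog_le χ _ n).trans ?_
    have hl0 : 0 ≤ log n := Real.log_natCast_nonneg n
    have hl : log n ≤ 2 * ℓ := by
      rcases Nat.eq_zero_or_pos n with rfl | hn0
      · simp; linarith
      have : log n ≤ log (2 * X) := Real.log_le_log (by exact_mod_cast hn0) (by linarith)
      rw [Real.log_mul (by norm_num) hX0.ne'] at this
      linarith [Real.log_two_lt_d9]
    calc _ ≤ log n * log n ^ (2 * m + 1) := by
          gcongr; exact ArithmeticFunction.vonMangoldt_le_log
      _ = log n ^ (2 * (m + 1)) := by ring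
      _ ≤ (2 * ℓ) ^ (2 * (m + 1)) := by gcongr
      _ = _ := by rw [hP, mul_pow, pow_mul, pow_mul]; norm_num; ring
  have hmain := norm_sum_mul_le_of_smoothed (a := lambdaLog χ (2 * m + 1)) hX0.le hH0 hm
  have t1 := h q χ hχ (X + H) (by linarith)
  have t2 := h q χ hχ X hX
  have t1' : C * (X + H) ^ 2 * √q ≤ C * (2 * X) ^ 2 * √q := by gcongr; linarith
  have hPX : P ≤ (m + 1).factorial * X := pow_log_le_factorial_mul hX1 _
  set S := ‖∑ n ∈ Icc 1 ⌊X⌋₊, lambdaLog χ (2 * m + 1) n‖ with hS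
  have hall : H * S ≤ 5 * C * X ^ 2 * √q + H * (H + 1) * (4 ^ (m + 1) * P ^ 2) := by
    linarith
  have hXH : X = H * P := by rw [hH]; field_simp
  have h5 : S ≤ 5 * C * X * P * √q + (H + 1) * (4 ^ (m + 1) * P ^ 2) := by
    refine le_of_mul_le_mul_left (hall.trans (le_of_eq ?_)) hH0
    have : X ^ 2 = X * (H * P) := by rw [← hXH]; ring
    rw [this]; ring
  have h6 : (H + 1) * (4 ^ (m + 1) * P ^ 2) ≤
      4 ^ (m + 1) * (1 + (m + 1).factorial) * X * P * √q := by
    calc (H + 1) * (4 ^ (m + 1) * P ^ 2) = 4 ^ (m + 1) * (H * P + P) * P := by ring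
      _ ≤ 4 ^ (m + 1) * (X + (m + 1).factorial * X) * P := by rw [← hXH]; gcongr
      _ = 4 ^ (m + 1) * (1 + (m + 1).factorial) * X * P * 1 := by ring
      _ ≤ _ := by gcongr
  calc S ≤ _ := h5
    _ ≤ 5 * C * X * P * √q + 4 ^ (m + 1) * (1 + (m + 1).factorial) * X * P * √q := by linarith
    _ = _ := by ring

theorem exists_norm_sum_prime_log_le (m : ℕ) : ∃ C : ℝ, 0 < C ∧
    ∀ (q : ℕ) [NeZero q] (χ : DirichletCharacter ℂ q), χ ≠ 1 → ∀ X : ℝ, exp 1 ≤ X →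
    ‖∑ p ∈ Icc 1 ⌊X⌋₊ with p.Prime, χ p * (log p : ℂ) ^ (2 * (m + 1))‖ ≤
      C * X * log X ^ (m + 1) * √q := by
  obtain ⟨C, hC, h⟩ := exists_norm_sum_lambdaLog_le m
  refine ⟨C + 2 * 2 ^ (m + 1) * (m + 1).factorial, by positivity, fun q _ χ hχ X hX => ?_⟩
  have hX0 : 0 < X := (exp_pos 1).trans_le hX
  have hX1 : 1 ≤ X := by linarith [Real.add_one_le_exp 1]
  have hℓ : 1 ≤ log X := by rwa [Real.le_log_iff_exp_le hX0]
  have hq : 1 ≤ √(q : ℝ) := Real.one_le_sqrt.mpr (by exact_mod_cast NeZero.one_le)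
  have hsplit := Finset.sum_filter_add_sum_filter_not (Icc 1 ⌊X⌋₊) (fun n => n.Prime)
    (fun n => lambdaLog χ (2 * m + 1) n)
  have e1 : ∑ p ∈ Icc 1 ⌊X⌋₊ with p.Prime, lambdaLog χ (2 * m + 1) p =
      ∑ p ∈ Icc 1 ⌊X⌋₊ with p.Prime, χ p * (log p : ℂ) ^ (2 * (m + 1)) := by
    refine Finset.sum_congr rfl fun p hp => ?_
    rw [Finset.mem_filter] at hp
    rw [lambdaLog, ArithmeticFunction.vonMangoldt_apply_prime hp.2]
    ring
  have e2 : ‖∑ n ∈ Icc 1 ⌊X⌋₊ with ¬ n.Prime, lambdaLog χ (2 * m + 1) n‖ ≤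
      2 * 2 ^ (m + 1) * (m + 1).factorial * X * log X ^ (m + 1) * √q := by
    have hsq : log X ^ (m + 1) ≤ 2 ^ (m + 1) * (m + 1).factorial * √X := by
      have := pow_log_le_factorial_mul (Real.one_le_sqrt.mpr hX1) (m + 1)
      rw [Real.log_sqrt hX0.le, div_pow, div_le_iff₀ (by positivity)] at this
      linarith
    calc _ ≤ ∑ n ∈ Icc 1 ⌊X⌋₊ with ¬ n.Prime, ‖lambdaLog χ (2 * m + 1) n‖ := norm_sum_le _ _
      _ ≤ ∑ n ∈ Icc 1 ⌊X⌋₊ with ¬ n.Prime,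
          ArithmeticFunction.vonMangoldt n * log X ^ (2 * m + 1) := by
          refine Finset.sum_le_sum fun n hn => (norm_lambdaLog_le χ _ n).trans ?_
          rw [Finset.mem_filter, Finset.mem_Icc] at hn
          have h0 : 0 ≤ ArithmeticFunction.vonMangoldt n := ArithmeticFunction.vonMangoldt_nonneg
          have h1 : 0 ≤ log n := Real.log_natCast_nonneg n
          have h2 : (0 : ℝ) < n := by exact_mod_cast hn.1.1
          have h3 : (n : ℝ) ≤ X := (Nat.le_floor_iff hX0.le).mp hn.1.2
          gcongr
      _ = (Chebyshev.psi X - Chebyshev.theta X) * log X ^ (2 * m + 1) := by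
          rw [← Finset.sum_mul, Chebyshev.psi_sub_theta_eq_sum_not_prime]
          rfl
      _ ≤ 2 * √X * log X * log X ^ (2 * m + 1) := by
          gcongr
          exact Chebyshev.psi_sub_theta_le hX1
      _ = 2 * √X * log X ^ (m + 1) * log X ^ (m + 1) := by ring
      _ ≤ 2 * √X * (2 ^ (m + 1) * (m + 1).factorial * √X) * log X ^ (m + 1) := by gcongr
      _ = 2 * 2 ^ (m + 1) * (m + 1).factorial * (√X * √X) * log X ^ (m + 1) * 1 := by ring
      _ ≤ _ := by rw [Real.mul_self_sqrt hX0.le]; gcongr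
  rw [← e1, eq_sub_of_add_eq hsplit]
  refine (norm_sub_le _ _).trans ((add_le_add (h q χ hχ X hX) e2).trans (le_of_eq ?_))
  ring

/-- Partial summation against a nonnegative antitone weight. -/
theorem norm_sum_Ioc_mul_le {b : ℕ → ℂ} {g : ℕ → ℝ} {D : ℝ} {u v : ℕ} (huv : u ≤ v)
    (hg : Antitone g) (hg0 : ∀ n, 0 ≤ g n)
    (hD : ∀ t, u ≤ t → t ≤ v → ‖∑ n ∈ Icc 1 t, b n‖ ≤ D) :
    ‖∑ n ∈ Ioc u v, b n * g n‖ ≤ 2 * D * g u := by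
  have key : ∀ t, u ≤ t → t ≤ v →
      ‖∑ n ∈ Ioc u t, b n * g n - (∑ n ∈ Icc 1 t, b n) * g t‖ ≤ D * (2 * g u - g t) := by
    intro t hut
    induction t, hut using Nat.le_induction with
    | base =>
      intro huv
      simp only [Finset.Ioc_self, Finset.sum_empty, zero_sub, norm_neg, norm_mul,
        Complex.norm_real, Real.norm_of_nonneg (hg0 u)]
      nlinarith [hD u le_rfl huv, hg0 u]
    | succ t hut ih =>
      intro htv
      have h1 := ih (by omega)
      have h2 := hD t hut (by omega)
      have h3 := hg (Nat.le_succ t)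
      have e : ∑ n ∈ Ioc u (t + 1), b n * g n - (∑ n ∈ Icc 1 (t + 1), b n) * g (t + 1) =
          (∑ n ∈ Ioc u t, b n * g n - (∑ n ∈ Icc 1 t, b n) * g t) +
            (∑ n ∈ Icc 1 t, b n) * ((g t - g (t + 1) : ℝ) : ℂ) := by
        rw [Finset.sum_Ioc_succ_top (by omega), Finset.sum_Icc_succ_top (by omega)]
        push_cast; ring
      rw [e]
      refine (norm_add_le _ _).trans ?_
      rw [norm_mul, Complex.norm_real, Real.norm_of_nonneg (sub_nonneg.mpr h3)]
      have : ‖∑ n ∈ Icc 1 t, b n‖ * (g t - g (t + 1)) ≤ D * (g t - g (t + 1)) :=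
        mul_le_mul_of_nonneg_right h2 (sub_nonneg.mpr h3)
      linarith
  have h1 := key v huv le_rfl
  have h2 : ‖(∑ n ∈ Icc 1 v, b n) * (g v : ℂ)‖ ≤ D * g v := by
    rw [norm_mul, Complex.norm_real, Real.norm_of_nonneg (hg0 v)]
    exact mul_le_mul_of_nonneg_right (hD v huv le_rfl) (hg0 v)
  have := norm_add_le (∑ n ∈ Ioc u v, b n * g n - (∑ n ∈ Icc 1 v, b n) * g v)
    ((∑ n ∈ Icc 1 v, b n) * (g v : ℂ))
  rw [sub_add_cancel] at this
  linarith

theorem exists_norm_sum_prime_le (m : ℕ) : ∃ C : ℝ, 0 < C ∧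
    ∀ (q : ℕ) [NeZero q] (χ : DirichletCharacter ℂ q), χ ≠ 1 → ∀ Z u v : ℕ, 3 ≤ Z → Z ≤ u →
    ‖∑ p ∈ Ioc u v with p.Prime, χ p‖ ≤
      C * v * log v ^ (m + 1) * √q / log Z ^ (2 * (m + 1)) := by
  obtain ⟨C, hC, h⟩ := exists_norm_sum_prime_log_le m
  refine ⟨2 * C, by positivity, fun q _ χ hχ Z u v hZ hZu => ?_⟩
  have hlogv : 0 ≤ log v := Real.log_natCast_nonneg v
  have hZ3 : (3 : ℝ) ≤ Z := by exact_mod_cast hZ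
  have hlogZ : 0 < log Z := Real.log_pos (by linarith)
  rcases lt_or_ge v u with hvu | huv
  · rw [Finset.Ioc_eq_empty (by omega)]
    simp only [Finset.filter_empty, Finset.sum_empty, norm_zero]
    positivity
  set b : ℕ → ℂ := fun n => if n.Prime then χ n * (log n : ℂ) ^ (2 * (m + 1)) else 0 with hb
  set g : ℕ → ℝ := fun n => (log (max n Z : ℕ) ^ (2 * (m + 1)))⁻¹ with hg
  have hZlog : ∀ n : ℕ, log Z ≤ log (max n Z : ℕ) := fun n =>
    Real.log_le_log (by linarith) (by exact_mod_cast le_max_right n Z)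
  have hganti : Antitone g := by
    intro i j hij
    simp only [hg]
    have h1 := hZlog i
    apply inv_anti₀ (pow_pos (by linarith) _)
    apply pow_le_pow_left₀ (by linarith)
    apply Real.log_le_log
    · exact_mod_cast lt_of_lt_of_le (by omega) (le_max_right i Z)
    · exact_mod_cast max_le_max_right Z hij
  have hg0 : ∀ n, 0 ≤ g n := fun n => inv_nonneg.mpr (pow_nonneg (by linarith [hZlog n]) _)
  have hsum : ∑ p ∈ Ioc u v with p.Prime, χ p = ∑ n ∈ Ioc u v, b n * g n := by
    rw [Finset.sum_filter]
    refine Finset.sum_congr rfl fun n hn => ?_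
    rw [Finset.mem_Ioc] at hn
    simp only [hb, hg]
    split_ifs with hp
    · rw [max_eq_left (by omega)]
      have : (log n : ℂ) ≠ 0 := by
        have : 0 < log n := Real.log_pos (by exact_mod_cast hp.one_lt)
        exact_mod_cast this.ne'
      rw [Complex.ofReal_inv, Complex.ofReal_pow, mul_assoc,
        mul_inv_cancel₀ (pow_ne_zero _ this), mul_one]
    · simp
  rw [hsum]
  refine (norm_sum_Ioc_mul_le (D := C * v * log v ^ (m + 1) * √q) huv hganti hg0
    fun t hut htv => ?_).trans (le_of_eq_of_le ?_ (mul_le_mul_of_nonneg_left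
      (show g u ≤ (log Z ^ (2 * (m + 1)))⁻¹ from
        inv_anti₀ (pow_pos hlogZ _) (pow_le_pow_left₀ hlogZ.le (hZlog u) _))
      (show 0 ≤ 2 * (C * v * log v ^ (m + 1) * √q) by positivity)) |>.trans (le_of_eq ?_))
  · have hte : exp 1 ≤ (t : ℝ) := by
      have : (3 : ℝ) ≤ t := by exact_mod_cast (by omega : 3 ≤ t)
      linarith [Real.exp_one_lt_d9]
    have := h q χ hχ t hte
    rw [Nat.floor_natCast, Finset.sum_filter] at this
    refine this.trans ?_
    have ht0 : (0 : ℝ) < t := (exp_pos 1).trans_le hte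
    have ht1 : 0 ≤ log (t : ℝ) := Real.log_natCast_nonneg t
    have htv' : (t : ℝ) ≤ v := by exact_mod_cast htv
    gcongr
  · rfl
  · rw [div_eq_mul_inv]; ring

/-! ### Rough Möbius sums twisted by a character -/

/-- The largest prime factor of `n`, with value `0` at `n = 0` and `n = 1`. -/
def largestPrimeFactor (n : ℕ) : ℕ := n.primeFactors.sup id

theorem le_largestPrimeFactor {n p : ℕ} (hp : p ∈ n.primeFactors) : p ≤ largestPrimeFactor n :=
  Finset.le_sup (f := id) hp

theorem largestPrimeFactor_mem {n : ℕ} (hn : 1 < n) : largestPrimeFactor n ∈ n.primeFactors := by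
  obtain ⟨p, hp, h⟩ := Finset.exists_mem_eq_sup n.primeFactors
    (Nat.nonempty_primeFactors.mpr hn) id
  unfold largestPrimeFactor
  rw [h]; exact hp

theorem largestPrimeFactor_mul_prime {m p : ℕ} (hm : m ≠ 0) (hp : p.Prime)
    (h : largestPrimeFactor m < p) : largestPrimeFactor (m * p) = p := by
  unfold largestPrimeFactor at h ⊢
  rw [Nat.primeFactors_mul hm hp.ne_zero, Finset.sup_union, hp.primeFactors, Finset.sup_singleton]
  exact max_eq_right h.le

theorem coprime_of_largestPrimeFactor_lt {m p : ℕ} (hm : m ≠ 0) (hp : p.Prime)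
    (h : largestPrimeFactor m < p) : m.Coprime p := by
  rw [Nat.coprime_comm, hp.coprime_iff_not_dvd]
  intro hd
  exact absurd (le_largestPrimeFactor (Nat.mem_primeFactors.mpr ⟨hp, hd, hm⟩)) (by omega)

theorem two_pow_card_primeFactors_le {n : ℕ} (hn : n ≠ 0) :
    2 ^ #n.primeFactors ≤ #n.divisors := by
  rw [Nat.card_divisors hn]
  apply Finset.pow_card_le_prod
  intro p hp
  have := (Nat.prime_of_mem_primeFactors hp).factorization_pos_of_dvd hn
    (Nat.dvd_of_mem_primeFactors hp)
  omega

theorem sum_card_divisors_le (N : ℕ) :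
    ∑ n ∈ Icc 1 N, (#n.divisors : ℝ) ≤ N * (1 + log N) := by
  have h := ArithmeticFunction.sum_Ioc_sigma0_eq_sum_div N
  simp only [ArithmeticFunction.sigma_zero_apply] at h
  have h' : ∑ n ∈ Icc 1 N, (#n.divisors : ℝ) = ∑ n ∈ Icc 1 N, ((N / n : ℕ) : ℝ) := by
    exact_mod_cast h
  rw [h']
  have hh := harmonic_le_one_add_log N
  simp only [harmonic_eq_sum_Icc, Rat.cast_sum, Rat.cast_inv, Rat.cast_natCast] at hh
  calc _ ≤ ∑ n ∈ Icc 1 N, (N : ℝ) * (n : ℝ)⁻¹ := by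
        refine Finset.sum_le_sum fun n _ => ?_
        rw [← div_eq_mul_inv]
        exact Nat.cast_div_le
    _ ≤ _ := by rw [← Finset.mul_sum]; gcongr

theorem card_squarefree_smooth_le (N w : ℕ) {Z : ℕ} (hZ : 1 ≤ Z) :
    (#{n ∈ Icc 1 N | Squarefree n ∧ largestPrimeFactor n ≤ Z} : ℝ) ≤
      Z ^ w + N * (1 + log N) / 2 ^ w := by
  set S := {n ∈ Icc 1 N | Squarefree n ∧ largestPrimeFactor n ≤ Z} with hS
  have hpt : ∀ n ∈ S, n ∉ Icc 1 (Z ^ w) → (1 : ℝ) ≤ #n.divisors / 2 ^ w := by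
    intro n hn hnw
    rw [hS, Finset.mem_filter, Finset.mem_Icc] at hn
    rw [Finset.mem_Icc, not_and, not_le] at hnw
    have hlt := hnw hn.1.1
    rw [one_le_div (by positivity)]
    have hle : n ≤ Z ^ #n.primeFactors := by
      conv_lhs => rw [← Nat.prod_primeFactors_of_squarefree hn.2.1]
      exact Finset.prod_le_pow_card _ _ _ fun p hp => (le_largestPrimeFactor hp).trans hn.2.2
    have hw : w ≤ #n.primeFactors := by
      by_contra! h
      have := Nat.pow_le_pow_right hZ h.le
      omega
    have h2 := two_pow_card_primeFactors_le (show n ≠ 0 by omega)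
    have h3 : 2 ^ w ≤ #n.divisors := (Nat.pow_le_pow_right (by norm_num) hw).trans h2
    exact_mod_cast h3
  have h1 : (#{n ∈ S | n ∈ Icc 1 (Z ^ w)} : ℝ) ≤ Z ^ w := by
    have : #{n ∈ S | n ∈ Icc 1 (Z ^ w)} ≤ #(Icc 1 (Z ^ w)) :=
      Finset.card_le_card fun n hn => (Finset.mem_filter.mp hn).2
    rw [Nat.card_Icc, Nat.add_sub_cancel] at this
    exact_mod_cast this
  have h2 : (#{n ∈ S | n ∉ Icc 1 (Z ^ w)} : ℝ) ≤ N * (1 + log N) / 2 ^ w := by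
    calc (#{n ∈ S | n ∉ Icc 1 (Z ^ w)} : ℝ) = ∑ n ∈ S with n ∉ Icc 1 (Z ^ w), (1 : ℝ) := by simp
      _ ≤ ∑ n ∈ S with n ∉ Icc 1 (Z ^ w), (#n.divisors : ℝ) / 2 ^ w :=
          Finset.sum_le_sum fun n hn => hpt n (Finset.mem_filter.mp hn).1 (Finset.mem_filter.mp hn).2
      _ ≤ ∑ n ∈ Icc 1 N, (#n.divisors : ℝ) / 2 ^ w :=
          Finset.sum_le_sum_of_subset_of_nonneg
            (fun n hn => (Finset.mem_filter.mp (Finset.mem_filter.mp hn).1).1)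
            (fun n _ _ => by positivity)
      _ ≤ _ := by
          rw [← Finset.sum_div]
          gcongr
          exact sum_card_divisors_le N
  have := Finset.card_filter_add_card_filter_not (s := S) (fun n => n ∈ Icc 1 (Z ^ w))
  rw [← this]
  push_cast
  linarith

/-- The Möbius function restricted to `Y`-rough integers, twisted by a character. -/
noncomputable def roughMoebius {q : ℕ} (χ : DirichletCharacter ℂ q) (Y : ℝ) (n : ℕ) : ℂ :=
  χ n * (((ArithmeticFunction.moebius n : ℝ) * YInd Y n : ℝ) : ℂ)

theorem abs_moebius_mul_YInd_le (Y : ℝ) (n : ℕ) :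
    |(ArithmeticFunction.moebius n : ℝ) * YInd Y n| ≤ 1 := by
  have h1 : |(ArithmeticFunction.moebius n : ℝ)| ≤ 1 := by
    exact_mod_cast ArithmeticFunction.abs_moebius_le_one (n := n)
  have h2 : |YInd Y n| ≤ 1 := by
    unfold YInd; split_ifs <;> simp
  rw [abs_mul]
  exact mul_le_one₀ h1 (abs_nonneg _) h2

theorem norm_roughMoebius_le {q : ℕ} (χ : DirichletCharacter ℂ q) (Y : ℝ) (n : ℕ) :
    ‖roughMoebius χ Y n‖ ≤ 1 := by
  unfold roughMoebius
  rw [norm_mul, Complex.norm_real]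
  exact mul_le_one₀ (χ.norm_le_one n) (norm_nonneg _) (abs_moebius_mul_YInd_le Y n)

theorem roughMoebius_eq_zero {q : ℕ} (χ : DirichletCharacter ℂ q) (Y : ℝ) {n : ℕ}
    (hn : ¬ Squarefree n) : roughMoebius χ Y n = 0 := by
  simp [roughMoebius, ArithmeticFunction.moebius_eq_zero_of_not_squarefree hn]

theorem roughMoebius_mul_prime {q : ℕ} (χ : DirichletCharacter ℂ q) (Y : ℝ) {m p : ℕ}
    (hm : m ≠ 0) (hp : p.Prime) (h : largestPrimeFactor m < p) :
    roughMoebius χ Y (m * p) = if Y ≤ p then -(roughMoebius χ Y m * χ p) else 0 := by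
  have hY : YInd Y (m * p) = if Y ≤ p then YInd Y m else 0 := by
    unfold YInd
    rw [Nat.primeFactors_mul hm hp.ne_zero, hp.primeFactors]
    simp only [Finset.mem_union, Finset.mem_singleton, or_imp, forall_and, forall_eq]
    split_ifs <;> tauto
  unfold roughMoebius
  rw [ArithmeticFunction.isMultiplicative_moebius.map_mul_of_coprime
    (coprime_of_largestPrimeFactor_lt hm hp h), ArithmeticFunction.moebius_apply_prime hp, hY,
    Nat.cast_mul, map_mul]
  split_ifs
  · push_cast; ring
  · simp

theorem sum_roughMoebius_eq {q : ℕ} (χ : DirichletCharacter ℂ q) (Y : ℝ) (N Z : ℕ) :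
    ∑ n ∈ Icc 1 N with Z < largestPrimeFactor n, roughMoebius χ Y n =
      -∑ m ∈ Icc 1 N, roughMoebius χ Y m *
        ∑ p ∈ Ioc (max Z (max (largestPrimeFactor m) (⌈Y⌉₊ - 1))) (N / m) with p.Prime, χ p := by
  set P : Finset (Σ _ : ℕ, ℕ) := (Icc 1 N).sigma fun m =>
    {p ∈ Ioc (max Z (largestPrimeFactor m)) (N / m) | p.Prime} with hP
  have hPmem : ∀ x : Σ _ : ℕ, ℕ, x ∈ P ↔ (1 ≤ x.1 ∧ x.1 ≤ N) ∧
      ((Z < x.2 ∧ largestPrimeFactor x.1 < x.2) ∧ x.2 * x.1 ≤ N) ∧ x.2.Prime := by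
    intro x
    rw [hP, Finset.mem_sigma, Finset.mem_Icc, Finset.mem_filter, Finset.mem_Ioc, max_lt_iff]
    constructor
    · rintro ⟨h1, ⟨h2, h3⟩, h4⟩
      exact ⟨h1, ⟨h2, (Nat.le_div_iff_mul_le h1.1).mp h3⟩, h4⟩
    · rintro ⟨h1, ⟨h2, h3⟩, h4⟩
      exact ⟨h1, ⟨h2, (Nat.le_div_iff_mul_le h1.1).mpr h3⟩, h4⟩
  have hinj : Set.InjOn (fun x : Σ _ : ℕ, ℕ => x.1 * x.2) P := by
    rintro ⟨m, p⟩ hx ⟨m', p'⟩ hx' h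
    rw [Finset.mem_coe, hPmem] at hx hx'
    simp only at h hx hx'
    have e1 := largestPrimeFactor_mul_prime (by omega) hx.2.2 hx.2.1.1.2
    have e2 := largestPrimeFactor_mul_prime (by omega) hx'.2.2 hx'.2.1.1.2
    have e : p = p' := by rw [← e1, h, e2]
    subst e
    have : m = m' := Nat.eq_of_mul_eq_mul_right hx.2.2.pos h
    subst this
    rfl
  have hsub : P.image (fun x => x.1 * x.2) ⊆ {n ∈ Icc 1 N | Z < largestPrimeFactor n} := by
    intro n hn
    obtain ⟨⟨m, p⟩, hx, rfl⟩ := Finset.mem_image.mp hn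
    rw [hPmem] at hx
    simp only at hx ⊢
    rw [Finset.mem_filter, Finset.mem_Icc,
      largestPrimeFactor_mul_prime (by omega) hx.2.2 hx.2.1.1.2]
    refine ⟨⟨Nat.mul_pos hx.1.1 hx.2.2.pos, ?_⟩, hx.2.1.1.1⟩
    rw [mul_comm]; exact hx.2.1.2
  rw [← Finset.sum_subset hsub, Finset.sum_image hinj, hP, Finset.sum_sigma,
    ← Finset.sum_neg_distrib]
  · refine Finset.sum_congr rfl fun m hm => ?_
    rw [Finset.mem_Icc] at hm
    have hset : ({p ∈ Ioc (max Z (max (largestPrimeFactor m) (⌈Y⌉₊ - 1))) (N / m) | p.Prime} :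
        Finset ℕ) =
        {p ∈ ({p ∈ Ioc (max Z (largestPrimeFactor m)) (N / m) | p.Prime} : Finset ℕ) | Y ≤ ((p : ℕ) : ℝ)} := by
      ext p
      simp only [Finset.mem_filter, Finset.mem_Ioc, max_lt_iff]
      have : p.Prime → (⌈Y⌉₊ - 1 < p ↔ Y ≤ p) := by
        intro hp
        rw [← Nat.ceil_le]
        have := hp.pos
        omega
      tauto
    rw [hset, Finset.sum_filter _ (fun p : ℕ => χ p), Finset.mul_sum, ← Finset.sum_neg_distrib]
    refine Finset.sum_congr rfl fun p hp => ?_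
    rw [Finset.mem_filter, Finset.mem_Ioc, max_lt_iff] at hp
    simp only
    rw [roughMoebius_mul_prime χ Y (by omega) hp.2 hp.1.1.2]
    split_ifs <;> simp
  · intro n hn hnot
    rw [Finset.mem_filter, Finset.mem_Icc] at hn
    by_contra hne
    have hsq : Squarefree n := by
      by_contra hns
      exact hne (roughMoebius_eq_zero χ Y hns)
    have hn1 : 1 < n := by
      by_contra! h
      have : n = 1 := by omega
      subst this
      simp [largestPrimeFactor] at hn
    have hmem := largestPrimeFactor_mem hn1
    set p := largestPrimeFactor n with hp
    have hpp := Nat.prime_of_mem_primeFactors hmem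
    obtain ⟨m, hm⟩ := Nat.dvd_of_mem_primeFactors hmem
    have hm0 : 1 ≤ m := by
      rcases Nat.eq_zero_or_pos m with h | h
      · subst h; omega
      · exact h
    have hcop : p.Coprime m := by
      rw [hm] at hsq
      exact Nat.coprime_of_squarefree_mul hsq
    have hlt : largestPrimeFactor m < p := by
      rcases Nat.eq_or_lt_of_le hm0 with h | h
      · rw [← h]; simpa [largestPrimeFactor] using hpp.pos
      have hmm := largestPrimeFactor_mem h
      have hmn : largestPrimeFactor m ∈ n.primeFactors :=
        Nat.primeFactors_mono ⟨p, by rw [hm, mul_comm]⟩ (by omega) hmm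
      refine lt_of_le_of_ne (le_largestPrimeFactor hmn) fun heq => ?_
      have hd := Nat.dvd_of_mem_primeFactors hmm
      rw [heq] at hd
      exact (hpp.coprime_iff_not_dvd.mp hcop) hd
    refine hnot (Finset.mem_image.mpr ⟨⟨m, p⟩, (hPmem _).mpr ?_, by rw [hm, mul_comm]⟩)
    have : m ≤ n := by rw [hm]; exact Nat.le_mul_of_pos_left m hpp.pos
    exact ⟨⟨hm0, by simp only; omega⟩, ⟨⟨hn.2, hlt⟩, by simp only; omega⟩, hpp⟩

theorem exists_norm_sum_roughMoebius_le (m : ℕ) : ∃ C : ℝ, 0 < C ∧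
    ∀ (q : ℕ) [NeZero q] (χ : DirichletCharacter ℂ q), χ ≠ 1 → ∀ (Y : ℝ) (N Z w : ℕ), 3 ≤ Z →
    ‖∑ n ∈ Icc 1 N, roughMoebius χ Y n‖ ≤ Z ^ w + N * (1 + log N) *
      (1 / 2 ^ w + C * log N ^ (m + 1) * √q / log Z ^ (2 * (m + 1))) := by
  obtain ⟨C, hC, h⟩ := exists_norm_sum_prime_le m
  refine ⟨C, hC, fun q _ χ hχ Y N Z w hZ => ?_⟩
  have hZ3 : (3 : ℝ) ≤ Z := by exact_mod_cast hZ
  have hlogZ : 0 < log Z := Real.log_pos (by linarith)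
  have hlogN : 0 ≤ log N := Real.log_natCast_nonneg N
  have hsplit := Finset.sum_filter_add_sum_filter_not (Icc 1 N)
    (fun n => Z < largestPrimeFactor n) (fun n => roughMoebius χ Y n)
  have h1 : ‖∑ n ∈ Icc 1 N with ¬ Z < largestPrimeFactor n, roughMoebius χ Y n‖ ≤
      Z ^ w + N * (1 + log N) / 2 ^ w := by
    refine le_trans ?_ (card_squarefree_smooth_le N w (by omega : 1 ≤ Z))
    have hsub : {n ∈ Icc 1 N | Squarefree n ∧ largestPrimeFactor n ≤ Z} ⊆
        {n ∈ Icc 1 N | ¬ Z < largestPrimeFactor n} := by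
      intro n hn
      rw [Finset.mem_filter] at hn ⊢
      exact ⟨hn.1, not_lt.mpr hn.2.2⟩
    rw [← Finset.sum_subset hsub]
    · refine (norm_sum_le_of_le _ fun n _ => norm_roughMoebius_le χ Y n).trans ?_
      simp
    · intro n hn hnot
      rw [Finset.mem_filter] at hn hnot
      apply roughMoebius_eq_zero
      exact fun hs => hnot ⟨hn.1, hs, not_lt.mp hn.2⟩
  set E := C * log N ^ (m + 1) * √q / log Z ^ (2 * (m + 1)) with hE
  have hE0 : 0 ≤ E := by positivity
  have h2 : ‖∑ n ∈ Icc 1 N with Z < largestPrimeFactor n, roughMoebius χ Y n‖ ≤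
      N * (1 + log N) * E := by
    rw [sum_roughMoebius_eq, norm_neg]
    have hh := harmonic_le_one_add_log N
    simp only [harmonic_eq_sum_Icc, Rat.cast_sum, Rat.cast_inv, Rat.cast_natCast] at hh
    calc _ ≤ ∑ n ∈ Icc 1 N, (N : ℝ) * E * (n : ℝ)⁻¹ := by
          refine norm_sum_le_of_le _ fun n hn => ?_
          rw [Finset.mem_Icc] at hn
          rw [norm_mul]
          have t1 := h q χ hχ Z (max Z (max (largestPrimeFactor n) (⌈Y⌉₊ - 1))) (N / n) hZ
            (le_max_left _ _)
          have t2 := norm_roughMoebius_le χ Y n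
          have hn0 : (0 : ℝ) < n := by exact_mod_cast hn.1
          have hNn : 0 < N / n := Nat.div_pos hn.2 hn.1
          have t3 : C * (N / n : ℕ) * log (N / n : ℕ) ^ (m + 1) * √q / log Z ^ (2 * (m + 1)) ≤
              N * E * (n : ℝ)⁻¹ := by
            have a1 : ((N / n : ℕ) : ℝ) ≤ N / n := Nat.cast_div_le
            have a2 : log (N / n : ℕ) ≤ log N :=
              Real.log_le_log (by exact_mod_cast hNn) (by exact_mod_cast Nat.div_le_self N n)
            have a3 : 0 ≤ log (N / n : ℕ) := Real.log_natCast_nonneg _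
            calc _ ≤ C * (N / n) * log N ^ (m + 1) * √q / log Z ^ (2 * (m + 1)) := by gcongr
              _ = _ := by rw [hE]; field_simp
          calc _ ≤ 1 * (N * E * (n : ℝ)⁻¹) :=
                mul_le_mul t2 (t1.trans t3) (norm_nonneg _) zero_le_one
            _ = _ := one_mul _
      _ ≤ N * E * (1 + log N) := by rw [← Finset.mul_sum]; gcongr
      _ = _ := by ring
  rw [← hsplit]
  refine (norm_add_le _ _).trans ((add_le_add h2 h1).trans (le_of_eq ?_))
  ring

/-! ### The Siegel–Walfisz bound -/

theorem exists_rpow_le_mul_exp (a : ℝ) {b : ℝ} (hb : 0 < b) : ∃ C : ℝ, 0 < C ∧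
    ∀ t : ℝ, 1 ≤ t → t ^ a ≤ C * exp (b * t) := by
  obtain ⟨k, hk⟩ := exists_nat_ge a
  refine ⟨k.factorial / b ^ k, by positivity, fun t ht => ?_⟩
  have h1 : t ^ a ≤ t ^ k := by
    rw [← Real.rpow_natCast]
    exact Real.rpow_le_rpow_of_exponent_le ht hk
  have h2 := Real.pow_div_factorial_le_exp (b * t) (by positivity) k
  rw [div_le_iff₀ (by positivity), mul_pow] at h2
  refine h1.trans ?_
  rw [div_mul_eq_mul_div, le_div_iff₀ (by positivity)]
  linarith

theorem exists_norm_sum_roughMoebius_le_div_log (A : ℝ) : ∃ C : ℝ, 0 < C ∧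
    ∀ (q : ℕ) [NeZero q] (χ : DirichletCharacter ℂ q), χ ≠ 1 → ∀ (Y x : ℝ), 1 ≤ x →
    (q : ℝ) ≤ log (3 * x) ^ A →
    ‖∑ n ∈ Icc 1 ⌊x⌋₊, roughMoebius χ Y n‖ ≤ C * x / log (3 * x) ^ A := by
  obtain ⟨m, hm⟩ := exists_nat_ge (2 + 3 * A)
  obtain ⟨C, hC, h⟩ := exists_norm_sum_roughMoebius_le m
  obtain ⟨C₁, hC₁, h₁⟩ := exists_rpow_le_mul_exp (4 + 4 * A) (b := 1 / 16) (by norm_num)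
  obtain ⟨C₂, hC₂, h₂⟩ := exists_rpow_le_mul_exp A (b := 3 / 4) (by norm_num)
  refine ⟨3 * C₂ + 2 * (exp (1 / 2) * C₁ + C), by positivity, fun q _ χ hχ Y x hx hqx => ?_⟩
  set L := log (3 * x) with hL
  have hL1 : 1 ≤ L := by
    rw [hL, Real.le_log_iff_exp_le (by linarith)]
    linarith [Real.exp_one_lt_d9]
  have hexpL : exp L = 3 * x := Real.exp_log (by linarith)
  set l := L ^ (1 / 4 : ℝ) with hl
  have hl1 : 1 ≤ l := Real.one_le_rpow hL1 (by norm_num)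
  have hl0 : 0 < l := by linarith
  have hl4 : l ^ 4 = L := by
    rw [hl, ← Real.rpow_natCast, ← Real.rpow_mul (by linarith)]; norm_num
  have hLA : L ^ A = l ^ (4 * A) := by
    rw [Real.rpow_mul hl0.le, ← hl4]; norm_num
  set Z := ⌈exp (l ^ 3)⌉₊ with hZ
  set w := ⌊l / 8⌋₊ with hw
  have hl3 : 1 ≤ l ^ 3 := one_le_pow₀ hl1
  have hZ3 : 3 ≤ Z := by
    have : (2 : ℕ) < Z := by
      rw [hZ, Nat.lt_ceil]
      have := Real.exp_one_gt_d9
      have h2 := Real.exp_le_exp.mpr hl3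
      push_cast
      linarith
    exact this
  have hZlow : exp (l ^ 3) ≤ Z := Nat.le_ceil _
  have hlogZ : l ^ 3 ≤ log Z := by
    rw [Real.le_log_iff_exp_le ((exp_pos _).trans_le hZlow)]; exact hZlow
  have hZup : (Z : ℝ) ≤ exp (2 * l ^ 3) := by
    have h1 := (Nat.ceil_lt_add_one (exp_pos (l ^ 3)).le).le
    have h2 : 2 ≤ exp (l ^ 3) := by
      linarith [Real.exp_one_gt_d9, Real.exp_le_exp.mpr hl3]
    have h3 : exp (2 * l ^ 3) = exp (l ^ 3) * exp (l ^ 3) := by rw [← Real.exp_add]; ring_nf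
    rw [h3]
    change (Z : ℝ) ≤ _
    nlinarith
  have hZw : (Z : ℝ) ^ w ≤ exp (L / 4) := by
    calc (Z : ℝ) ^ w ≤ exp (2 * l ^ 3) ^ w := by gcongr
      _ = exp (w * (2 * l ^ 3)) := (Real.exp_nat_mul _ _).symm
      _ ≤ exp (L / 4) := by
          rw [Real.exp_le_exp]
          have : (w : ℝ) ≤ l / 8 := Nat.floor_le (by positivity)
          calc (w : ℝ) * (2 * l ^ 3) ≤ l / 8 * (2 * l ^ 3) := by gcongr
            _ = l ^ 4 / 4 := by ring
            _ = L / 4 := by rw [hl4]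
  have h2w : 1 / (2 : ℝ) ^ w ≤ exp (1 / 2) * exp (-(1 / 16 * l)) := by
    have e1 : exp (1 / 2) ≤ 2 := by
      have : exp (1 / 2) * exp (1 / 2) = exp 1 := by rw [← Real.exp_add]; norm_num
      nlinarith [Real.exp_one_lt_d9, exp_pos (1 / 2)]
    have e2 : exp (w * (1 / 2)) ≤ 2 ^ w := by
      rw [Real.exp_nat_mul]; gcongr
    have e3 : l / 8 ≤ w + 1 := (Nat.lt_floor_add_one _).le
    calc 1 / (2 : ℝ) ^ w ≤ 1 / exp (w * (1 / 2)) := by gcongr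
      _ = exp (-(w * (1 / 2))) := by rw [Real.exp_neg, one_div]
      _ ≤ exp (1 / 2 + -(1 / 16 * l)) := by rw [Real.exp_le_exp]; linarith
      _ = _ := Real.exp_add _ _
  set N := ⌊x⌋₊ with hN
  have hNx : (N : ℝ) ≤ x := Nat.floor_le (by linarith)
  have hlogN0 : 0 ≤ log (N : ℝ) := Real.log_natCast_nonneg N
  have hlogN : log (N : ℝ) ≤ L := by
    have : 0 < N := Nat.floor_pos.mpr hx
    exact Real.log_le_log (by exact_mod_cast this) (by linarith)
  have hq : √(q : ℝ) ≤ l ^ (2 * A) := by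
    have e : l ^ (2 * A) = √(L ^ A) := by
      rw [Real.sqrt_eq_rpow, hLA, ← Real.rpow_mul hl0.le]; ring_nf
    rw [e]
    exact Real.sqrt_le_sqrt hqx
  have hT : C * log N ^ (m + 1) * √q / log Z ^ (2 * (m + 1)) ≤ C * l ^ (-(4 + 4 * A)) := by
    calc C * log N ^ (m + 1) * √q / log Z ^ (2 * (m + 1))
        ≤ C * L ^ (m + 1) * l ^ (2 * A) / (l ^ 3) ^ (2 * (m + 1)) := by gcongr
      _ = C * l ^ (4 * (m + 1 : ℝ) + 2 * A - 6 * (m + 1 : ℝ)) := by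
          rw [← hl4, Real.rpow_sub hl0, Real.rpow_add hl0, ← pow_mul, ← pow_mul,
            ← Real.rpow_natCast l (4 * (m + 1)), ← Real.rpow_natCast l (3 * (2 * (m + 1)))]
          push_cast
          ring_nf
      _ ≤ C * l ^ (-(4 + 4 * A)) := by
          refine mul_le_mul_of_nonneg_left
            (Real.rpow_le_rpow_of_exponent_le hl1 (by linarith)) hC.le
  have hmain := h q χ hχ Y N Z w hZ3
  have hneg : ∀ a : ℝ, l ^ (-a) = (l ^ a)⁻¹ := fun a => Real.rpow_neg hl0.le a
  have hE : exp (-(1 / 16 * l)) ≤ C₁ * l ^ (-(4 + 4 * A)) := by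
    have := h₁ l hl1
    rw [hneg, Real.exp_neg, ← div_eq_mul_inv, inv_eq_one_div,
      div_le_div_iff₀ (exp_pos _) (by positivity)]
    linarith
  have hfirst : exp (L / 4) ≤ 3 * C₂ * x / L ^ A := by
    have := h₂ L hL1
    rw [le_div_iff₀ (by positivity)]
    calc exp (L / 4) * L ^ A ≤ exp (L / 4) * (C₂ * exp (3 / 4 * L)) := by gcongr
      _ = C₂ * exp L := by
          rw [mul_left_comm, ← Real.exp_add]; ring_nf
      _ = _ := by rw [hexpL]; ring
  calc _ ≤ _ := hmain
    _ ≤ exp (L / 4) + x * (2 * L) * (exp (1 / 2) * (C₁ * l ^ (-(4 + 4 * A))) +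
        C * l ^ (-(4 + 4 * A))) := by
        have : 1 + log (N : ℝ) ≤ 2 * L := by linarith
        gcongr
        exact h2w.trans (by gcongr)
    _ ≤ 3 * C₂ * x / L ^ A + 2 * (exp (1 / 2) * C₁ + C) * x / L ^ A := by
        refine add_le_add hfirst (le_of_eq ?_)
        rw [hLA, hneg, ← hl4, Real.rpow_add hl0]
        have : l ^ (4 : ℝ) = l ^ 4 := by norm_cast
        rw [this]
        field_simp
    _ = _ := by ring

theorem card_filter_mod_eq_le (a : ℤ) (q : ℕ) (N : ℕ) :
    #((Icc 1 N).filter (fun n : ℕ => (n : ℤ) % q = a % q)) ≤ N / q + 1 := by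
  rw [← Finset.card_range (N / q + 1)]
  refine Finset.card_le_card_of_injOn (fun n => n / q) ?_ ?_
  · intro n hn
    rw [Finset.mem_coe, Finset.mem_filter, Finset.mem_Icc] at hn
    have := Nat.div_le_div_right (c := q) hn.1.2
    rw [Finset.mem_coe, Finset.mem_range]
    simp only
    omega
  · intro n hn n' hn' h
    rw [Finset.mem_coe, Finset.mem_filter] at hn hn'
    have h1 : n % q = n' % q := by
      have := hn.2.trans hn'.2.symm
      exact_mod_cast this
    simp only at h
    rw [← Nat.div_add_mod n q, ← Nat.div_add_mod n' q, h, h1]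

theorem card_filter_coprime_le {q : ℕ} (hq : 1 ≤ q) (N : ℕ) :
    #{n ∈ Icc 1 N | n.Coprime q} ≤ q.totient * (N / q + 1) := by
  have := Nat.Ico_filter_coprime_le (a := q) 1 N (by omega)
  have e : {n ∈ Icc 1 N | n.Coprime q} = {n ∈ Ico 1 (1 + N) | q.Coprime n} := by
    ext n
    simp only [Finset.mem_filter, Finset.mem_Icc, Finset.mem_Ico, Nat.coprime_comm (m := n)]
    refine and_congr_left fun _ => ?_
    omega
  rw [e]; exact this

theorem abs_sum_sub_le_of_abs_le_one {f : ℕ → ℝ} (hf : ∀ n, |f n| ≤ 1) (a : ℤ) {q : ℕ}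
    (hq : 1 ≤ q) (N : ℕ) :
    |∑ n ∈ (Icc 1 N).filter (fun n : ℕ => (n : ℤ) % q = a % q), f n -
      (1 / (q.totient : ℝ)) * ∑ n ∈ Icc 1 N with n.Coprime q, f n| ≤ 2 * (N / q + 1) := by
  have hφ : (0 : ℝ) < q.totient := by exact_mod_cast Nat.totient_pos.mpr hq
  have hfloor : ((N / q : ℕ) : ℝ) ≤ N / q := Nat.cast_div_le
  have hcard : ∀ s : Finset ℕ, |∑ n ∈ s, f n| ≤ #s := fun s => by
    refine (Finset.abs_sum_le_sum_abs _ _).trans ((Finset.sum_le_sum fun n _ => hf n).trans ?_)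
    simp
  have h1 : |∑ n ∈ (Icc 1 N).filter (fun n : ℕ => (n : ℤ) % q = a % q), f n| ≤ N / q + 1 := by
    refine (hcard _).trans ?_
    have : (#((Icc 1 N).filter (fun n : ℕ => (n : ℤ) % q = a % q)) : ℝ) ≤ (N / q : ℕ) + 1 := by
      exact_mod_cast card_filter_mod_eq_le a q N
    linarith
  have h2 : |(1 / (q.totient : ℝ)) * ∑ n ∈ Icc 1 N with n.Coprime q, f n| ≤ N / q + 1 := by
    rw [abs_mul, abs_of_pos (by positivity), one_div, inv_mul_le_iff₀ hφ]
    refine (hcard _).trans ?_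
    have : (#{n ∈ Icc 1 N | n.Coprime q} : ℝ) ≤ q.totient * ((N / q : ℕ) + 1) := by
      exact_mod_cast card_filter_coprime_le hq N
    refine this.trans ?_
    gcongr
  have := abs_sub (∑ n ∈ (Icc 1 N).filter (fun n : ℕ => (n : ℤ) % q = a % q), f n)
    ((1 / (q.totient : ℝ)) * ∑ n ∈ Icc 1 N with n.Coprime q, f n)
  linarith

/-- Character orthogonality bounds the discrepancy in an arithmetic progression by the twisted sums
over nontrivial characters. -/
theorem abs_sum_sub_le_of_characters {f : ℕ → ℝ} {a : ℤ} {q : ℕ} [NeZero q]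
    (ha : Int.gcd a q = 1) (N : ℕ) {B : ℝ} (hB0 : 0 ≤ B)
    (hB : ∀ χ : DirichletCharacter ℂ q, χ ≠ 1 → ‖∑ n ∈ Icc 1 N, χ n * (f n : ℂ)‖ ≤ B) :
    |∑ n ∈ (Icc 1 N).filter (fun n : ℕ => (n : ℤ) % q = a % q), f n -
      (1 / (q.totient : ℝ)) * ∑ n ∈ Icc 1 N with n.Coprime q, f n| ≤ B := by
  classical
  have hφ : (0 : ℝ) < q.totient := by exact_mod_cast Nat.totient_pos.mpr (NeZero.pos q)
  have hφc : (q.totient : ℂ) ≠ 0 := by exact_mod_cast hφ.ne'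
  have hau : IsUnit (a : ZMod q) := by
    rw [ZMod.coe_int_isUnit_iff_isCoprime, isCoprime_comm, Int.isCoprime_iff_gcd_eq_one]
    exact ha
  have hau' : IsUnit ((a : ZMod q)⁻¹) := by
    obtain ⟨u, hu⟩ := hau
    rw [← hu, ZMod.inv_coe_unit]
    exact u⁻¹.isUnit
  have hind : ∀ n : ℕ, (if (n : ℤ) % q = a % q then (f n : ℂ) else 0) =
      (1 / (q.totient : ℂ)) *
        ∑ χ : DirichletCharacter ℂ q, χ (a : ZMod q)⁻¹ * (χ n * (f n : ℂ)) := by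
    intro n
    simp_rw [← mul_assoc]
    rw [← Finset.sum_mul, DirichletCharacter.sum_char_inv_mul_char_eq ℂ hau]
    have : (a : ZMod q) = (n : ZMod q) ↔ (n : ℤ) % q = a % q := by
      rw [← Int.cast_natCast n, ZMod.intCast_eq_intCast_iff']
      exact eq_comm
    simp only [this]
    split_ifs
    · field_simp
    · simp
  have hfirst : ((∑ n ∈ (Icc 1 N).filter (fun n : ℕ => (n : ℤ) % q = a % q), f n : ℝ) : ℂ) =
      (1 / (q.totient : ℂ)) * ∑ χ : DirichletCharacter ℂ q, χ (a : ZMod q)⁻¹ *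
        ∑ n ∈ Icc 1 N, χ n * (f n : ℂ) := by
    rw [Complex.ofReal_sum, Finset.sum_filter, Finset.sum_congr rfl fun n _ => hind n,
      ← Finset.mul_sum, Finset.sum_comm]
    simp_rw [Finset.mul_sum]
  have hone : ((∑ n ∈ Icc 1 N with n.Coprime q, f n : ℝ) : ℂ) =
      (1 : DirichletCharacter ℂ q) (a : ZMod q)⁻¹ *
        ∑ n ∈ Icc 1 N, (1 : DirichletCharacter ℂ q) n * (f n : ℂ) := by
    rw [MulChar.one_apply hau', one_mul, Complex.ofReal_sum, Finset.sum_filter]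
    refine Finset.sum_congr rfl fun n _ => ?_
    split_ifs with h
    · rw [MulChar.one_apply ((ZMod.isUnit_iff_coprime n q).mpr h), one_mul]
    · rw [MulChar.map_nonunit _ (fun h' => h ((ZMod.isUnit_iff_coprime n q).mp h')), zero_mul]
  have hdiff : ((∑ n ∈ (Icc 1 N).filter (fun n : ℕ => (n : ℤ) % q = a % q), f n -
      (1 / (q.totient : ℝ)) * ∑ n ∈ Icc 1 N with n.Coprime q, f n : ℝ) : ℂ) =
      (1 / (q.totient : ℂ)) * ∑ χ ∈ Finset.univ.erase (1 : DirichletCharacter ℂ q),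
        χ (a : ZMod q)⁻¹ * ∑ n ∈ Icc 1 N, χ n * (f n : ℂ) := by
    rw [Complex.ofReal_sub, Complex.ofReal_mul, hfirst, hone,
      ← Finset.add_sum_erase _ _ (Finset.mem_univ (1 : DirichletCharacter ℂ q))]
    push_cast
    ring
  have hcard : (#(Finset.univ.erase (1 : DirichletCharacter ℂ q)) : ℝ) ≤ q.totient := by
    have h1 := DirichletCharacter.card_eq_totient_of_hasEnoughRootsOfUnity ℂ q
    rw [Nat.card_eq_fintype_card] at h1
    have h2 := Finset.card_erase_le (s := Finset.univ) (a := (1 : DirichletCharacter ℂ q))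
    rw [Finset.card_univ, h1] at h2
    exact_mod_cast h2
  rw [← Real.norm_eq_abs, ← Complex.norm_real, hdiff, norm_mul, norm_div, norm_one,
    Complex.norm_natCast, one_div, inv_mul_le_iff₀ hφ]
  calc _ ≤ ∑ χ ∈ Finset.univ.erase (1 : DirichletCharacter ℂ q), B := by
        refine norm_sum_le_of_le _ fun χ hχ => ?_
        rw [norm_mul]
        calc _ ≤ 1 * B := mul_le_mul (χ.norm_le_one _) (hB χ (Finset.ne_of_mem_erase hχ))
              (norm_nonneg _) zero_le_one
          _ = B := one_mul B
    _ = #(Finset.univ.erase (1 : DirichletCharacter ℂ q)) * B := by simp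
    _ ≤ q.totient * B := by gcongr

end SiegelWalfisz

open SiegelWalfisz

/-- Siegel–Walfisz theorem for the Möbius function restricted to integers free of prime
factors below `Y₀`, uniform in `Y₀`: for every `A > 0` there is `C(A)` such that for all
`Y₀ > 1`, `x ≥ 1` and coprime `a`, `q` with `q ≥ 1`,
`|∑_{n≤x, n≡a (q), P⁻(n)≥Y₀} μ(n) − (1/φ(q)) ∑_{n≤x,(n,q)=1, P⁻(n)≥Y₀} μ(n)|
  ≤ C(A) x/(log 3x)^A`. -/
theorem stmt_15 (A : ℝ) (hA : 0 < A) :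
    ∃ C : ℝ, 0 < C ∧ ∀ (Y₀ x : ℝ) (a : ℤ) (q : ℕ), 1 < Y₀ → 1 ≤ x → 1 ≤ q →
      Int.gcd a q = 1 →
      |(∑ n ∈ (Finset.Icc 1 ⌊x⌋₊).filter (fun n : ℕ => (n : ℤ) % q = a % q),
          (ArithmeticFunction.moebius n : ℝ) * YInd Y₀ n)
        - (1 / (Nat.totient q : ℝ)) *
            ∑ n ∈ (Finset.Icc 1 ⌊x⌋₊).filter (fun n => Nat.Coprime n q),
              (ArithmeticFunction.moebius n : ℝ) * YInd Y₀ n|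
      ≤ C * x / Real.log (3 * x) ^ A := by
  obtain ⟨C, hC, h⟩ := exists_norm_sum_roughMoebius_le_div_log A
  obtain ⟨C₁, hC₁, h₁⟩ := exists_rpow_le_mul_exp A one_pos
  refine ⟨C + 2 * (1 + 3 * C₁), by positivity, fun Y x a q _ hx hq ha => ?_⟩
  have : NeZero q := ⟨by omega⟩
  have hL1 : 1 ≤ log (3 * x) := by
    rw [Real.le_log_iff_exp_le (by linarith)]
    linarith [Real.exp_one_lt_d9]
  have hLA : 0 < log (3 * x) ^ A := by positivity
  rcases le_or_gt (q : ℝ) (log (3 * x) ^ A) with hqA | hqA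
  · refine (abs_sum_sub_le_of_characters ha ⌊x⌋₊ (B := C * x / log (3 * x) ^ A) (by positivity)
      fun χ hχ => h q χ hχ Y x hx hqA).trans ?_
    gcongr
    have : 0 < C₁ := hC₁
    linarith
  · refine (abs_sum_sub_le_of_abs_le_one (abs_moebius_mul_YInd_le Y) a hq ⌊x⌋₊).trans ?_
    have hN : (⌊x⌋₊ : ℝ) ≤ x := Nat.floor_le (by linarith)
    have e1 : (⌊x⌋₊ : ℝ) / q ≤ x / log (3 * x) ^ A := by gcongr
    have e2 : 1 ≤ 3 * C₁ * x / log (3 * x) ^ A := by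
      have := h₁ _ hL1
      rw [one_mul, Real.exp_log (by linarith)] at this
      rw [le_div_iff₀ hLA]
      linarith
    have e3 : 0 ≤ C * x / log (3 * x) ^ A := by positivity
    have e4 : (C + 2 * (1 + 3 * C₁)) * x / log (3 * x) ^ A = C * x / log (3 * x) ^ A +
        2 * (x / log (3 * x) ^ A + 3 * C₁ * x / log (3 * x) ^ A) := by ring
    rw [e4]
    linarith
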